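/- arXiv:1805.03097 — 2 statements merged into one kernel-verified Lean document; each statement's English description precedes it below -/
import Mathlib

section
/- Let q ≥ 13 be a prime power and let φ = f/g ∈ F_q(x) be a separable rational function of degree 3, with f, g ∈ F_q[x] coprime. Let M be the splitting field of f(x) − t·g(x) over F_q(t), let k be its field of constants, and set G = Gal(M : F_q(t)) and N = Gal(M : k(t)). Then φ is a permutation rational function of P¹(F_q) if and only if G is isomorphic to the symmetric group S₃ and N is isomorphic to the alternating group A₃ (the cyclic group of order 3). -/
open Polynomial

noncomputable section

open scoped Classical in
/-- The self-map of `ℙ¹(F) = F ∪ {∞}` (encoded as `Option F`, with `none` = `∞`)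
induced by the rational function `f/g`, where `f, g` are coprime polynomials. -/
def ratEval {F : Type} [Field F] (f g : F[X]) : Option F → Option F := fun x =>
  match x with
  | some a => if g.eval a ≠ 0 then some (f.eval a / g.eval a) else none
  | none =>
      if g.natDegree < f.natDegree then none
      else if f.natDegree < g.natDegree then some 0
      else some (f.leadingCoeff / g.leadingCoeff)

/-- The polynomial `f(x) - t·g(x)` over the rational function field `F(t)`. -/
def fiberPoly {F : Type} [Field F] (f g : F[X]) : Polynomial (RatFunc F) :=
  f.map (algebraMap F (RatFunc F)) - Polynomial.C RatFunc.X * g.map (algebraMap F (RatFunc F))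

/-- `x` in the splitting field of `f - t·g` is a "constant", i.e. algebraic over `F`
(equivalently lies in the field of constants `k = M ∩ F̄`). -/
def isConstantElem {F : Type} [Field F] (f g : F[X])
    (x : (fiberPoly f g).SplittingField) : Prop :=
  ∃ P : F[X], P ≠ 0 ∧
    P.eval₂ ((algebraMap (RatFunc F) (fiberPoly f g).SplittingField).comp
      (algebraMap F (RatFunc F))) x = 0

/-- The subgroup `N = Gal(M : k(t))` of `G = Gal(M : F(t))`, consisting of those
automorphisms that fix the field of constants pointwise. -/
def constGal {F : Type} [Field F] (f g : F[X]) :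
    Subgroup ((fiberPoly f g).SplittingField ≃ₐ[RatFunc F] (fiberPoly f g).SplittingField) where
  carrier := {σ | ∀ x, isConstantElem f g x → σ x = x}
  one_mem' := fun x _ => rfl
  mul_mem' := by
    intro σ τ hσ hτ x hx
    have h1 : τ x = x := hτ x hx
    show σ (τ x) = x
    rw [h1]
    exact hσ x hx
  inv_mem' := by
    intro σ hσ x hx
    show σ⁻¹ x = x
    have h1 := hσ x hx
    calc σ⁻¹ x = σ⁻¹ (σ x) := by rw [h1]
      _ = x := σ.symm_apply_apply x

theorem prod_X_sub_C_eq_X_pow_card_sub_X (F : Type*) [Field F] [Fintype F] :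
    ∏ x : F, (X - C x) = (X ^ Fintype.card F - X : F[X]) := by
  have hm : (X ^ Fintype.card F - X : F[X]).Monic := by
    apply monic_X_pow_sub
    rw [degree_X]
    exact_mod_cast Fintype.one_lt_card
  have := prod_multiset_X_sub_C_of_monic_of_roots_card_eq hm (by
    rw [FiniteField.roots_X_pow_card_sub_X,
      FiniteField.X_pow_card_sub_X_natDegree_eq F Fintype.one_lt_card]; rfl)
  rwa [FiniteField.roots_X_pow_card_sub_X] at this

theorem prod_sub_algebraMap_eq_pow_card_sub {F L : Type*} [Field F] [Fintype F] [Field L]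
    [Algebra F L] (z : L) :
    ∏ x : F, (z - algebraMap F L x) = z ^ Fintype.card F - z := by
  simpa [map_prod] using congrArg (aeval z) (prod_X_sub_C_eq_X_pow_card_sub_X F)

theorem sum_inv_pow_of_prod {F L : Type*} [Fintype F] [Field L] (u : F → L)
    (e : L) (h1 : (∏ x, (1 + C (u x) * X)).coeff 1 = e)
    (h2 : (∏ x, (1 + C (u x) * X)).coeff 2 = 0) (h3 : (∏ x, (1 + C (u x) * X)).coeff 3 = 0) :
    ∑ x, u x = e ∧ ∑ x, u x ^ 2 = e ^ 2 ∧ ∑ x, u x ^ 3 = e ^ 3 := by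
  classical
  set E : L[X] := ∏ x, (1 + C (u x) * X) with hE
  let P : F → L[X] := fun x => ∏ y ∈ Finset.univ.erase x, (1 + C (u y) * X)
  have hEP : ∀ x, E = (1 + C (u x) * X) * P x := fun x =>
    (Finset.mul_prod_erase Finset.univ _ (Finset.mem_univ x)).symm
  have hP0 : ∀ x, (P x).coeff 0 = 1 := by
    intro x
    simp [P, coeff_zero_eq_eval_zero, eval_prod]
  have hder : derivative E = ∑ x, C (u x) * P x := by
    rw [hE, derivative_prod_finset]
    refine Finset.sum_congr rfl fun x _ => ?_
    rw [mul_comm, derivative_add, derivative_one, derivative_C_mul, derivative_X, mul_one, zero_add]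
  have key : ∀ x k, E.coeff (k + 1) = (P x).coeff (k + 1) + u x * (P x).coeff k := by
    intro x k
    rw [hEP x, add_mul, one_mul, coeff_add, mul_assoc, coeff_C_mul, coeff_X_mul]
  have hd : ∀ k, E.coeff (k + 1) * (k + 1) = ∑ x, u x * (P x).coeff k := by
    intro k
    rw [← coeff_derivative, hder]
    simp
  have d0 := hd 0
  have d1 := hd 1
  have d2 := hd 2
  have p1 : ∑ x, u x = e := by
    simpa [hP0, h1] using d0.symm
  have c1 : ∀ x, (P x).coeff 1 = e - u x := by
    intro x
    have := key x 0
    rw [hP0] at this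
    rw [← h1, this]; ring
  have c2 : ∀ x, (P x).coeff 2 = - u x * (e - u x) := by
    intro x
    have := key x 1
    rw [c1, h2] at this
    linear_combination -this
  have p2 : ∑ x, u x ^ 2 = e ^ 2 := by
    rw [h2] at d1
    have : ∑ x, u x * (P x).coeff 1 = e * ∑ x, u x - ∑ x, u x ^ 2 := by
      rw [Finset.mul_sum, ← Finset.sum_sub_distrib]
      exact Finset.sum_congr rfl fun x _ => by rw [c1]; ring
    rw [this, p1] at d1
    linear_combination d1
  refine ⟨p1, p2, ?_⟩
  rw [h3] at d2
  have : ∑ x, u x * (P x).coeff 2 = - e * ∑ x, u x ^ 2 + ∑ x, u x ^ 3 := by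
    rw [Finset.mul_sum, ← Finset.sum_add_distrib]
    exact Finset.sum_congr rfl fun x _ => by rw [c2]; ring
  rw [this, p2] at d2
  linear_combination -d2

theorem sum_inv_sub_pow {F L : Type*} [Field F] [Fintype F] [Field L] [Algebra F L]
    (hq : 4 ≤ Fintype.card F) (θ d : L) (hd : θ ^ Fintype.card F - θ = d) (hd0 : d ≠ 0) :
    ∑ x : F, (algebraMap F L x - θ)⁻¹ = d⁻¹ ∧ ∑ x : F, (algebraMap F L x - θ)⁻¹ ^ 2 = d⁻¹ ^ 2 ∧
      ∑ x : F, (algebraMap F L x - θ)⁻¹ ^ 3 = d⁻¹ ^ 3 := by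
  set q := Fintype.card F
  have hprod := prod_sub_algebraMap_eq_pow_card_sub (F := F) θ
  have hne : ∀ x : F, θ - algebraMap F L x ≠ 0 := by
    intro x hx
    apply hd0
    rw [← hd, ← hprod]
    exact Finset.prod_eq_zero (Finset.mem_univ x) hx
  have hfrob : (C θ - X : L[X]) ^ q = C (θ ^ q) - X ^ q := by
    obtain ⟨p, hp⟩ := CharP.exists F
    have : CharP L p := charP_of_injective_algebraMap (algebraMap F L).injective p
    have hpp : Fact p.Prime := ⟨CharP.char_is_prime F p⟩
    obtain ⟨n, -, hn⟩ := FiniteField.card F p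
    simp only [q, hn]
    rw [sub_pow_char_pow, C_pow]
  have hE : ∏ x : F, (1 + C ((algebraMap F L x - θ)⁻¹) * X) =
      1 + C d⁻¹ * X - C d⁻¹ * X ^ q := by
    have h1 : ∏ x : F, (1 + C ((algebraMap F L x - θ)⁻¹) * X) =
        C d⁻¹ * ∏ x : F, (C θ - X - C (algebraMap F L x)) := by
      have : C d⁻¹ = ∏ x : F, C (θ - algebraMap F L x)⁻¹ := by
        rw [← map_prod, Finset.prod_inv_distrib, hprod, hd]
      rw [this, ← Finset.prod_mul_distrib]
      refine Finset.prod_congr rfl fun x _ => ?_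
      have h2 : C (θ - algebraMap F L x)⁻¹ * C (θ - algebraMap F L x) = 1 := by
        rw [← C_mul, inv_mul_cancel₀ (hne x), C_1]
      have h3 : (algebraMap F L x - θ)⁻¹ = - (θ - algebraMap F L x)⁻¹ := by
        rw [← inv_neg, neg_sub]
      rw [h3, C_neg]
      rw [C_sub] at h2
      linear_combination -h2
    have h4 : ∏ x : F, (C θ - X - C (algebraMap F L x)) = (C θ - X) ^ q - (C θ - X) := by
      have hm := congrArg (fun p : F[X] => (p.map (algebraMap F L)).comp (C θ - X))
        (prod_X_sub_C_eq_X_pow_card_sub_X F)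
      simpa [Polynomial.map_prod, Polynomial.prod_comp] using hm
    have h5 : C d⁻¹ * C d = 1 := by rw [← C_mul, inv_mul_cancel₀ hd0, C_1]
    rw [h1, h4, hfrob]
    rw [← hd, C_sub] at h5
    rw [← hd]
    linear_combination h5
  apply sum_inv_pow_of_prod
  · rw [hE]
    simp [coeff_X_pow, coeff_one, show ¬ (1 = q) by omega]
  · rw [hE]
    simp [coeff_X_pow, coeff_one, show ¬ (2 = q) by omega]
  · rw [hE]
    simp [coeff_X_pow, coeff_one, show ¬ (3 = q) by omega]

theorem coeffs_of_injective_add_div_aux {F : Type*} (L : Type*) [Field F] [Fintype F] [Field L]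
    [IsAlgClosed L] [Algebra F L]
    (hq : 5 ≤ Fintype.card F) (s n l₀ l₁ : F) (hH : ∀ x : F, x ^ 2 - s * x + n ≠ 0)
    (hinj : Function.Injective fun x : F => x + (l₁ * x + l₀) / (x ^ 2 - s * x + n)) :
    (l₁ = 0 ∧ l₀ = 0) ∨ (l₁ = -2 * (s ^ 2 - 4 * n) ∧ l₀ = (s ^ 2 - 4 * n) * s) := by
  set q := Fintype.card F with hqdef
  obtain ⟨ι, hιL⟩ : ∃ ι : F →+* L, ι = algebraMap F L := ⟨_, rfl⟩
  have hι : Function.Injective ι := ι.injective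
  obtain ⟨θ, hθ⟩ : ∃ θ : L, θ ^ 2 - ι s * θ + ι n = 0 := by
    obtain ⟨θ, hθ⟩ := IsAlgClosed.exists_aeval_eq_zero L (X ^ 2 - C s * X + C n : F[X]) (by
      have : (X ^ 2 - C s * X + C n : F[X]).degree = 2 := by compute_degree!
      rw [this]; norm_num)
    exact ⟨θ, by simpa [hιL] using hθ⟩
  have hprod := prod_sub_algebraMap_eq_pow_card_sub (F := F) θ
  obtain ⟨p, hp⟩ := CharP.exists F
  have hpL : CharP L p := charP_of_injective_algebraMap (hιL ▸ hι) p
  have hpp : Fact p.Prime := ⟨CharP.char_is_prime F p⟩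
  obtain ⟨e, -, he⟩ := FiniteField.card F p
  have hadd : ∀ a b : L, (a + b) ^ q = a ^ q + b ^ q := by
    intro a b; rw [hqdef, he, add_pow_char_pow]
  have hsub : ∀ a b : L, (a - b) ^ q = a ^ q - b ^ q := by
    intro a b; rw [hqdef, he, sub_pow_char_pow]
  have hfix : ∀ a : F, ι a ^ q = ι a := by
    intro a; rw [← map_pow, FiniteField.pow_card]
  obtain ⟨d, hd⟩ : ∃ d, d = ι s - 2 * θ := ⟨_, rfl⟩
  have hθne : ∀ x : F, ι x - θ ≠ 0 := by
    intro x hx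
    apply hH x
    apply hι
    rw [← sub_eq_zero.mp hx] at hθ
    simpa using hθ
  have hθq0 : θ ^ q - θ ≠ 0 := by
    rw [← hprod]
    exact Finset.prod_ne_zero_iff.mpr fun x _ h => hθne x (by rw [hιL]; linear_combination -h)
  have hθq : θ ^ q - θ = d := by
    have h1 : (θ ^ q) ^ 2 - ι s * θ ^ q + ι n = 0 := by
      have := congrArg (· ^ q) hθ
      simp only [hadd, hsub, mul_pow, hfix] at this
      rw [zero_pow (by omega)] at this
      rw [← this]; ring
    have h2 : (θ ^ q - θ) * (θ ^ q - θ - d) = 0 := by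
      rw [hd]; linear_combination h1 - hθ
    exact sub_eq_zero.mp ((mul_eq_zero.mp h2).resolve_left hθq0)
  have hd0 : d ≠ 0 := hθq ▸ hθq0
  have hd2 : d ^ 2 = ι s ^ 2 - 4 * ι n := by rw [hd]; linear_combination 4 * hθ
  have hηq : (ι s - θ) ^ q - (ι s - θ) = -d := by
    rw [hsub, hfix]; linear_combination -hθq
  have hηne : ∀ x : F, ι x - (ι s - θ) ≠ 0 := by
    intro x hx
    apply hθne (s - x)
    rw [map_sub]; linear_combination -hx
  obtain ⟨v1, v2, v3⟩ := sum_inv_sub_pow (F := F) (L := L) (by omega) θ d hθq hd0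
  obtain ⟨w1, w2, w3⟩ := sum_inv_sub_pow (F := F) (L := L) (by omega) (ι s - θ) (-d) hηq (neg_ne_zero.mpr hd0)
  rw [← hιL] at v1 v2 v3 w1 w2 w3
  let v : F → L := fun x => (ι x - θ)⁻¹
  let w : F → L := fun x => (ι x - (ι s - θ))⁻¹
  change ∑ x, v x = _ at v1
  change ∑ x, v x ^ 2 = _ at v2
  change ∑ x, v x ^ 3 = _ at v3
  change ∑ x, w x = _ at w1
  change ∑ x, w x ^ 2 = _ at w2
  change ∑ x, w x ^ 3 = _ at w3
  have hv : ∀ x, ι x * v x = 1 + θ * v x := by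
    intro x
    have : (ι x - θ) * v x = 1 := mul_inv_cancel₀ (hθne x)
    linear_combination this
  have hw : ∀ x, ι x * w x = 1 + (ι s - θ) * w x := by
    intro x
    have : (ι x - (ι s - θ)) * w x = 1 := mul_inv_cancel₀ (hηne x)
    linear_combination this
  have hvw : ∀ x, v x * w x = - d⁻¹ * (v x - w x) := by
    intro x
    have h3 : d * (v x * w x) = w x - v x := by
      rw [hd]; linear_combination (w x) * hv x - (v x) * hw x
    have h4 : d⁻¹ * d = 1 := inv_mul_cancel₀ hd0
    linear_combination d⁻¹ * h3 - h4 * (v x * w x)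
  obtain ⟨β, hβ⟩ : ∃ β, β = -(ι l₁ * θ + ι l₀) * d⁻¹ := ⟨_, rfl⟩
  obtain ⟨γ, hγ⟩ : ∃ γ, γ = (ι l₁ * (ι s - θ) + ι l₀) * d⁻¹ := ⟨_, rfl⟩
  set ρ : F → F := fun x => x + (l₁ * x + l₀) / (x ^ 2 - s * x + n) with hρ
  have hρv : ∀ x, ι (ρ x) = ι x + β * v x + γ * w x := by
    intro x
    have h1 : ι (x ^ 2 - s * x + n) = (ι x - θ) * (ι x - (ι s - θ)) := by
      simp only [map_add, map_sub, map_mul, map_pow]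
      linear_combination hθ
    have h2 := hθne x
    have h3 := hηne x
    simp only [hρ, map_add ι x, map_div₀, h1, hβ, hγ, v, w]
    rw [map_add, map_mul]
    field_simp
    rw [hd]; ring
  have hsum0 : ∀ k, k < 4 → ∑ x : F, ι x ^ k = 0 := by
    intro k hk
    simp_rw [← map_pow, ← map_sum]
    rw [FiniteField.sum_pow_lt_card_sub_one F k (by omega), map_zero]
  have hbij : Function.Bijective ρ := Finite.injective_iff_bijective.mp hinj
  have hsumρ : ∀ k, k < 4 → ∑ x : F, (ι x + β * v x + γ * w x) ^ k = 0 := by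
    intro k hk
    rw [← hsum0 k hk, ← Function.Bijective.sum_comp hbij (fun x => ι x ^ k)]
    simp_rw [hρv]
  rw [inv_neg] at w1 w2 w3
  obtain ⟨D, hD⟩ : ∃ D, D = d⁻¹ := ⟨_, rfl⟩
  have hdD : d * D = 1 := by rw [hD, mul_inv_cancel₀ hd0]
  rw [← hD] at v1 v2 v3 w1 w2 w3 hβ hγ
  simp_rw [← hD] at hvw
  have hD0 : D ≠ 0 := right_ne_zero_of_mul_eq_one hdD
  have hβγ : γ = β := by
    have h := hsumρ 1 (by norm_num)
    have h1 := hsum0 1 (by norm_num)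
    simp only [pow_one, Finset.sum_add_distrib, ← Finset.mul_sum] at h h1
    rw [h1, v1, w1] at h
    apply mul_right_cancel₀ hD0
    linear_combination -h
  rw [hβγ] at hγ hsumρ
  have hl₁ : ι l₁ = 2 * β := by
    linear_combination -ι l₁ * hdD + ι l₁ * D * hd - hβ - hγ
  have hl₀ : ι l₀ = -β * ι s := by
    linear_combination -θ * hl₁ + d * hβ - (ι l₁ * θ + ι l₀) * hdD - β * hd
  have hβ0 : β = 0 ∨ β = -d ^ 2 := by
    have hk2 : 2 * (β * (1 + β * D ^ 2)) = 0 := by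
      have h := hsumρ 2 (by norm_num)
      have h0 := hsum0 0 (by norm_num)
      have h2 := hsum0 2 (by norm_num)
      have ht : ∀ x, (ι x + β * v x + β * w x) ^ 2 = ι x ^ 2 + 4 * β * ι x ^ 0 +
          2 * β * θ * v x + 2 * β * (ι s - θ) * w x + β ^ 2 * v x ^ 2 + β ^ 2 * w x ^ 2
          - 2 * β ^ 2 * D * v x + 2 * β ^ 2 * D * w x := by
        intro x
        linear_combination 2 * β * hv x + 2 * β * hw x + 2 * β ^ 2 * hvw x
      rw [Finset.sum_congr rfl fun x _ => ht x] at h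
      simp only [Finset.sum_add_distrib, Finset.sum_sub_distrib, ← Finset.mul_sum] at h
      rw [h0, h2, v1, v2, w1, w2] at h
      linear_combination -h - 2 * β * hdD + 2 * β * D * hd
    by_cases h2 : (2 : L) = 0
    · have hs : ι s = d := by linear_combination -hd + θ * h2
      have hk3 : β * (1 + β * D ^ 2) = 0 := by
        have h := hsumρ 3 (by norm_num)
        have h0 := hsum0 0 (by norm_num)
        have h1 := hsum0 1 (by norm_num)
        have h3 := hsum0 3 (by norm_num)
        have ht : ∀ x, (ι x + β * v x + β * w x) ^ 3 = ι x ^ 3 + β * θ * ι x ^ 0 +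
            β * (ι s - θ) * ι x ^ 0 + β * θ ^ 2 * v x + β * (ι s - θ) ^ 2 * w x +
            β ^ 2 * v x + β ^ 2 * w x + β ^ 2 * θ * v x ^ 2 + β ^ 2 * (ι s - θ) * w x ^ 2 +
            β ^ 3 * v x ^ 3 + β ^ 3 * w x ^ 3 + β ^ 3 * D * v x ^ 2 - β ^ 3 * D * w x ^ 2 := by
          intro x
          linear_combination 3 * β * (ι x + θ) * hv x + 3 * β * (ι x + (ι s - θ)) * hw x +
            3 * β ^ 2 * (v x * hv x + w x * hw x) + 3 * β ^ 3 * (v x + w x) * hvw x +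
            h2 * (3 * β * ι x + β * (ι s + θ ^ 2 * v x + (ι s - θ) ^ 2 * w x) +
              β ^ 2 * (v x + θ * v x ^ 2 + w x + (ι s - θ) * w x ^ 2) +
              3 * β ^ 2 * ι x * (v x * w x) - 2 * β ^ 3 * D * (v x ^ 2 - w x ^ 2))
        rw [Finset.sum_congr rfl fun x _ => ht x] at h
        simp only [Finset.sum_add_distrib, Finset.sum_sub_distrib, ← Finset.mul_sum] at h
        rw [h0, h3, v1, v2, v3, w1, w2, w3] at h
        have h' : d * (-β * (d * D) + β ^ 2 * D ^ 2) = 0 := by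
          rw [← hs] at hd ⊢
          linear_combination h - ι s * β * D * hd
        rw [hdD] at h'
        linear_combination (mul_eq_zero.mp h').resolve_left hd0 + β * h2
      rcases mul_eq_zero.mp hk3 with h | h
      · exact Or.inl h
      · right; linear_combination d ^ 2 * h - β * (d * D + 1) * hdD
    · rcases mul_eq_zero.mp ((mul_eq_zero.mp hk2).resolve_left h2) with h | h
      · exact Or.inl h
      · right; linear_combination d ^ 2 * h - β * (d * D + 1) * hdD
  rcases hβ0 with h | h
  · left
    constructor <;> apply hι
    · rw [hl₁, h]; simp
    · rw [hl₀, h]; simp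
  · right
    rw [hd2] at h
    constructor <;> apply hι
    · rw [hl₁, h]; simp only [map_mul, map_neg, map_sub, map_pow, map_ofNat]; ring
    · rw [hl₀, h]; simp only [map_mul, map_sub, map_pow, map_ofNat]; ring

theorem coeffs_of_injective_add_div {F : Type*} [Field F] [Fintype F]
    (hq : 5 ≤ Fintype.card F) (s n l₀ l₁ : F) (hH : ∀ x : F, x ^ 2 - s * x + n ≠ 0)
    (hinj : Function.Injective fun x : F => x + (l₁ * x + l₀) / (x ^ 2 - s * x + n)) :
    (l₁ = 0 ∧ l₀ = 0) ∨ (l₁ = -2 * (s ^ 2 - 4 * n) ∧ l₀ = (s ^ 2 - 4 * n) * s) :=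
  coeffs_of_injective_add_div_aux (AlgebraicClosure F) hq s n l₀ l₁ hH hinj

theorem ratEval_none {F : Type} [Field F] {f g : F[X]} (hdeg : max f.natDegree g.natDegree = 3) :
    ratEval f g none = open scoped Classical in
      if g.coeff 3 ≠ 0 then some (f.coeff 3 / g.coeff 3) else none := by
  have hf : f.natDegree ≤ 3 := hdeg ▸ le_max_left _ _
  have hg : g.natDegree ≤ 3 := hdeg ▸ le_max_right _ _
  simp only [ratEval]
  by_cases h : g.coeff 3 = 0
  · have h1 : g.natDegree < 3 := by
      refine lt_of_le_of_ne hg fun h1 => ?_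
      rw [← h1, coeff_natDegree, leadingCoeff_eq_zero] at h
      simp [h] at h1
    have h2 : f.natDegree = 3 := by omega
    simp [h, h1, h2]
  · have h1 : g.natDegree = 3 := le_antisymm hg (le_natDegree_of_ne_zero h)
    rw [if_pos h, if_neg (by omega)]
    split_ifs with h2
    · rw [coeff_eq_zero_of_natDegree_lt (by omega), zero_div]
    · have h3 : f.natDegree = 3 := by omega
      rw [leadingCoeff, leadingCoeff, h1, h3]

theorem eq_cubic_of_natDegree_le {R : Type*} [CommRing R] {p : R[X]} (hp : p.natDegree ≤ 3) :
    p = C (p.coeff 0) + C (p.coeff 1) * X + C (p.coeff 2) * X ^ 2 + C (p.coeff 3) * X ^ 3 := by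
  conv_lhs => rw [p.as_sum_range_C_mul_X_pow' (Nat.lt_succ_of_le hp)]
  simp [Finset.sum_range_succ]

/-- The values of a rational function of degree three, in the coordinate `y = 1 / (x - a)`. -/
theorem ratEval_inv_add {F : Type} [Field F] {f g : F[X]}
    (hdeg : max f.natDegree g.natDegree = 3) (a y : F) :
    open scoped Classical in
    ratEval f g (if y = 0 then none else some (y⁻¹ + a)) =
      let P := fun p : F[X] => (taylor a p).coeff 0 * y ^ 3 + (taylor a p).coeff 1 * y ^ 2 +
        (taylor a p).coeff 2 * y + (taylor a p).coeff 3
      if P g ≠ 0 then some (P f / P g) else none := by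
  classical
  have key : ∀ p : F[X], p.natDegree ≤ 3 → (taylor a p).coeff 3 = p.coeff 3 ∧ (y ≠ 0 →
      (taylor a p).coeff 0 * y ^ 3 + (taylor a p).coeff 1 * y ^ 2 +
        (taylor a p).coeff 2 * y + (taylor a p).coeff 3 = y ^ 3 * p.eval (y⁻¹ + a)) := by
    intro p hp
    constructor
    · rcases hp.lt_or_eq with h | h
      · rw [coeff_eq_zero_of_natDegree_lt h,
          coeff_eq_zero_of_natDegree_lt (by rwa [natDegree_taylor])]
      · conv_lhs => rw [← h, coeff_taylor_natDegree]
        rw [leadingCoeff, h]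
    · intro hy
      rw [← taylor_eval]
      conv_rhs => rw [eq_cubic_of_natDegree_le (p := taylor a p) (by rwa [natDegree_taylor])]
      simp
      field_simp
  have kf := key f (hdeg ▸ le_max_left _ _)
  have kg := key g (hdeg ▸ le_max_right _ _)
  by_cases hy : y = 0
  · subst hy
    simp only [if_true, ratEval_none hdeg, mul_zero, zero_add, ne_eq, OfNat.ofNat_ne_zero,
      not_false_eq_true, zero_pow, kf.1, kg.1]
  · simp only [if_neg hy, kf.2 hy, kg.2 hy]
    have h3 : y ^ 3 ≠ 0 := pow_ne_zero 3 hy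
    simp only [ratEval]
    by_cases h : eval (y⁻¹ + a) g = 0
    · simp [h]
    · rw [if_pos h, if_pos (mul_ne_zero h3 h), mul_div_mul_left _ _ h3]

open scoped Classical in
theorem exists_normal_form_aux {F : Type} [Field F] [Fintype F] (hq : 5 ≤ Fintype.card F)
    (f₀ f₁ f₂ f₃ g₀ g₁ g₂ g₃ : F) (hg₀ : g₀ ≠ 0) (h₃ : f₃ ≠ 0 ∨ g₃ ≠ 0) (hW : f₁ * g₀ - f₀ * g₁ ≠ 0)
    (hco : IsCoprime (C f₀ + C f₁ * X + C f₂ * X ^ 2 + C f₃ * X ^ 3)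
      (C g₀ + C g₁ * X + C g₂ * X ^ 2 + C g₃ * X ^ 3))
    (hinj : Function.Injective fun y : F =>
      if g₀ * y ^ 3 + g₁ * y ^ 2 + g₂ * y + g₃ ≠ 0 then
        some ((f₀ * y ^ 3 + f₁ * y ^ 2 + f₂ * y + f₃) / (g₀ * y ^ 3 + g₁ * y ^ 2 + g₂ * y + g₃))
      else none)
    (hne : ∀ y : F, (if g₀ * y ^ 3 + g₁ * y ^ 2 + g₂ * y + g₃ ≠ 0 then
        some ((f₀ * y ^ 3 + f₁ * y ^ 2 + f₂ * y + f₃) / (g₀ * y ^ 3 + g₁ * y ^ 2 + g₂ * y + g₃))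
      else none) ≠ some (f₀ / g₀)) :
    ∃ t l m k s n : F, l ≠ 0 ∧ m ≠ 0 ∧ (∀ x : F, x ^ 2 - s * x + n ≠ 0) ∧
      C g₀ + C g₁ * X + C g₂ * X ^ 2 + C g₃ * X ^ 3 =
        C l * ((1 + C k * X) * (1 - C s * X + C n * X ^ 2) -
          C (s ^ 2 - 4 * n) * X ^ 2 * (2 - C s * X)) ∧
      C f₀ + C f₁ * X + C f₂ * X ^ 2 + C f₃ * X ^ 3 =
        C t * (C g₀ + C g₁ * X + C g₂ * X ^ 2 + C g₃ * X ^ 3) +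
          C m * X * (1 - C s * X + C n * X ^ 2) := by
  obtain ⟨t, rfl⟩ : ∃ t, f₀ = t * g₀ := ⟨f₀ / g₀, by field_simp⟩
  obtain ⟨m, rfl⟩ : ∃ m, f₁ = t * g₁ + m := ⟨f₁ - t * g₁, by ring⟩
  have hm : m ≠ 0 := by rintro rfl; apply hW; ring
  obtain ⟨s, rfl⟩ : ∃ s, f₂ = t * g₂ - m * s := ⟨(t * g₂ - f₂) / m, by field_simp; ring⟩
  obtain ⟨n, rfl⟩ : ∃ n, f₃ = t * g₃ + m * n := ⟨(f₃ - t * g₃) / m, by field_simp; ring⟩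
  obtain ⟨b, rfl⟩ : ∃ b, g₁ = g₀ * b := ⟨g₁ / g₀, by field_simp⟩
  obtain ⟨c, rfl⟩ : ∃ c, g₂ = g₀ * c := ⟨g₂ / g₀, by field_simp⟩
  obtain ⟨e, rfl⟩ : ∃ e, g₃ = g₀ * e := ⟨g₃ / g₀, by field_simp⟩
  have hC : (C m : F[X]) * X * (1 - C s * X + C n * X ^ 2) =
      C (t * g₀) + C (t * (g₀ * b) + m) * X + C (t * (g₀ * c) - m * s) * X ^ 2 +
        C (t * (g₀ * e) + m * n) * X ^ 3 -
        C t * (C g₀ + C (g₀ * b) * X + C (g₀ * c) * X ^ 2 + C (g₀ * e) * X ^ 3) := by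
    simp only [C_mul, C_add, C_sub]; ring
  -- a common root of numerator and denominator is excluded
  have hnum : ∀ y : F, t * g₀ * y ^ 3 + (t * (g₀ * b) + m) * y ^ 2 +
      (t * (g₀ * c) - m * s) * y + (t * (g₀ * e) + m * n) =
      t * (g₀ * y ^ 3 + g₀ * b * y ^ 2 + g₀ * c * y + g₀ * e) + m * (y ^ 2 - s * y + n) :=
    fun y => by ring
  simp only [hnum] at hinj hne
  have hunit : ¬ IsUnit (1 - C s * X + C n * X ^ 2 : F[X]) ∨ n = 0 := by
    by_cases hn : n = 0
    · exact Or.inr hn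
    · left
      intro h
      have := natDegree_eq_zero_of_isUnit h
      have h2 : (1 - C s * X + C n * X ^ 2 : F[X]).natDegree = 2 := by compute_degree!
      omega
  have hH : ∀ y : F, y ^ 2 - s * y + n ≠ 0 := by
    intro y hy
    by_cases hG : g₀ * y ^ 3 + g₀ * b * y ^ 2 + g₀ * c * y + g₀ * e = 0
    · obtain ⟨u, v, huv⟩ := hco
      have hy0 : y ≠ 0 := by
        rintro rfl
        have he : e = 0 := by simpa [hg₀] using hG
        have hn : n = 0 := by simpa using hy
        simp [he, hn] at h₃
      have h1 : eval y⁻¹ (C g₀ + C (g₀ * b) * X + C (g₀ * c) * X ^ 2 + C (g₀ * e) * X ^ 3) = 0 := by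
        simp only [eval_add, eval_mul, eval_C, eval_X, eval_pow]
        refine Eq.trans ?_ (mul_zero (y⁻¹ ^ 3))
        rw [← hG]
        field_simp
      have h2 := congrArg (eval y⁻¹) hC
      rw [eval_sub, eval_mul (p := C t), h1, mul_zero, sub_zero] at h2
      have h3 : eval y⁻¹ (C m * X * (1 - C s * X + C n * X ^ 2)) = 0 := by
        simp only [eval_add, eval_mul, eval_C, eval_X, eval_pow, eval_sub, eval_one]
        refine Eq.trans ?_ (mul_zero (m * y⁻¹ ^ 3))
        rw [← hy]
        field_simp
      have := congrArg (eval y⁻¹) huv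
      rw [eval_add, eval_mul, eval_mul, h1, ← h2, h3] at this
      simp at this
    · refine hne y ?_
      rw [if_pos hG, hy, mul_zero, add_zero, mul_div_cancel_right₀ _ hG,
        mul_div_cancel_right₀ _ hg₀]
  have hn : n ≠ 0 := by simpa using hH 0
  have hcoeff := coeffs_of_injective_add_div hq s n (e - (b + s) * n) (c - n + (b + s) * s) hH (by
    intro y z hyz
    apply hinj
    have hψ : ∀ y : F, g₀ * y ^ 3 + g₀ * b * y ^ 2 + g₀ * c * y + g₀ * e =
        g₀ * (y ^ 2 - s * y + n) * ((y + ((c - n + (b + s) * s) * y + (e - (b + s) * n)) /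
          (y ^ 2 - s * y + n)) + (b + s)) := by
      intro y
      obtain ⟨h, hh⟩ : ∃ h, h = y ^ 2 - s * y + n := ⟨_, rfl⟩
      have := hH y
      rw [← hh] at this ⊢
      field_simp
      rw [hh]
      ring
    have hval : ∀ y r : F, (y + ((c - n + (b + s) * s) * y + (e - (b + s) * n)) /
          (y ^ 2 - s * y + n)) = r → (if g₀ * y ^ 3 + g₀ * b * y ^ 2 + g₀ * c * y + g₀ * e ≠ 0 then
        some ((t * (g₀ * y ^ 3 + g₀ * b * y ^ 2 + g₀ * c * y + g₀ * e) +
          m * (y ^ 2 - s * y + n)) / (g₀ * y ^ 3 + g₀ * b * y ^ 2 + g₀ * c * y + g₀ * e))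
        else none) = if r + (b + s) ≠ 0 then some (t + m / (g₀ * (r + (b + s)))) else none := by
      intro y r hr
      rw [hψ, hr]
      obtain ⟨H, hH'⟩ : ∃ H, H = y ^ 2 - s * y + n := ⟨_, rfl⟩
      have := hH y
      rw [← hH'] at this ⊢
      by_cases h : r + (b + s) = 0
      · simp [h]
      · rw [if_pos h, if_pos (mul_ne_zero (mul_ne_zero hg₀ this) h)]
        congr 1
        field_simp
    exact (hval y _ rfl).trans (hval z _ hyz.symm).symm)
  refine ⟨t, g₀, m, b + s, s, n, hg₀, hm, hH, ?_, by rw [hC]; ring⟩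
  rcases hcoeff with ⟨h1, h0⟩ | ⟨h1, h0⟩
  · exfalso
    have hg : (1 - C s * X + C n * X ^ 2) ∣
        C g₀ + C (g₀ * b) * X + C (g₀ * c) * X ^ 2 + C (g₀ * e) * X ^ 3 := by
      refine ⟨C g₀ * (1 + C (b + s) * X), ?_⟩
      have hc : c = n - (b + s) * s := by linear_combination h1
      have he : e = (b + s) * n := by linear_combination h0
      rw [hc, he]
      simp only [C_mul, C_add, C_sub]
      ring
    refine hunit.resolve_right hn (hco.isUnit_of_dvd' ?_ hg)
    rw [sub_eq_iff_eq_add.mp hC.symm]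
    exact dvd_add (Dvd.intro_left _ rfl) (hg.mul_left _)
  · have hc : c = n - (b + s) * s - 2 * (s ^ 2 - 4 * n) := by linear_combination h1
    have he : e = (b + s) * n + (s ^ 2 - 4 * n) * s := by linear_combination h0
    rw [hc, he]
    simp only [C_mul, C_add, C_sub, C_pow, map_ofNat]
    ring

theorem exists_normal_form_of_injective_ratEval {F : Type} [Field F] [Fintype F]
    (hq : 13 ≤ Fintype.card F) {f g : F[X]} (hco : IsCoprime f g)
    (hdeg : max f.natDegree g.natDegree = 3)
    (hW : derivative f * g - f * derivative g ≠ 0) (hinj : Function.Injective (ratEval f g)) :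
    ∃ a t l m k s n : F, l ≠ 0 ∧ m ≠ 0 ∧ (∀ x : F, x ^ 2 - s * x + n ≠ 0) ∧
      taylor a g = C l * ((1 + C k * X) * (1 - C s * X + C n * X ^ 2) -
        C (s ^ 2 - 4 * n) * X ^ 2 * (2 - C s * X)) ∧
      taylor a f = C t * taylor a g + C m * X * (1 - C s * X + C n * X ^ 2) := by
  classical
  have hf3 : f.natDegree ≤ 3 := hdeg ▸ le_max_left _ _
  have hg3 : g.natDegree ≤ 3 := hdeg ▸ le_max_right _ _
  have hg0 : g ≠ 0 := by
    rintro rfl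
    have : f.natDegree = 0 := natDegree_eq_zero_of_isUnit (isCoprime_zero_right.mp hco)
    simp [this] at hdeg
  obtain ⟨a, ha⟩ : ∃ a : F, ((derivative f * g - f * derivative g) * g).eval a ≠ 0 := by
    by_contra! h
    have hne := mul_ne_zero hW hg0
    have h1 := card_le_degree_of_subset_roots (p := (derivative f * g - f * derivative g) * g)
      (Z := Finset.univ) (fun x _ => by simpa [hne] using h x)
    have h2 : ((derivative f * g - f * derivative g) * g).natDegree ≤ 8 + 3 := by
      refine natDegree_mul_le_of_le ((natDegree_sub_le_of_le (m := 8) (n := 8) ?_ ?_).trans le_rfl) hg3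
      · exact (natDegree_mul_le_of_le (natDegree_derivative_le f) hg3).trans (by omega)
      · exact (natDegree_mul_le_of_le hf3 (natDegree_derivative_le g)).trans (by omega)
    rw [Finset.card_univ] at h1
    omega
  have hga : g.eval a ≠ 0 := fun h => ha (by simp [h])
  have hWa : (derivative f).eval a * g.eval a - f.eval a * (derivative g).eval a ≠ 0 :=
    fun h => ha (by simp [h])
  rw [← taylor_coeff_one, ← taylor_coeff_one, ← taylor_coeff_zero a f, ← taylor_coeff_zero a g]
    at hWa
  rw [← taylor_coeff_zero] at hga
  have h₃ : (taylor a f).coeff 3 ≠ 0 ∨ (taylor a g).coeff 3 ≠ 0 := by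
    rcases max_choice f.natDegree g.natDegree with h | h <;> rw [hdeg] at h
    · left
      rw [h, coeff_taylor_natDegree, leadingCoeff_ne_zero]
      rintro rfl
      simp at h
    · right
      rw [h, coeff_taylor_natDegree, leadingCoeff_ne_zero]
      exact hg0
  have hval := ratEval_inv_add hdeg a
  have hco' : IsCoprime (taylor a f) (taylor a g) := hco.map (taylorAlgHom a).toRingHom
  have hfeq := eq_cubic_of_natDegree_le (p := taylor a f) (by rwa [natDegree_taylor])
  have hgeq := eq_cubic_of_natDegree_le (p := taylor a g) (by rwa [natDegree_taylor])
  have hfa : ratEval f g (some a) = some ((taylor a f).coeff 0 / (taylor a g).coeff 0) := by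
    simp only [taylor_coeff_zero] at hga ⊢
    simp [ratEval, hga]
  have hinj' : Function.Injective fun y : F => ratEval f g (if y = 0 then none else some (y⁻¹ + a)) := by
    refine hinj.comp fun y z h => ?_
    by_cases hy : y = 0 <;> by_cases hz : z = 0 <;> simp [hy, hz] at h ⊢
    exact h
  have hne : ∀ y : F, ratEval f g (if y = 0 then none else some (y⁻¹ + a)) ≠
      some ((taylor a f).coeff 0 / (taylor a g).coeff 0) := by
    intro y h
    rw [← hfa] at h
    have h1 := hinj h
    by_cases hy : y = 0 <;> simp [hy] at h1
  simp only [hval] at hinj' hne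
  rw [hfeq, hgeq] at hco'
  obtain ⟨t, l, m, k, s, n, hl, hm, hn, h1, h2⟩ :=
    exists_normal_form_aux (by omega) _ _ _ _ _ _ _ _ hga h₃ hWa hco' hinj' hne
  rw [← hfeq, ← hgeq] at h2
  rw [← hgeq] at h1
  exact ⟨a, t, l, m, k, s, n, hl, hm, hn, h1, h2⟩

theorem exists_root_of_normal_form {F M : Type*} [Field F] [Field M] [Algebra F M] {f g : F[X]}
    {a t l m k s n : F} (hl : l ≠ 0) (hm : m ≠ 0)
    (hg : taylor a g = C l * ((1 + C k * X) * (1 - C s * X + C n * X ^ 2) -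
        C (s ^ 2 - 4 * n) * X ^ 2 * (2 - C s * X)))
    (hf : taylor a f = C t * taylor a g + C m * X * (1 - C s * X + C n * X ^ 2))
    {T α₁ α₂ : M} (hT : T ≠ algebraMap F M t) (hne : α₁ ≠ α₂)
    (h₁ : aeval α₁ f = T * aeval α₁ g) (h₂ : aeval α₂ f = T * aeval α₂ g) :
    ∃ ω : M, ω ^ 2 - algebraMap F M s * ω + algebraMap F M n = 0 := by
  obtain ⟨ι, hι⟩ : ∃ ι : F →+* M, ι = algebraMap F M := ⟨_, rfl⟩
  have hl' : ι l ≠ 0 := (map_ne_zero ι).mpr hl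
  have hm' : ι m ≠ 0 := (map_ne_zero ι).mpr hm
  rw [← hι] at hT ⊢
  have hshift : ∀ (p : F[X]) (α : M), aeval α p = aeval (α - ι a) (taylor a p) := by
    intro p α
    rw [taylor_apply, aeval_comp]
    simp [hι]
  have key : ∀ α : M, aeval α f = T * aeval α g → α - ι a ≠ 0 ∧
      (T - ι t) * ι l * (((α - ι a)⁻¹ + ι k) *
        ((α - ι a)⁻¹ ^ 2 - ι s * (α - ι a)⁻¹ + ι n) -
        (ι s ^ 2 - 4 * ι n) * (2 * (α - ι a)⁻¹ - ι s)) =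
      ι m * ((α - ι a)⁻¹ ^ 2 - ι s * (α - ι a)⁻¹ + ι n) := by
    intro α h
    rw [hshift f, hshift g, hf, hg] at h
    simp only [map_add, map_mul, map_sub, map_pow, aeval_C, aeval_X, map_one, map_ofNat, ← hι] at h
    have hz : α - ι a ≠ 0 := by
      intro h0
      rw [h0] at h
      apply hT
      apply mul_right_cancel₀ hl'
      linear_combination -h
    refine ⟨hz, ?_⟩
    generalize α - ι a = z at *
    field_simp
    linear_combination -h
  obtain ⟨hz₁, e₁⟩ := key α₁ h₁
  obtain ⟨hz₂, e₂⟩ := key α₂ h₂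
  have hy : (α₁ - ι a)⁻¹ - (α₂ - ι a)⁻¹ ≠ 0 := by
    intro h
    rw [sub_eq_zero, inv_inj] at h
    exact hne (sub_left_injective h)
  generalize (α₁ - ι a)⁻¹ = y₁ at *
  generalize (α₂ - ι a)⁻¹ = y₂ at *
  have hc : (T - ι t) * ι l ≠ 0 := mul_ne_zero (sub_ne_zero.mpr hT) hl'
  have e : ((T - ι t) * ι l) * ((y₁ - y₂) * ((y₁ ^ 2 - ι s * y₁ + ι n) * (y₂ ^ 2 - ι s * y₂ + ι n) +
      (ι s ^ 2 - 4 * ι n) * (2 * y₁ * y₂ - ι s * (y₁ + y₂) + ι s ^ 2 - 2 * ι n))) = 0 := by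
    linear_combination (y₂ ^ 2 - ι s * y₂ + ι n) * e₁ - (y₁ ^ 2 - ι s * y₁ + ι n) * e₂
  replace e := (mul_eq_zero.mp ((mul_eq_zero.mp e).resolve_left hc)).resolve_left hy
  refine ⟨(y₁ * y₂ - ι s * y₂ + ι s ^ 2 - 3 * ι n) / (y₁ - y₂), ?_⟩
  field_simp
  linear_combination e

theorem natDegree_fiberPoly {F : Type} [Field F] {f g : F[X]}
    (hdeg : max f.natDegree g.natDegree = 3) : (fiberPoly f g).natDegree = 3 := by
  have hf3 : f.natDegree ≤ 3 := hdeg ▸ le_max_left _ _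
  have hg3 : g.natDegree ≤ 3 := hdeg ▸ le_max_right _ _
  refine natDegree_eq_of_le_of_coeff_ne_zero ?_ ?_
  · refine (natDegree_sub_le_of_le (natDegree_map_le.trans hf3)
      ((natDegree_C_mul_le _ _).trans (natDegree_map_le.trans hg3))).trans_eq (max_self 3)
  · rw [fiberPoly, coeff_sub, coeff_C_mul, coeff_map, coeff_map]
    intro h
    by_cases hg : g.coeff 3 = 0
    · have hf : f.coeff 3 = 0 := by simpa [hg] using h
      rcases max_choice f.natDegree g.natDegree with h | h <;> rw [hdeg] at h
      · rw [h, coeff_natDegree, leadingCoeff_eq_zero] at hf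
        simp [hf] at h
      · rw [h, coeff_natDegree, leadingCoeff_eq_zero] at hg
        simp [hg] at h
    · have hg' : algebraMap F (RatFunc F) (g.coeff 3) ≠ 0 := by simpa using hg
      have hX : (RatFunc.X : RatFunc F) = RatFunc.C (f.coeff 3 / g.coeff 3) := by
        rw [map_div₀, ← RatFunc.algebraMap_eq_C, eq_div_iff hg']
        linear_combination -h
      have := congrArg RatFunc.num hX
      rw [RatFunc.num_X, RatFunc.num_C] at this
      exact X_ne_C _ this

theorem irreducible_fiberPoly {F : Type} [Field F] {f g : F[X]} (hco : IsCoprime f g)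
    (hdeg : max f.natDegree g.natDegree = 3) : Irreducible (fiberPoly f g) := by
  have hg : g ≠ 0 := by
    rintro rfl
    have : f.natDegree = 0 := natDegree_eq_zero_of_isUnit (isCoprime_zero_right.mp hco)
    simp [this] at hdeg
  let φ : F[X][X] := f.map (algebraMap F F[X]) - Polynomial.C Polynomial.X * g.map (algebraMap ..)
  have hφ : Irreducible φ := by
    have : φ = Bivariate.swap (Polynomial.C f - Polynomial.X * Polynomial.C g) := by
      rw [map_sub, map_mul, Bivariate.swap_Y, Bivariate.swap_C, Bivariate.swap_C]
      rfl
    rw [this, MulEquiv.irreducible_iff]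
    convert! irreducible_C_mul_X_add_C (neg_ne_zero.mpr hg)
        ((IsCoprime.neg_right_iff _ _).mpr hco).symm.isRelPrime using 1
    rw [add_comm, X_mul_C, map_neg, neg_mul]
    exact sub_eq_add_neg (Polynomial.C f) (Polynomial.C g * Polynomial.X)
  have hmap : φ.map (algebraMap F[X] (RatFunc F)) = fiberPoly f g := by
    simp only [φ, fiberPoly, Polynomial.map_sub, Polynomial.map_mul, Polynomial.map_map, map_C,
      RatFunc.algebraMap_X, ← IsScalarTower.algebraMap_eq]
  rw [← hmap, ← IsPrimitive.irreducible_iff_irreducible_map_fraction_map]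
  · exact hφ
  · apply hφ.isPrimitive
    intro H
    have := natDegree_map_le (f := algebraMap F[X] (RatFunc F)) (p := φ)
    rw [hmap, natDegree_fiberPoly hdeg, H] at this
    omega

/-- The permutation representation of the Galois group on the roots. -/
def permRoots {K : Type*} [Field K] (p : K[X]) :
    (p.SplittingField ≃ₐ[K] p.SplittingField) →* Equiv.Perm (p.rootSet p.SplittingField) :=
  letI := Gal.galActionAux p
  MulAction.toPermHom p.Gal (p.rootSet p.SplittingField)

theorem permRoots_apply {K : Type*} [Field K] (p : K[X])
    (σ : p.SplittingField ≃ₐ[K] p.SplittingField) (x : p.rootSet p.SplittingField) :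
    (permRoots p σ x : p.SplittingField) = σ x := rfl

theorem permRoots_injective {K : Type*} [Field K] (p : K[X]) :
    Function.Injective (permRoots p) := by
  intro σ τ h
  refine Gal.ext p fun x hx => ?_
  exact congrArg Subtype.val (DFunLike.congr_fun h ⟨x, hx⟩)

theorem card_rootSet_splittingField {K : Type*} [Field K] {p : K[X]} (hp : p.Separable) :
    Nat.card (p.rootSet p.SplittingField) = p.natDegree := by
  rw [Nat.card_eq_fintype_card, card_rootSet_eq_natDegree hp (SplittingField.splits p)]

theorem nonempty_perm_rootSet_mulEquiv {K : Type*} [Field K] {p : K[X]} (hp : p.Separable)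
    (hdeg : p.natDegree = 3) :
    Nonempty (Equiv.Perm (p.rootSet p.SplittingField) ≃* Equiv.Perm (Fin 3)) := by
  have h := card_rootSet_splittingField hp
  rw [hdeg] at h
  exact ⟨(Finite.equivFinOfCardEq h).permCongrHom⟩

theorem permRoots_bijective {K : Type*} [Field K] {p : K[X]} (hp : p.Separable)
    (hdeg : p.natDegree = 3) (hcard : Nat.card (p.SplittingField ≃ₐ[K] p.SplittingField) = 6) :
    Function.Bijective (permRoots p) := by
  obtain ⟨e⟩ := nonempty_perm_rootSet_mulEquiv hp hdeg
  refine (Nat.bijective_iff_injective_and_card _).mpr ⟨permRoots_injective p, ?_⟩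
  rw [hcard, Nat.card_congr e.toEquiv, Nat.card_perm, Nat.card_fin]
  rfl

theorem card_gal_dvd_six {K : Type*} [Field K] {p : K[X]} (hp : p.Separable)
    (hdeg : p.natDegree = 3) :
    Nat.card (p.SplittingField ≃ₐ[K] p.SplittingField) ∣ 6 := by
  obtain ⟨e⟩ := nonempty_perm_rootSet_mulEquiv hp hdeg
  have := Subgroup.card_dvd_of_injective (permRoots p) (permRoots_injective p)
  rwa [Nat.card_congr e.toEquiv, Nat.card_perm, Nat.card_fin] at this

theorem natDegree_dvd_card_gal {K : Type*} [Field K] {p : K[X]} (hp : p.Separable)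
    (hirr : Irreducible p) :
    p.natDegree ∣ Nat.card (p.SplittingField ≃ₐ[K] p.SplittingField) := by
  change p.natDegree ∣ Nat.card p.Gal
  rw [Gal.card_of_separable hp]
  let α : p.SplittingField :=
    rootOfSplits (SplittingField.splits p) (by
      rw [degree_map]; exact (degree_pos_of_irreducible hirr).ne')
  have hα : IsIntegral K α := .of_finite K α
  have hroot : aeval α p = 0 := by
    rw [← eval_map_algebraMap, eval_rootOfSplits]
  have h : (minpoly K α).natDegree = p.natDegree := by
    have hdvd : minpoly K α ∣ p := minpoly.dvd K α hroot
    have key := (minpoly.irreducible hα).dvd_symm hirr hdvd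
    exact le_antisymm (natDegree_le_of_dvd hdvd hirr.ne_zero)
      (natDegree_le_of_dvd key (minpoly.ne_zero hα))
  rw [← Module.finrank_mul_finrank K (IntermediateField.adjoin K {α}) p.SplittingField,
    IntermediateField.adjoin.finrank hα, h]
  exact dvd_mul_right _ _

theorem two_dvd_card_of_quadratic {K M : Type*} [Field K] [Field M] [Algebra K M]
    [FiniteDimensional K M] [IsGalois K M] {s n : K} {ω : M}
    (hω : ω ^ 2 - algebraMap K M s * ω + algebraMap K M n = 0)
    (hK : ω ∉ (algebraMap K M).range) : 2 ∣ Nat.card (M ≃ₐ[K] M) := by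
  rw [IsGalois.card_aut_eq_finrank]
  have hωint : IsIntegral K ω := .of_finite K ω
  have h : (minpoly K ω).natDegree = 2 := by
    have hdvd : minpoly K ω ∣ X ^ 2 - C s * X + C n := minpoly.dvd K ω (by simpa using hω)
    have hd : (X ^ 2 - C s * X + C n : K[X]).natDegree = 2 := by compute_degree!
    have h0 : (X ^ 2 - C s * X + C n : K[X]) ≠ 0 := fun h => by simp [h] at hd
    have h1 := natDegree_le_of_dvd hdvd h0
    have h2 := (minpoly.two_le_natDegree_iff hωint).mpr hK
    omega
  rw [← Module.finrank_mul_finrank K (IntermediateField.adjoin K {ω}) M,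
    IntermediateField.adjoin.finrank hωint, h]
  exact dvd_mul_right _ _

theorem algEquiv_comm_of_isAlgebraic {F M : Type*} [Field F] [Finite F] [Field M] [Algebra F M]
    (σ τ : M ≃ₐ[F] M) {x : M} (hx : IsAlgebraic F x) : σ (τ x) = τ (σ x) := by
  let E := IntermediateField.adjoin F {x}
  have : FiniteDimensional F E := IntermediateField.adjoin.finiteDimensional hx.isIntegral
  have : Finite E := Module.finite_of_finite F
  let y : E := ⟨x, IntermediateField.mem_adjoin_simple_self F x⟩
  have h : ∀ (ρ : M ≃ₐ[F] M) (z : E), ρ (algebraMap E M z) = algebraMap E M (ρ.restrictNormal E z) :=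
    fun ρ z => (AlgEquiv.restrictNormal_commutes ρ E z).symm
  have hxy : x = algebraMap E M y := rfl
  have hc : σ.restrictNormal E * τ.restrictNormal E = τ.restrictNormal E * σ.restrictNormal E :=
    IsMulCommutative.is_comm.comm _ _
  rw [hxy, h τ, h σ, h σ, h τ]
  exact congrArg (algebraMap E M) (DFunLike.congr_fun hc y)

theorem no_root_ratFunc {F : Type*} [Field F] {s n : F} (h : ∀ x : F, x ^ 2 - s * x + n ≠ 0)
    (r : RatFunc F) :
    r ^ 2 - algebraMap F (RatFunc F) s * r + algebraMap F (RatFunc F) n ≠ 0 := by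
  intro hr
  by_cases hc : ∃ c, r = RatFunc.C c
  · obtain ⟨c, rfl⟩ := hc
    refine h c ((algebraMap F (RatFunc F)).injective ?_)
    simpa using hr
  · refine RatFunc.transcendental_of_ne_C _ hc ⟨X ^ 2 - C s * X + C n, ?_, by simpa using hr⟩
    have hd : (X ^ 2 - C s * X + C n : F[X]).natDegree = 2 := by compute_degree!
    exact fun h => by simp [h] at hd

theorem isConstantElem_iff {F : Type} [Field F] (f g : F[X]) (x : (fiberPoly f g).SplittingField) :
    isConstantElem f g x ↔ IsAlgebraic F x := by
  simp only [isConstantElem, IsAlgebraic, aeval_def,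
    IsScalarTower.algebraMap_eq F (RatFunc F) (fiberPoly f g).SplittingField]

theorem derivative_eq_zero_of_dvd {F : Type*} [Field F] {p : F[X]} (h : p ∣ derivative p) :
    derivative p = 0 := by
  by_cases hp : p = 0
  · simp [hp]
  · exact eq_zero_of_dvd_of_degree_lt h (degree_derivative_lt hp)

theorem wronskian_ne_zero_of_separable {F : Type} [Field F] {f g : F[X]} (hco : IsCoprime f g)
    (hdeg : max f.natDegree g.natDegree = 3) (hsep : (fiberPoly f g).Separable) :
    derivative f * g - f * derivative g ≠ 0 := by
  intro h
  have hf : derivative f = 0 := derivative_eq_zero_of_dvd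
    (hco.dvd_of_dvd_mul_right ⟨derivative g, sub_eq_zero.mp h⟩)
  have hg : derivative g = 0 := derivative_eq_zero_of_dvd
    (hco.symm.dvd_of_dvd_mul_left ⟨derivative f, by linear_combination -h⟩)
  have hd : derivative (fiberPoly f g) = 0 := by
    simp [fiberPoly, derivative_map, hf, hg]
  rw [Separable, hd, isCoprime_zero_right] at hsep
  have := natDegree_eq_zero_of_isUnit hsep
  rw [natDegree_fiberPoly hdeg] at this
  omega

theorem aeval_fiberPoly {F M : Type} [Field F] [Field M] [Algebra (RatFunc F) M]
    [Algebra F M] [IsScalarTower F (RatFunc F) M] (f g : F[X]) (α : M) :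
    aeval α (fiberPoly f g) =
      aeval α f - algebraMap (RatFunc F) M RatFunc.X * aeval α g := by
  rw [fiberPoly, map_sub, map_mul, aeval_C, aeval_map_algebraMap, aeval_map_algebraMap]

theorem aeval_eq_of_mem_rootSet {F : Type} [Field F] {f g : F[X]}
    {α : (fiberPoly f g).SplittingField}
    (hα : α ∈ (fiberPoly f g).rootSet (fiberPoly f g).SplittingField) :
    aeval α f = algebraMap (RatFunc F) (fiberPoly f g).SplittingField RatFunc.X * aeval α g :=
  sub_eq_zero.mp ((aeval_fiberPoly f g α).symm.trans (aeval_eq_zero_of_mem_rootSet hα))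

theorem algebraMap_X_ne_algebraMap {F M : Type*} [Field F] [Field M] [Algebra (RatFunc F) M]
    [Algebra F M] [IsScalarTower F (RatFunc F) M] (t : F) :
    algebraMap (RatFunc F) M RatFunc.X ≠ algebraMap F M t := by
  rw [IsScalarTower.algebraMap_apply F (RatFunc F) M]
  intro h
  have hX := (algebraMap (RatFunc F) M).injective h
  have := congrArg RatFunc.num hX
  rw [RatFunc.num_X, RatFunc.algebraMap_eq_C, RatFunc.num_C] at this
  exact X_ne_C _ this

theorem exists_orderOf_commutator_perm_fin_three :
    ∃ a b : Equiv.Perm (Fin 3), a * b * a⁻¹ * b⁻¹ ≠ 1 ∧ (a * b * a⁻¹ * b⁻¹) ^ 3 = 1 :=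
  ⟨Equiv.swap 0 1, Equiv.swap 1 2, by decide, by decide⟩

theorem nonempty_mulEquiv_alternatingGroup {H : Type*} [Group H] (h : Nat.card H = 3) :
    Nonempty (H ≃* alternatingGroup (Fin 3)) := by
  have : Fact (Nat.Prime 3) := ⟨Nat.prime_three⟩
  refine ⟨mulEquivOfPrimeCardEq h ?_⟩
  have := two_mul_nat_card_alternatingGroup (α := Fin 3)
  rw [Nat.card_perm, Nat.card_fin, show Nat.factorial 3 = 6 from rfl] at this
  omega

theorem galois_groups_of_injective {F : Type} [Field F] [Fintype F] (hq : 13 ≤ Fintype.card F)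
    {f g : F[X]} (hco : IsCoprime f g) (hdeg : max f.natDegree g.natDegree = 3)
    (hsep : (fiberPoly f g).Separable) (hinj : Function.Injective (ratEval f g)) :
    Nonempty (((fiberPoly f g).SplittingField ≃ₐ[RatFunc F] (fiberPoly f g).SplittingField)
        ≃* Equiv.Perm (Fin 3)) ∧
      Nonempty (constGal f g ≃* alternatingGroup (Fin 3)) := by
  obtain ⟨a, t, l, m, k, s, n, hl, hm, hH, hg, hf⟩ := exists_normal_form_of_injective_ratEval hq hco
    hdeg (wronskian_ne_zero_of_separable hco hdeg hsep) hinj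
  have hp := natDegree_fiberPoly hdeg
  have hroots := card_rootSet_splittingField hsep
  rw [hp] at hroots
  have hgal : IsGalois (RatFunc F) (fiberPoly f g).SplittingField :=
    IsGalois.of_separable_splitting_field hsep
  obtain ⟨ω, hω⟩ : ∃ ω : (fiberPoly f g).SplittingField,
      ω ^ 2 - algebraMap F _ s * ω + algebraMap F _ n = 0 := by
    obtain ⟨α, β, hαβ⟩ := (Finite.one_lt_card_iff_nontrivial.mp
      (by rw [hroots]; norm_num : 1 < Nat.card _)).exists_pair_ne
    exact exists_root_of_normal_form hl hm hg hf (algebraMap_X_ne_algebraMap t)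
      (Subtype.coe_injective.ne hαβ) (aeval_eq_of_mem_rootSet α.2) (aeval_eq_of_mem_rootSet β.2)
  have hωF : IsAlgebraic F ω := by
    refine ⟨X ^ 2 - C s * X + C n, ?_, by simpa using hω⟩
    have hd : (X ^ 2 - C s * X + C n : F[X]).natDegree = 2 := by compute_degree!
    exact fun h => by simp [h] at hd
  simp only [IsScalarTower.algebraMap_apply F (RatFunc F) (fiberPoly f g).SplittingField] at hω
  have hωK : ω ∉ (algebraMap (RatFunc F) (fiberPoly f g).SplittingField).range := by
    rintro ⟨r, rfl⟩
    refine no_root_ratFunc hH r ((algebraMap (RatFunc F) (fiberPoly f g).SplittingField).injective ?_)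
    simpa using hω
  have hcard : Nat.card ((fiberPoly f g).SplittingField ≃ₐ[RatFunc F]
      (fiberPoly f g).SplittingField) = 6 := by
    have h3 := natDegree_dvd_card_gal hsep (irreducible_fiberPoly hco hdeg)
    rw [hp] at h3
    exact Nat.dvd_antisymm (card_gal_dvd_six hsep hp)
      (Nat.Coprime.mul_dvd_of_dvd_of_dvd (by norm_num) (two_dvd_card_of_quadratic hω hωK) h3)
  obtain ⟨e⟩ := nonempty_perm_rootSet_mulEquiv hsep hp
  let E := (MulEquiv.ofBijective _ (permRoots_bijective hsep hp hcard)).trans e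
  refine ⟨⟨E⟩, nonempty_mulEquiv_alternatingGroup ?_⟩
  have hdvd : Nat.card (constGal f g) ∣ 6 := hcard ▸ Subgroup.card_subgroup_dvd_card _
  have hne : Nat.card (constGal f g) ≠ 6 := by
    intro h
    rw [← hcard, Subgroup.card_eq_iff_eq_top] at h
    refine hωK ((IsGalois.mem_range_algebraMap_iff_fixed ω).mpr fun σ => ?_)
    exact (h ▸ Subgroup.mem_top σ : σ ∈ constGal f g) ω ((isConstantElem_iff f g ω).mpr hωF)
  have h3 : 3 ∣ Nat.card (constGal f g) := by
    obtain ⟨a, b, hab, hab3⟩ := exists_orderOf_commutator_perm_fin_three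
    have hmem : ∀ σ τ, σ * τ * σ⁻¹ * τ⁻¹ ∈ constGal f g := by
      intro σ τ x hx
      rw [isConstantElem_iff] at hx
      have hy : IsAlgebraic F (σ⁻¹ (τ⁻¹ x)) :=
        (hx.algHom (AlgEquiv.restrictScalars F τ⁻¹).toAlgHom).algHom
          (AlgEquiv.restrictScalars F σ⁻¹).toAlgHom
      refine (algEquiv_comm_of_isAlgebraic (σ.restrictScalars F) (τ.restrictScalars F) hy).trans ?_
      change τ (σ (σ.symm (τ.symm x))) = x
      rw [AlgEquiv.apply_symm_apply, AlgEquiv.apply_symm_apply]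
    let c : constGal f g := ⟨_, hmem (E.symm a) (E.symm b)⟩
    have hc : E c = a * b * a⁻¹ * b⁻¹ := by simp [c]
    have : Fact (Nat.Prime 3) := ⟨Nat.prime_three⟩
    rw [← orderOf_eq_prime (x := c) (p := 3)]
    · exact orderOf_dvd_natCard c
    · apply Subtype.ext
      apply E.injective
      simp [hc, hab3]
    · intro h
      apply hab
      rw [← hc, h]
      simp
  obtain ⟨i, hi⟩ := h3
  have := Nat.le_of_dvd (by norm_num) hdvd
  have : 0 < Nat.card (constGal f g) := Nat.card_pos
  omega

theorem eq_zero_of_normForm_eq_zero {F : Type*} [Field F] {s n : F}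
    (hH : ∀ c : F, c ^ 2 - s * c + n ≠ 0) {x y : F} (h : x ^ 2 + s * x * y + n * y ^ 2 = 0) :
    x = 0 ∧ y = 0 := by
  have hy : y = 0 := by
    by_contra hy
    apply hH (-x / y)
    field_simp
    linear_combination h
  subst hy
  simpa using h

/-- The norm form of a quadratic extension has even degree on polynomials, which bounds norms and
traces of elements of the quadratic extension of the rational function field. -/
theorem coeff_eq_zero_of_norm_of_trace {F : Type*} [Field F] {s n : F}
    (hH : ∀ c : F, c ^ 2 - s * c + n ≠ 0) {R S : F[X]} (hR : R.natDegree ≤ 3)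
    (hS : S.natDegree ≤ 2) (u v : RatFunc F)
    (hRuv : algebraMap F[X] (RatFunc F) R =
      u ^ 2 + algebraMap F (RatFunc F) s * u * v + algebraMap F (RatFunc F) n * v ^ 2)
    (hSuv : algebraMap F[X] (RatFunc F) S = 2 * u + algebraMap F (RatFunc F) s * v) :
    R.coeff 3 = 0 ∧ S.coeff 2 = 0 := by
  have hnum : ∀ r : RatFunc F, algebraMap F[X] (RatFunc F) r.num =
      r * algebraMap F[X] (RatFunc F) r.denom := fun r =>
    (div_eq_iff (RatFunc.algebraMap_ne_zero r.denom_ne_zero)).mp (RatFunc.num_div_denom r)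
  obtain ⟨U, V, w, hw, hU, hV⟩ : ∃ U V w : F[X], w ≠ 0 ∧
      algebraMap F[X] (RatFunc F) U = algebraMap F[X] (RatFunc F) w * u ∧
      algebraMap F[X] (RatFunc F) V = algebraMap F[X] (RatFunc F) w * v := by
    refine ⟨u.num * v.denom, v.num * u.denom, u.denom * v.denom,
      mul_ne_zero u.denom_ne_zero v.denom_ne_zero, ?_, ?_⟩
    · rw [map_mul, map_mul, hnum u]; ring
    · rw [map_mul, map_mul, hnum v]; ring
  have hinj := IsFractionRing.injective F[X] (RatFunc F)
  have h1 : w ^ 2 * R = U ^ 2 + C s * (U * V) + C n * V ^ 2 := by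
    apply hinj
    simp only [map_add, map_mul, map_pow, hU, hV, hRuv, ← algebraMap_eq (R := F),
      ← IsScalarTower.algebraMap_apply]
    ring
  have h2 : w * S = 2 * U + C s * V := by
    apply hinj
    simp only [map_add, map_mul, hU, hV, hSuv, ← algebraMap_eq (R := F),
      ← IsScalarTower.algebraMap_apply, map_ofNat]
    ring
  clear hRuv hSuv hU hV
  set D := max U.natDegree V.natDegree with hD
  have hUD : U.natDegree ≤ D := le_max_left _ _
  have hVD : V.natDegree ≤ D := le_max_right _ _
  by_cases hUV : U.coeff D = 0 ∧ V.coeff D = 0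
  · have hU0 : U = 0 ∧ V = 0 := by
      rcases max_choice U.natDegree V.natDegree with h | h
      · rw [← hD] at h
        have hU0 : U = 0 := by rw [← leadingCoeff_eq_zero, leadingCoeff, ← h]; exact hUV.1
        refine ⟨hU0, ?_⟩
        rw [hU0, natDegree_zero] at h
        rw [eq_C_of_natDegree_le_zero (hVD.trans h.le), ← h, hUV.2, C_0]
      · rw [← hD] at h
        have hV0 : V = 0 := by rw [← leadingCoeff_eq_zero, leadingCoeff, ← h]; exact hUV.2
        refine ⟨?_, hV0⟩
        rw [hV0, natDegree_zero] at h
        rw [eq_C_of_natDegree_le_zero (hUD.trans h.le), ← h, hUV.1, C_0]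
    rw [hU0.1, hU0.2] at h1 h2
    have hR0 : R = 0 := by simpa [hw] using h1
    have hS0 : S = 0 := by simpa [hw] using h2
    simp [hR0, hS0]
  · have hc : (w ^ 2 * R).coeff (D + D) ≠ 0 := by
      rw [h1, coeff_add, coeff_add, coeff_C_mul, coeff_C_mul, sq, sq,
        coeff_mul_add_eq_of_natDegree_le hUD hUD, coeff_mul_add_eq_of_natDegree_le hUD hVD,
        coeff_mul_add_eq_of_natDegree_le hVD hVD]
      intro h
      exact hUV (eq_zero_of_normForm_eq_zero hH (by linear_combination h))
    have hle : (w ^ 2 * R).natDegree ≤ D + D := by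
      rw [h1, sq, sq]
      refine natDegree_add_le_of_degree_le (natDegree_add_le_of_degree_le ?_ ?_) ?_
      · exact natDegree_mul_le_of_le hUD hUD
      · exact (natDegree_C_mul_le _ _).trans (natDegree_mul_le_of_le hUD hVD)
      · exact (natDegree_C_mul_le _ _).trans (natDegree_mul_le_of_le hVD hVD)
    have hdeg := natDegree_eq_of_le_of_coeff_ne_zero hle hc
    have hR0 : R ≠ 0 := by
      rintro rfl
      simp at hc
    rw [natDegree_mul (pow_ne_zero 2 hw) hR0, natDegree_pow] at hdeg
    refine ⟨coeff_eq_zero_of_natDegree_lt (by omega), ?_⟩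
    by_cases hS0 : S = 0
    · simp [hS0]
    · have h3 : (w * S).natDegree ≤ D := by
        rw [h2]
        refine natDegree_add_le_of_degree_le ?_ ((natDegree_C_mul_le _ _).trans hVD)
        rw [← map_ofNat C]
        exact (natDegree_C_mul_le _ _).trans hUD
      rw [natDegree_mul hw hS0] at h3
      exact coeff_eq_zero_of_natDegree_lt (by omega)

theorem vieta_cubic_of_distinct {M : Type*} [Field M] {y₀ y₁ y₂ e₁ e₂ e₃ : M} (h01 : y₀ ≠ y₁)
    (h12 : y₁ ≠ y₂) (h02 : y₀ ≠ y₂) (h₀ : y₀ ^ 3 - e₁ * y₀ ^ 2 + e₂ * y₀ - e₃ = 0)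
    (h₁ : y₁ ^ 3 - e₁ * y₁ ^ 2 + e₂ * y₁ - e₃ = 0)
    (h₂ : y₂ ^ 3 - e₁ * y₂ ^ 2 + e₂ * y₂ - e₃ = 0) :
    e₁ = y₀ + y₁ + y₂ ∧ e₂ = y₀ * y₁ + y₁ * y₂ + y₂ * y₀ ∧ e₃ = y₀ * y₁ * y₂ := by
  have a1 : y₀ ^ 2 + y₀ * y₁ + y₁ ^ 2 - e₁ * (y₀ + y₁) + e₂ = 0 :=
    mul_left_cancel₀ (sub_ne_zero.mpr h01) (by linear_combination h₀ - h₁)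
  have a2 : y₀ ^ 2 + y₀ * y₂ + y₂ ^ 2 - e₁ * (y₀ + y₂) + e₂ = 0 :=
    mul_left_cancel₀ (sub_ne_zero.mpr h02) (by linear_combination h₀ - h₂)
  have b : e₁ = y₀ + y₁ + y₂ :=
    mul_left_cancel₀ (sub_ne_zero.mpr h12) (by linear_combination a2 - a1)
  subst b
  have c : e₂ = y₀ * y₁ + y₁ * y₂ + y₂ * y₀ := by linear_combination a1
  subst c
  exact ⟨rfl, rfl, by linear_combination -h₀⟩

theorem coeff_eq_zero_of_cubic {F M : Type*} [Field F] [Field M] [Algebra (RatFunc F) M]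
    [Algebra F M] [IsScalarTower F (RatFunc F) M] {s n : F}
    (hH : ∀ c : F, c ^ 2 - s * c + n ≠ 0) (ρ τ : M ≃ₐ[RatFunc F] M)
    (hfix : ∀ z, ρ z = z → τ z = z → z ∈ (algebraMap (RatFunc F) M).range)
    {x : M} (hρx : ρ x = x) (hτx : τ x = algebraMap F M s - x) (hx : τ x ≠ x)
    (hxn : x ^ 2 - algebraMap F M s * x + algebraMap F M n = 0)
    {y₀ y₁ y₂ : M} (h01 : y₀ ≠ y₁) (h12 : y₁ ≠ y₂) (h02 : y₀ ≠ y₂)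
    (hρ₀ : ρ y₀ = y₁) (hρ₁ : ρ y₁ = y₂) (hρ₂ : ρ y₂ = y₀)
    (hτ₀ : τ y₀ = y₁) (hτ₁ : τ y₁ = y₀) (hτ₂ : τ y₂ = y₂)
    {T : RatFunc F} (ψ : RatFunc F →ₐ[F] RatFunc F) (hψ : ψ T = RatFunc.X)
    {b b' c c' e : F} (he : e ≠ 0)
    (hroot : ∀ y, y = y₀ ∨ y = y₁ ∨ y = y₂ →
      y ^ 3 - (algebraMap F M b * algebraMap (RatFunc F) M T + algebraMap F M b') * y ^ 2 +
        (algebraMap F M c * algebraMap (RatFunc F) M T + algebraMap F M c') * y -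
        algebraMap F M e = 0) : b = 0 ∧ c = 0 := by
  obtain ⟨v1, v2, v3⟩ := vieta_cubic_of_distinct h01 h12 h02 (hroot y₀ (by simp))
    (hroot y₁ (by simp)) (hroot y₂ (by simp))
  obtain ⟨z, hz⟩ : ∃ z, z = y₀ ^ 2 * y₁ + y₁ ^ 2 * y₂ + y₂ ^ 2 * y₀ := ⟨_, rfl⟩
  obtain ⟨z', hz'⟩ : ∃ z', z' = y₁ ^ 2 * y₀ + y₀ ^ 2 * y₂ + y₂ ^ 2 * y₁ := ⟨_, rfl⟩
  have hρz : ρ z = z := by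
    rw [hz]; simp only [map_add, map_mul, map_pow, hρ₀, hρ₁, hρ₂]; ring
  have hρz' : ρ z' = z' := by
    rw [hz']; simp only [map_add, map_mul, map_pow, hρ₀, hρ₁, hρ₂]; ring
  have hτz : τ z = z' := by
    rw [hz, hz']; simp only [map_add, map_mul, map_pow, hτ₀, hτ₁, hτ₂]
  have hτz' : τ z' = z := by
    rw [hz, hz']; simp only [map_add, map_mul, map_pow, hτ₀, hτ₁, hτ₂]
  have hs : ∀ (σ : M ≃ₐ[RatFunc F] M) (r : F), σ (algebraMap F M r) = algebraMap F M r :=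
    fun σ r => (σ.restrictScalars F).commutes r
  have hx0 : x - (algebraMap F M s - x) ≠ 0 := by
    rw [← hτx]; exact sub_ne_zero.mpr hx.symm
  have hx0' : algebraMap F M s - x - (algebraMap F M s - (algebraMap F M s - x)) ≠ 0 := by
    intro h; apply hx0; linear_combination -h
  obtain ⟨v, hv⟩ := hfix ((z - z') / (x - (algebraMap F M s - x)))
    (by simp only [map_div₀, map_sub, hρz, hρz', hρx, hs])
    (by
      simp only [map_div₀, map_sub, hτz, hτz', hτx, hs]
      rw [div_eq_div_iff hx0' hx0]
      ring)
  rw [eq_div_iff hx0] at hv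
  obtain ⟨u, hu⟩ := hfix (z - algebraMap (RatFunc F) M v * x)
    (by simp only [map_mul, map_sub, hρz, hρx, AlgEquiv.commutes])
    (by
      simp only [map_mul, map_sub, hτz, hτx, AlgEquiv.commutes]
      linear_combination hv)
  have hzu : z = algebraMap (RatFunc F) M u + algebraMap (RatFunc F) M v * x := by
    linear_combination -hu
  have hzu' : z' = algebraMap (RatFunc F) M u +
      algebraMap (RatFunc F) M v * (algebraMap F M s - x) := by
    linear_combination hzu + hv
  let e₁ : F[X] := C b * X + C b'
  let e₂ : F[X] := C c * X + C c'
  let S : F[X] := e₁ * e₂ - C (3 * e)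
  let R : F[X] := e₁ ^ 3 * C e + e₂ ^ 3 - 6 * e₁ * e₂ * C e + C (9 * e ^ 2)
  have hM : ∀ r : F, algebraMap F M r = algebraMap (RatFunc F) M (algebraMap F (RatFunc F) r) :=
    IsScalarTower.algebraMap_apply F (RatFunc F) M
  have hinj := (algebraMap (RatFunc F) M).injective
  have hψS : ψ (aeval T S) = algebraMap F[X] (RatFunc F) S := by
    rw [← aeval_algHom_apply, hψ, ← RatFunc.algebraMap_X, aeval_algebraMap_apply, aeval_X_left_apply]
  have hψR : ψ (aeval T R) = algebraMap F[X] (RatFunc F) R := by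
    rw [← aeval_algHom_apply, hψ, ← RatFunc.algebraMap_X, aeval_algebraMap_apply, aeval_X_left_apply]
  have hRK : aeval T R = u ^ 2 + algebraMap F (RatFunc F) s * u * v +
      algebraMap F (RatFunc F) n * v ^ 2 := by
    apply hinj
    simp only [R, e₁, e₂, map_add, map_sub, map_mul, map_pow, aeval_C, aeval_X, map_ofNat, ← hM,
      v1, v2, v3]
    have : z * z' = algebraMap (RatFunc F) M u ^ 2 + algebraMap F M s * algebraMap (RatFunc F) M u *
        algebraMap (RatFunc F) M v + algebraMap F M n * algebraMap (RatFunc F) M v ^ 2 := by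
      rw [hzu, hzu']
      linear_combination -algebraMap (RatFunc F) M v ^ 2 * hxn
    rw [← this, hz, hz']
    ring
  have hSK : aeval T S = 2 * u + algebraMap F (RatFunc F) s * v := by
    apply hinj
    simp only [S, e₁, e₂, map_add, map_sub, map_mul, aeval_C, aeval_X, map_ofNat, ← hM,
      v1, v2, v3]
    have : z + z' = 2 * algebraMap (RatFunc F) M u +
        algebraMap F M s * algebraMap (RatFunc F) M v := by
      rw [hzu, hzu']; ring
    rw [← this, hz, hz']
    ring
  have hRdeg : R.natDegree ≤ 3 := by
    simp only [R, e₁, e₂]; compute_degree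
  have hSdeg : S.natDegree ≤ 2 := by
    simp only [S, e₁, e₂]; compute_degree
  obtain ⟨r3, s2⟩ := coeff_eq_zero_of_norm_of_trace hH hRdeg hSdeg (ψ u) (ψ v)
    (by rw [← hψR, hRK]; simp only [map_add, map_mul, map_pow, AlgHom.commutes])
    (by rw [← hψS, hSK]; simp only [map_add, map_mul, map_ofNat, AlgHom.commutes])
  have hS2 : S.coeff 2 = b * c := by
    have : S = C (b * c) * X ^ 2 + C (b * c' + b' * c) * X + C (b' * c' - 3 * e) := by
      simp only [S, e₁, e₂, C_mul, C_add, C_sub]; ring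
    rw [this]; simp only [coeff_add, coeff_C_mul, coeff_X_pow, coeff_X, coeff_C]; norm_num
  have hR3 : R.coeff 3 = b ^ 3 * e + c ^ 3 := by
    have : R = C (b ^ 3 * e + c ^ 3) * X ^ 3 +
        C (3 * b ^ 2 * b' * e + 3 * c ^ 2 * c' - 6 * b * c * e) * X ^ 2 +
        C (3 * b * b' ^ 2 * e + 3 * c * c' ^ 2 - 6 * (b * c' + b' * c) * e) * X +
        C (b' ^ 3 * e + c' ^ 3 - 6 * b' * c' * e + 9 * e ^ 2) := by
      simp only [R, e₁, e₂, C_mul, C_add, C_sub, C_pow, map_ofNat]; ring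
    rw [this]; simp only [coeff_add, coeff_C_mul, coeff_X_pow, coeff_X, coeff_C]; norm_num
  rw [hS2] at s2
  rw [hR3] at r3
  rcases mul_eq_zero.mp s2 with h | h <;> subst h
  · simpa using r3
  · simpa [he] using r3

theorem exists_perm_mulEquiv {K : Type*} [Field K] {p : K[X]} (hp : p.Separable)
    (hdeg : p.natDegree = 3) (hcard : Nat.card (p.SplittingField ≃ₐ[K] p.SplittingField) = 6) :
    ∃ (α : Fin 3 → p.SplittingField)
      (Φ : (p.SplittingField ≃ₐ[K] p.SplittingField) ≃* Equiv.Perm (Fin 3)),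
      Function.Injective α ∧ (∀ i, α i ∈ p.rootSet p.SplittingField) ∧
        ∀ σ i, σ (α i) = α (Φ σ i) := by
  have h := card_rootSet_splittingField hp
  rw [hdeg] at h
  let e := Finite.equivFinOfCardEq h
  refine ⟨fun i => e.symm i,
    (MulEquiv.ofBijective _ (permRoots_bijective hp hdeg hcard)).trans e.permCongrHom,
    fun i j hij => e.symm.injective (Subtype.ext hij), fun i => (e.symm i).2, fun σ i => ?_⟩
  simp [Equiv.permCongrHom, permRoots_apply]

theorem exists_mul_pow_perm_fin_three (π : Equiv.Perm (Fin 3)) :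
    ∃ i j : Fin 3, π = finRotate 3 ^ (i : ℕ) * Equiv.swap 0 1 ^ (j : ℕ) := by
  revert π
  decide

/-- If the Galois group of a cubic is the full symmetric group and a subgroup `N` has order three,
then the rotation of the roots lies in `N` and the transposition of two roots does not. -/
theorem exists_rotation_transposition {K : Type*} [Field K] {p : K[X]} (hp : p.Separable)
    (hdeg : p.natDegree = 3) (hcard : Nat.card (p.SplittingField ≃ₐ[K] p.SplittingField) = 6)
    (N : Subgroup (p.SplittingField ≃ₐ[K] p.SplittingField)) (hN : Nat.card N = 3) :
    ∃ (α : Fin 3 → p.SplittingField) (ρ τ : p.SplittingField ≃ₐ[K] p.SplittingField),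
      Function.Injective α ∧ (∀ i, α i ∈ p.rootSet p.SplittingField) ∧
        (∀ i, ρ (α i) = α (finRotate 3 i)) ∧ (∀ i, τ (α i) = α (Equiv.swap 0 1 i)) ∧
        ρ ∈ N ∧ τ ∉ N ∧ τ ^ 2 = 1 ∧
        ∀ z, ρ z = z → τ z = z → z ∈ (algebraMap K p.SplittingField).range := by
  obtain ⟨α, Φ, hα, hroot, hΦ⟩ := exists_perm_mulEquiv hp hdeg hcard
  have hτ2 : Φ.symm (Equiv.swap 0 1) ^ 2 = 1 := by
    rw [← map_pow, show (Equiv.swap 0 1 : Equiv.Perm (Fin 3)) ^ 2 = 1 by decide, map_one]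
  refine ⟨α, Φ.symm (finRotate 3), Φ.symm (Equiv.swap 0 1), hα, hroot, fun i => by
    rw [hΦ, Φ.apply_symm_apply], fun i => by rw [hΦ, Φ.apply_symm_apply], ?_, fun h => ?_, hτ2,
    fun z hρ hτ => ?_⟩
  · have hidx : N.index = 2 := by
      have := N.card_mul_index
      rw [hN, hcard] at this
      omega
    rw [show finRotate 3 = (finRotate 3 ^ 2) ^ 2 by decide, map_pow]
    exact Subgroup.sq_mem_of_index_two hidx _
  · have h3 : Φ.symm (Equiv.swap 0 1) ^ 3 = 1 := by
      have := orderOf_dvd_natCard (⟨_, h⟩ : N)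
      rwa [Subgroup.orderOf_mk, hN, orderOf_dvd_iff_pow_eq_one] at this
    rw [pow_succ, hτ2, one_mul, EmbeddingLike.map_eq_one_iff] at h3
    revert h3
    decide
  · have : IsGalois K p.SplittingField := IsGalois.of_separable_splitting_field hp
    rw [RingHom.mem_range, ← Set.mem_range, IsGalois.mem_range_algebraMap_iff_fixed]
    intro σ
    obtain ⟨i, j, hij⟩ := exists_mul_pow_perm_fin_three (Φ σ)
    have hmem : σ ∈ MulAction.stabilizer (p.SplittingField ≃ₐ[K] p.SplittingField) z := by
      rw [← Φ.symm_apply_apply σ, hij, map_mul, map_pow, map_pow]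
      exact mul_mem (pow_mem (MulAction.mem_stabilizer_iff.mpr hρ) _)
        (pow_mem (MulAction.mem_stabilizer_iff.mpr hτ) _)
    exact hmem

theorem mem_range_of_isAlgebraic {F M : Type*} [Field F] [Field M] [Algebra (RatFunc F) M]
    [Algebra F M] [IsScalarTower F (RatFunc F) M] {z : M} (hz : IsAlgebraic F z)
    (h : z ∈ (algebraMap (RatFunc F) M).range) : ∃ c : F, algebraMap F M c = z := by
  obtain ⟨r, rfl⟩ := h
  rw [isAlgebraic_algebraMap_iff (algebraMap (RatFunc F) M).injective] at hz
  by_contra hc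
  refine RatFunc.transcendental_of_ne_C r ?_ hz
  rintro ⟨c, rfl⟩
  exact hc ⟨c, IsScalarTower.algebraMap_apply F (RatFunc F) M c⟩

/-- If the arithmetic and geometric monodromy groups are `S₃` and `A₃`, the field of constants
contains a quadratic irrationality moved by the transposition of two roots. -/
theorem exists_quadratic_constant {F : Type} [Field F] {f g : F[X]}
    (hdeg : max f.natDegree g.natDegree = 3) (hsep : (fiberPoly f g).Separable)
    (hG : Nat.card ((fiberPoly f g).SplittingField ≃ₐ[RatFunc F]
      (fiberPoly f g).SplittingField) = 6) (hN : Nat.card (constGal f g) = 3) :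
    ∃ (α : Fin 3 → (fiberPoly f g).SplittingField)
      (ρ τ : (fiberPoly f g).SplittingField ≃ₐ[RatFunc F] (fiberPoly f g).SplittingField),
      Function.Injective α ∧
        (∀ i, α i ∈ (fiberPoly f g).rootSet (fiberPoly f g).SplittingField) ∧
        (∀ i, ρ (α i) = α (finRotate 3 i)) ∧ (∀ i, τ (α i) = α (Equiv.swap 0 1 i)) ∧
        (∀ z, ρ z = z → τ z = z →
          z ∈ (algebraMap (RatFunc F) (fiberPoly f g).SplittingField).range) ∧
        ∃ (s n : F) (x : (fiberPoly f g).SplittingField), (∀ c : F, c ^ 2 - s * c + n ≠ 0) ∧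
          ρ x = x ∧ τ x = algebraMap F _ s - x ∧ τ x ≠ x ∧
          x ^ 2 - algebraMap F _ s * x + algebraMap F _ n = 0 := by
  obtain ⟨α, ρ, τ, hα, hroot, hρα, hτα, hρ, hτ, hτ2, hfix⟩ :=
    exists_rotation_transposition hsep (natDegree_fiberPoly hdeg) hG (constGal f g) hN
  refine ⟨α, ρ, τ, hα, hroot, hρα, hτα, hfix, ?_⟩
  obtain ⟨x, hx, hτx⟩ : ∃ x, isConstantElem f g x ∧ τ x ≠ x := by
    by_contra! h
    exact hτ h
  have hττ : τ (τ x) = x := by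
    rw [← AlgEquiv.mul_apply, ← sq, hτ2, AlgEquiv.one_apply]
  have hxa : IsAlgebraic F x := (isConstantElem_iff f g x).mp hx
  have hτxa : IsAlgebraic F (τ x) := hxa.algHom (τ.restrictScalars F).toAlgHom
  have hρx : ρ x = x := hρ x hx
  have hρτx : ρ (τ x) = τ x := hρ _ ((isConstantElem_iff f g _).mpr hτxa)
  obtain ⟨s, hs⟩ := mem_range_of_isAlgebraic (hxa.add hτxa)
    (hfix _ (by rw [map_add, hρx, hρτx]) (by rw [map_add, hττ, add_comm]))
  obtain ⟨n, hn⟩ := mem_range_of_isAlgebraic (hxa.mul hτxa)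
    (hfix _ (by rw [map_mul, hρx, hρτx]) (by rw [map_mul, hττ, mul_comm]))
  refine ⟨s, n, x, fun c hc => hτx ?_, hρx, by rw [hs]; ring, hτx, by rw [hs, hn]; ring⟩
  have h : (algebraMap F _ c - x) * (algebraMap F _ c - τ x) = 0 := by
    have := congrArg (algebraMap F (fiberPoly f g).SplittingField) hc
    simp only [map_add, map_sub, map_mul, map_pow, map_zero, hs, hn] at this
    linear_combination this
  have hc' : τ (algebraMap F _ c) = algebraMap F _ c := (τ.restrictScalars F).commutes c
  rcases mul_eq_zero.mp h with h | h
  · rw [← sub_eq_zero.mp h, hc']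
  · rw [← hττ, ← sub_eq_zero.mp h, hc', hc']

theorem exists_algHom_inv_X_sub {F : Type*} [Field F] (t : F) :
    ∃ ψ : RatFunc F →ₐ[F] RatFunc F,
      ψ (RatFunc.X - algebraMap F (RatFunc F) t)⁻¹ = RatFunc.X := by
  have htr : Transcendental F (algebraMap F (RatFunc F) t + RatFunc.X⁻¹) := by
    intro h
    have h' := (h.sub (isAlgebraic_algebraMap t)).inv
    rw [add_sub_cancel_left, inv_inv] at h'
    exact RatFunc.transcendental_X h'
  refine ⟨(IntermediateField.val _).comp (RatFunc.algEquivOfTranscendental _ htr).toAlgHom, ?_⟩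
  have hX : ((IntermediateField.val _).comp (RatFunc.algEquivOfTranscendental _ htr).toAlgHom)
      RatFunc.X = algebraMap F (RatFunc F) t + RatFunc.X⁻¹ :=
    RatFunc.algEquivOfTranscendental_X _ htr
  rw [map_inv₀, map_sub, hX, AlgHom.commutes, add_sub_cancel_left, inv_inv]

/-- The pencil spanned by `f` and `g`, with a basis whose first member vanishes on the fibre over a
given point of the projective line. -/
theorem exists_pencil {F : Type} [Field F] {f g : F[X]} (hco : IsCoprime f g)
    (hdeg : max f.natDegree g.natDegree = 3) (t : Option F) :
    ∃ (P Q : F[X]) (T : RatFunc F) (ψ : RatFunc F →ₐ[F] RatFunc F), IsCoprime P Q ∧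
      P.natDegree ≤ 3 ∧ Q.natDegree ≤ 3 ∧ (P.coeff 3 = 0 → Q.coeff 3 ≠ 0) ∧ ψ T = RatFunc.X ∧
      (∀ α ∈ (fiberPoly f g).rootSet (fiberPoly f g).SplittingField,
        aeval α P * algebraMap (RatFunc F) _ T = aeval α Q) ∧
      (∀ a, ratEval f g (some a) = t → P.eval a = 0) ∧
      (ratEval f g none = t → P.coeff 3 = 0) := by
  have hf : f.natDegree ≤ 3 := hdeg ▸ le_max_left _ _
  have hg : g.natDegree ≤ 3 := hdeg ▸ le_max_right _ _
  have h3 : g.coeff 3 = 0 → f.coeff 3 ≠ 0 := by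
    intro h0 h1
    rcases max_choice f.natDegree g.natDegree with h | h <;> rw [hdeg] at h
    · rw [h, coeff_natDegree, leadingCoeff_eq_zero] at h1
      simp [h1] at h
    · rw [h, coeff_natDegree, leadingCoeff_eq_zero] at h0
      simp [h0] at h
  cases t with
  | none =>
    refine ⟨g, f, RatFunc.X, AlgHom.id F _, hco.symm, hg, hf, h3, rfl, fun α hα => ?_,
      fun a h => ?_, fun h => ?_⟩
    · rw [aeval_eq_of_mem_rootSet hα, mul_comm]
    · by_contra h0
      simp [ratEval, h0] at h
    · by_contra h0
      simp [ratEval_none hdeg, h0] at h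
  | some t =>
    obtain ⟨ψ, hψ⟩ := exists_algHom_inv_X_sub t
    refine ⟨f - C t * g, g, _, ψ, ?_, ?_, hg, ?_, hψ, fun α hα => ?_, fun a h => ?_, fun h => ?_⟩
    · rw [sub_eq_add_neg, ← neg_mul]
      exact hco.add_mul_right_left _
    · exact (natDegree_sub_le_of_le hf ((natDegree_C_mul_le _ _).trans hg)).trans_eq (max_self 3)
    · intro h h0
      rw [coeff_sub, coeff_C_mul, h0, mul_zero, sub_zero] at h
      exact h3 h0 h
    · have hne : algebraMap (RatFunc F) (fiberPoly f g).SplittingField RatFunc.X -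
          algebraMap F _ t ≠ 0 := sub_ne_zero.mpr (algebraMap_X_ne_algebraMap t)
      rw [map_sub, map_mul, aeval_C, aeval_eq_of_mem_rootSet hα, map_inv₀, map_sub,
        ← IsScalarTower.algebraMap_apply, ← sub_mul]
      field_simp
    · by_cases h0 : g.eval a = 0
      · simp [ratEval, h0] at h
      · simp only [ratEval, ne_eq, h0, not_false_eq_true, if_true, Option.some_inj] at h
        rw [eval_sub, eval_mul, eval_C, ← h, div_mul_cancel₀ _ h0, sub_self]
    · by_cases h0 : g.coeff 3 = 0
      · simp [ratEval_none hdeg, h0] at h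
      · simp only [ratEval_none hdeg, ne_eq, h0, not_false_eq_true, if_true, Option.some_inj] at h
        rw [coeff_sub, coeff_C_mul, ← h, div_mul_cancel₀ _ h0, sub_self]

theorem exists_roots_forall_coeff_eq_zero {F : Type} [Field F] {f g : F[X]}
    (hdeg : max f.natDegree g.natDegree = 3) (hsep : (fiberPoly f g).Separable)
    (hG : Nat.card ((fiberPoly f g).SplittingField ≃ₐ[RatFunc F]
      (fiberPoly f g).SplittingField) = 6) (hN : Nat.card (constGal f g) = 3) :
    ∃ α : Fin 3 → (fiberPoly f g).SplittingField, Function.Injective α ∧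
      (∀ i, α i ∈ (fiberPoly f g).rootSet (fiberPoly f g).SplittingField) ∧
      ∀ y : Fin 3 → (fiberPoly f g).SplittingField, Function.Injective y →
        (∀ (σ : (fiberPoly f g).SplittingField ≃ₐ[RatFunc F] (fiberPoly f g).SplittingField) i j,
          σ (α i) = α j → σ (y i) = y j) →
        ∀ (T : RatFunc F) (ψ : RatFunc F →ₐ[F] RatFunc F), ψ T = RatFunc.X →
        ∀ b₁ b₂ q₀ q₁ q₂ q₃ : F, q₀ ≠ 0 → q₃ ≠ 0 →
          (∀ i, (algebraMap F _ b₁ * y i + algebraMap F _ b₂ * y i ^ 2) * algebraMap (RatFunc F) _ T =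
            algebraMap F _ q₀ + algebraMap F _ q₁ * y i + algebraMap F _ q₂ * y i ^ 2 +
              algebraMap F _ q₃ * y i ^ 3) → b₁ = 0 ∧ b₂ = 0 := by
  obtain ⟨α, ρ, τ, hα, hroot, hρ, hτ, hfix, s, n, x, hH, hρx, hτx, hx, hxn⟩ :=
    exists_quadratic_constant hdeg hsep hG hN
  refine ⟨α, hα, hroot, fun y hy hσ T ψ hψ b₁ b₂ q₀ q₁ q₂ q₃ hq₀ hq₃ h => ?_⟩
  have hq₃' : algebraMap F (fiberPoly f g).SplittingField q₃ ≠ 0 := by simpa using hq₃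
  obtain ⟨hb, hc⟩ := coeff_eq_zero_of_cubic hH ρ τ hfix hρx hτx hx hxn
    (hy.ne (show (0 : Fin 3) ≠ 1 by decide)) (hy.ne (show (1 : Fin 3) ≠ 2 by decide))
    (hy.ne (show (0 : Fin 3) ≠ 2 by decide))
    (hσ ρ 0 1 (hρ 0)) (hσ ρ 1 2 (hρ 1)) (hσ ρ 2 0 (hρ 2))
    (hσ τ 0 1 (hτ 0)) (hσ τ 1 0 (hτ 1)) (hσ τ 2 2 (hτ 2)) ψ hψ
    (b := b₂ / q₃) (b' := -q₂ / q₃) (c := -b₁ / q₃) (c' := q₁ / q₃) (e := -q₀ / q₃)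
    (div_ne_zero (neg_ne_zero.mpr hq₀) hq₃) (by
      have key : ∀ i, y i ^ 3 - (algebraMap F _ (b₂ / q₃) * algebraMap (RatFunc F) _ T +
          algebraMap F _ (-q₂ / q₃)) * y i ^ 2 + (algebraMap F _ (-b₁ / q₃) *
          algebraMap (RatFunc F) _ T + algebraMap F _ (q₁ / q₃)) * y i -
          algebraMap F _ (-q₀ / q₃) = 0 := by
        intro i
        simp only [map_div₀, map_neg]
        field_simp
        linear_combination -h i
      rintro _ (rfl | rfl | rfl)
      exacts [key 0, key 1, key 2])
  simpa [hq₃] using And.intro hc hb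

theorem aeval_cubic {F M : Type*} [CommRing F] [CommRing M] [Algebra F M] {p : F[X]}
    (hp : p.natDegree ≤ 3) (x : M) :
    aeval x p = algebraMap F M (p.coeff 0) + algebraMap F M (p.coeff 1) * x +
      algebraMap F M (p.coeff 2) * x ^ 2 + algebraMap F M (p.coeff 3) * x ^ 3 := by
  conv_lhs => rw [eq_cubic_of_natDegree_le hp]
  simp only [map_add, map_mul, map_pow, aeval_C, aeval_X]

theorem eval_cubic {F : Type*} [CommRing F] {p : F[X]} (hp : p.natDegree ≤ 3) (x : F) :
    p.eval x = p.coeff 0 + p.coeff 1 * x + p.coeff 2 * x ^ 2 + p.coeff 3 * x ^ 3 := by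
  simpa only [coe_aeval_eq_eval, Algebra.algebraMap_self, RingHom.id_apply] using aeval_cubic hp x

theorem aeval_ne_zero_of_isCoprime {F M : Type*} [CommRing F] [CommRing M] [Nontrivial M]
    [Algebra F M] {p r : F[X]} (h : IsCoprime p r) {x : M} (hx : aeval x p = 0) :
    aeval x r ≠ 0 := by
  intro h0
  obtain ⟨u, v, huv⟩ := h
  simpa [hx, h0] using congrArg (aeval x) huv

theorem injective_of_card_gal {F : Type} [Field F] {f g : F[X]} (hco : IsCoprime f g)
    (hdeg : max f.natDegree g.natDegree = 3) (hsep : (fiberPoly f g).Separable)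
    (hG : Nat.card ((fiberPoly f g).SplittingField ≃ₐ[RatFunc F]
      (fiberPoly f g).SplittingField) = 6) (hN : Nat.card (constGal f g) = 3) :
    Function.Injective (ratEval f g) := by
  obtain ⟨α, hα, hroot, hmain⟩ := exists_roots_forall_coeff_eq_zero hdeg hsep hG hN
  have hcomm : ∀ (σ : (fiberPoly f g).SplittingField ≃ₐ[RatFunc F] (fiberPoly f g).SplittingField)
      (r : F), σ (algebraMap F _ r) = algebraMap F _ r := fun σ r =>
    (σ.restrictScalars F).commutes r
  have hinf : ∀ a, ratEval f g (some a) ≠ ratEval f g none := by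
    intro a h
    obtain ⟨P, Q, T, ψ, hPQ, hP, hQ, h3, hψ, hrel, hev, hev'⟩ :=
      exists_pencil hco hdeg (ratEval f g none)
    have hPa := hev a h
    have hP3 := hev' rfl
    have hQa := aeval_ne_zero_of_isCoprime hPQ hPa
    rw [coe_aeval_eq_eval] at hQa
    rw [eval_cubic hP] at hPa
    obtain ⟨h1, h2⟩ := hmain (fun i => α i - algebraMap F _ a)
      (fun i j hij => hα (sub_left_injective hij))
      (fun σ i j hij => by simp only [map_sub, hij, hcomm]) T ψ hψ
      (P.coeff 1 + 2 * a * P.coeff 2) (P.coeff 2) (Q.eval a)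
      (Q.coeff 1 + 2 * a * Q.coeff 2 + 3 * a ^ 2 * Q.coeff 3) (Q.coeff 2 + 3 * a * Q.coeff 3)
      (Q.coeff 3) hQa (h3 hP3) (fun i => by
        have hi := hrel _ (hroot i)
        have hPa' := congrArg (algebraMap F (fiberPoly f g).SplittingField) hPa
        rw [aeval_cubic hP, aeval_cubic hQ] at hi
        rw [eval_cubic hQ]
        simp only [hP3, map_add, map_mul, map_pow, map_zero, map_ofNat] at hi hPa' ⊢
        linear_combination hi - algebraMap (RatFunc F) _ T * hPa')
    have hP0 : P = 0 := by
      rw [h2, mul_zero, add_zero] at h1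
      rw [h1, h2, hP3] at hPa
      rw [eq_cubic_of_natDegree_le hP, h1, h2, hP3]
      simpa using hPa
    rw [hP0] at hPQ
    have := natDegree_eq_zero_of_isUnit (isCoprime_zero_left.mp hPQ)
    exact h3 hP3 (coeff_eq_zero_of_natDegree_lt (by omega))
  have hfin : ∀ a b, a ≠ b → ratEval f g (some a) ≠ ratEval f g (some b) := by
    intro a b hab h
    obtain ⟨P, Q, T, ψ, hPQ, hP, hQ, -, hψ, hrel, hev, -⟩ :=
      exists_pencil hco hdeg (ratEval f g (some b))
    have hPa := hev a h
    have hPb := hev b rfl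
    have hQa := aeval_ne_zero_of_isCoprime hPQ hPa
    have hQb := aeval_ne_zero_of_isCoprime hPQ hPb
    rw [coe_aeval_eq_eval] at hQa hQb
    rw [eval_cubic hP] at hPa hPb
    have hαb : ∀ i, α i - algebraMap F _ b ≠ 0 := by
      intro i h0
      have hi := hrel _ (hroot i)
      rw [sub_eq_zero.mp h0, aeval_algebraMap_apply, aeval_algebraMap_apply, coe_aeval_eq_eval,
        hev b rfl, map_zero, zero_mul, eq_comm, map_eq_zero] at hi
      exact hQb hi
    have hab' : algebraMap F (fiberPoly f g).SplittingField a - algebraMap F _ b ≠ 0 := by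
      rw [← map_sub]
      exact (_root_.map_ne_zero _).mpr (sub_ne_zero.mpr hab)
    obtain ⟨h1, h2⟩ := hmain
      (fun i => (α i - algebraMap F _ a) / (α i - algebraMap F _ b))
      (fun i j hij => by
        rw [div_eq_div_iff (hαb i) (hαb j)] at hij
        apply hα
        apply mul_left_cancel₀ hab'
        linear_combination hij)
      (fun σ i j hij => by simp only [map_div₀, map_sub, hij, hcomm]) T ψ hψ
      (-3 * P.coeff 0 - (2 * a + b) * P.coeff 1 - (a ^ 2 + 2 * a * b) * P.coeff 2 -
        3 * a ^ 2 * b * P.coeff 3)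
      (3 * P.coeff 0 + (a + 2 * b) * P.coeff 1 + (2 * a * b + b ^ 2) * P.coeff 2 +
        3 * a * b ^ 2 * P.coeff 3)
      (Q.eval a)
      (-3 * Q.coeff 0 - (2 * a + b) * Q.coeff 1 - (a ^ 2 + 2 * a * b) * Q.coeff 2 -
        3 * a ^ 2 * b * Q.coeff 3)
      (3 * Q.coeff 0 + (a + 2 * b) * Q.coeff 1 + (2 * a * b + b ^ 2) * Q.coeff 2 +
        3 * a * b ^ 2 * Q.coeff 3)
      (-Q.eval b) hQa (neg_ne_zero.mpr hQb) (fun i => by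
        have hi := hrel _ (hroot i)
        have hPa' := congrArg (algebraMap F (fiberPoly f g).SplittingField) hPa
        have hPb' := congrArg (algebraMap F (fiberPoly f g).SplittingField) hPb
        have hi0 := hαb i
        rw [aeval_cubic hP, aeval_cubic hQ] at hi
        rw [eval_cubic hQ, eval_cubic hQ]
        simp only [map_add, map_sub, map_neg, map_mul, map_pow, map_zero, map_ofNat]
          at hi hPa' hPb' ⊢
        generalize algebraMap F (fiberPoly f g).SplittingField a = a' at *
        generalize algebraMap F (fiberPoly f g).SplittingField b = b' at *
        field_simp
        linear_combination (a' - b') ^ 3 * hi -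
          algebraMap (RatFunc F) _ T * (α i - b') ^ 3 * hPa' +
          algebraMap (RatFunc F) _ T * (α i - a') ^ 3 * hPb')
    have hPα : aeval (α 0) P = 0 := by
      apply mul_left_cancel₀ (pow_ne_zero 3 hab')
      rw [aeval_cubic hP]
      have hPa' := congrArg (algebraMap F (fiberPoly f g).SplittingField) hPa
      have hPb' := congrArg (algebraMap F (fiberPoly f g).SplittingField) hPb
      have h1' := congrArg (algebraMap F (fiberPoly f g).SplittingField) h1
      have h2' := congrArg (algebraMap F (fiberPoly f g).SplittingField) h2
      simp only [map_add, map_sub, map_neg, map_mul, map_pow, map_zero, map_ofNat]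
        at hPa' hPb' h1' h2'
      generalize algebraMap F (fiberPoly f g).SplittingField a = a' at *
      generalize algebraMap F (fiberPoly f g).SplittingField b = b' at *
      linear_combination (α 0 - b') ^ 3 * hPa' - (α 0 - a') ^ 3 * hPb' +
        (α 0 - a') * (α 0 - b') ^ 2 * h1' + (α 0 - a') ^ 2 * (α 0 - b') * h2'
    apply aeval_ne_zero_of_isCoprime hPQ hPα
    rw [← hrel _ (hroot 0), hPα, zero_mul]
  rintro (_ | a) (_ | b) h
  · rfl
  · exact (hinf b h.symm).elim
  · exact (hinf a h).elim
  · by_contra hab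
    exact hfin a b (fun h' => hab (congrArg some h')) h

theorem stmt_2 (F : Type) [Field F] [Fintype F] (hq : 13 ≤ Fintype.card F)
    (f g : F[X]) (hco : IsCoprime f g) (hdeg : max f.natDegree g.natDegree = 3)
    (hsep : (fiberPoly f g).Separable) :
    Function.Bijective (ratEval f g) ↔
      Nonempty (((fiberPoly f g).SplittingField ≃ₐ[RatFunc F] (fiberPoly f g).SplittingField)
        ≃* Equiv.Perm (Fin 3)) ∧
      Nonempty (constGal f g ≃* alternatingGroup (Fin 3)) := by
  refine ⟨fun h => galois_groups_of_injective hq hco hdeg hsep h.injective, ?_⟩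
  rintro ⟨⟨e⟩, ⟨e'⟩⟩
  have hG : Nat.card (Equiv.Perm (Fin 3)) = 6 := by rw [Nat.card_perm, Nat.card_fin]; rfl
  have hN := two_mul_nat_card_alternatingGroup (α := Fin 3)
  rw [hG] at hN
  refine Finite.injective_iff_bijective.mp (injective_of_card_gal hco hdeg hsep
    ((Nat.card_congr e.toEquiv).trans hG) ((Nat.card_congr e'.toEquiv).trans ?_))
  omega

end
end

section
/- Let q ≥ 13 be a prime power and let φ = f/g ∈ F_q(x) be a separable rational function of degree 3, with f, g ∈ F_q[x] coprime. Let R₂(x) ∈ F_q(t)[x] be the quadratic resolvent of the cubic f(x) − t·g(x) (made monic by dividing by its leading coefficient in F_q(t)). Then φ is a permutation rational function of P¹(F_q) if and only if R₂(x) is irreducible in F_q(t)[x] but reducible in F_{q²}(t)[x]. -/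
open Polynomial

noncomputable section

/-- Make a polynomial monic by dividing by its leading coefficient. -/
def monicize {K : Type} [Field K] (P : Polynomial K) : Polynomial K :=
  Polynomial.C P.leadingCoeff⁻¹ * P

/-- The quadratic resolvent of a (monic) cubic `x³ + ax² + bx + c`. -/
def quadResolvent {K : Type} [Field K] (P : Polynomial K) : Polynomial K :=
  X ^ 2 + C (P.coeff 2 * P.coeff 1 - 3 * P.coeff 0) * X +
    C ((P.coeff 2) ^ 3 * P.coeff 0 + (P.coeff 1) ^ 3 + 9 * (P.coeff 0) ^ 2 -
      6 * P.coeff 2 * P.coeff 1 * P.coeff 0)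

/-- The linear coefficient of the quadratic resolvent `y² + P y + Q` of `ax³ + bx² + cx + d`,
normalised to be a polynomial in the coefficients. -/
def resolventP {R : Type*} [CommRing R] (a b c d : R) : R := b * c - 3 * a * d

/-- The constant coefficient of the quadratic resolvent `y² + P y + Q` of `ax³ + bx² + cx + d`,
normalised to be a polynomial in the coefficients. -/
def resolventQ {R : Type*} [CommRing R] (a b c d : R) : R :=
  b ^ 3 * d + a * c ^ 3 + 9 * a ^ 2 * d ^ 2 - 6 * a * b * c * d

lemma map_resolventP {R S : Type*} [CommRing R] [CommRing S] (φ : R →+* S) (a b c d : R) :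
    φ (resolventP a b c d) = resolventP (φ a) (φ b) (φ c) (φ d) := by
  simp only [resolventP, map_sub, map_mul, map_ofNat]

lemma map_resolventQ {R S : Type*} [CommRing R] [CommRing S] (φ : R →+* S) (a b c d : R) :
    φ (resolventQ a b c d) = resolventQ (φ a) (φ b) (φ c) (φ d) := by
  simp only [resolventQ, map_sub, map_add, map_mul, map_pow, map_ofNat]

lemma resolvent_discr {R : Type*} [CommRing R] (a b c d : R) :
    resolventP a b c d ^ 2 - 4 * resolventQ a b c d = (Cubic.mk a b c d).discr := by
  simp only [resolventP, resolventQ, Cubic.discr]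
  ring

/-- The roots in `ℙ¹(K)` of the binary cubic form with coefficients `a, b, c, d`. -/
def IsProjRoot {K : Type*} [Field K] (a b c d : K) : Option K → Prop
  | none => a = 0
  | some x => a * x ^ 3 + b * x ^ 2 + c * x + d = 0

lemma X_pow_card_sub_X_eq_prod (F : Type*) [Field F] [Fintype F] :
    (X ^ Fintype.card F - X : F[X]) = ∏ a : F, (X - C a) := by
  have hm : (X ^ Fintype.card F - X : F[X]).Monic :=
    monic_X_pow_sub (by simpa using Fintype.one_lt_card)
  have h := prod_multiset_X_sub_C_of_monic_of_roots_card_eq hm (by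
    rw [FiniteField.roots_X_pow_card_sub_X, FiniteField.X_pow_card_sub_X_natDegree_eq _
      Fintype.one_lt_card]
    simp)
  rw [FiniteField.roots_X_pow_card_sub_X] at h
  exact h.symm

lemma X_pow_card_sub_X_dvd {F : Type*} [Field F] [Fintype F] {G : F[X]}
    (h : ∀ t, G.eval t = 0) : X ^ Fintype.card F - X ∣ G := by
  rw [X_pow_card_sub_X_eq_prod]
  refine Finset.prod_dvd_of_coprime ?_ fun a _ => dvd_iff_isRoot.2 (h a)
  intro a _ b _ hab
  exact isCoprime_X_sub_C_of_isUnit_sub (sub_ne_zero.2 hab).isUnit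

lemma exists_algebraMap_eq_of_pow_card {F K : Type*} [Field F] [Fintype F] [Field K] [Algebra F K]
    {x : K} (hx : x ^ Fintype.card F = x) : ∃ r : F, algebraMap F K r = x := by
  have h := congrArg (aeval x) (X_pow_card_sub_X_eq_prod F)
  rw [map_prod] at h
  simp only [map_sub, map_pow, aeval_X, aeval_C, hx, sub_self] at h
  obtain ⟨a, -, ha⟩ := Finset.prod_eq_zero_iff.1 h.symm
  exact ⟨a, (sub_eq_zero.1 ha).symm⟩

/-- An irreducible cubic over a finite field has nonzero discriminant and its quadratic resolvent
has a root. -/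
lemma exists_resolvent_root {F : Type*} [Field F] [Fintype F] {a b c d : F}
    (h : ∀ x, ¬ IsProjRoot a b c d x) :
    (∃ r, r ^ 2 + resolventP a b c d * r + resolventQ a b c d = 0) ∧
      resolventP a b c d ^ 2 - 4 * resolventQ a b c d ≠ 0 := by
  have ha : a ≠ 0 := h none
  let K := AlgebraicClosure F
  let φ := algebraMap F K
  obtain ⟨x, y, z, hr⟩ := (Cubic.splits_iff_roots_eq_three (P := ⟨a, b, c, d⟩) (φ := φ) ha).1
    (IsAlgClosed.splits _)
  have hb : φ b = φ a * -(x + y + z) := Cubic.b_eq_three_roots (P := ⟨a, b, c, d⟩) ha hr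
  have hc : φ c = φ a * (x * y + x * z + y * z) :=
    Cubic.c_eq_three_roots (P := ⟨a, b, c, d⟩) ha hr
  have hd : φ d = φ a * -(x * y * z) := Cubic.d_eq_three_roots (P := ⟨a, b, c, d⟩) ha hr
  have ha' : φ a ≠ 0 := (map_ne_zero φ).2 ha
  set q := Fintype.card F
  have hφ : ∀ u : F, φ u ^ q = φ u := fun u => by
    rw [← map_pow, FiniteField.pow_card]
  let σ : K →ₐ[F] K := FiniteField.frobeniusAlgHom F K
  have hσ : ∀ u, σ u = u ^ q := fun u => rfl
  have hσφ : ∀ u : F, σ (φ u) = φ u := σ.commutes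
  have hroot : ∀ u, (u - x) * (u - y) * (u - z) = 0 →
      σ u ≠ u ∧ (σ u - x) * (σ u - y) * (σ u - z) = 0 := by
    intro u hu
    have hfu : φ a * u ^ 3 + φ b * u ^ 2 + φ c * u + φ d = 0 := by
      rw [hb, hc, hd]; linear_combination φ a * hu
    constructor
    · intro hfix
      obtain ⟨r, hr⟩ := exists_algebraMap_eq_of_pow_card (F := F) (hfix : u ^ q = u)
      refine h (some r) (φ.injective ?_)
      simp only [map_add, map_mul, map_pow, map_zero]
      rw [show φ r = u from hr]
      exact hfu
    · have := congrArg σ hfu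
      simp only [map_add, map_mul, map_pow, hσφ, map_zero] at this
      rw [hb, hc, hd] at this
      refine (mul_eq_zero.1 (?_ : φ a * _ = 0)).resolve_left ha'
      linear_combination this
  have hsum : σ x + σ y + σ z = x + y + z := by
    have := hσφ b
    rw [hb] at this
    simp only [map_mul, map_neg, map_add, hσφ] at this
    have := mul_left_cancel₀ ha' this
    linear_combination -this
  obtain ⟨hx, hx'⟩ := hroot x (by ring)
  obtain ⟨hy, hy'⟩ := hroot y (by ring)
  obtain ⟨hz, hz'⟩ := hroot z (by ring)
  have hconj : ∀ u v w : K, σ u ≠ u → σ v ≠ v → σ w ≠ w → σ u = v → σ v = w → σ w = u →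
      (u ≠ v ∧ u ≠ w ∧ v ≠ w) ∧ ∃ r, φ r = u ^ 2 * v + v ^ 2 * w + w ^ 2 * u := by
    intro u v w hu hv hw h1 h2 h3
    refine ⟨⟨fun e => hu (h1.trans e.symm), fun e => hw (h3.trans e), fun e => hv (h2.trans e.symm)⟩,
      exists_algebraMap_eq_of_pow_card ?_⟩
    rw [← hσ]
    simp only [map_add, map_mul, map_pow, h1, h2, h3]
    ring
  have hcases : (σ x = y ∧ σ y = z ∧ σ z = x) ∨ (σ x = z ∧ σ z = y ∧ σ y = x) := by
    simp only [mul_eq_zero, sub_eq_zero] at hx' hy' hz'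
    rcases hx' with (e | e) | e
    · exact absurd e hx
    · rcases hy' with (e' | e') | e'
      · exact absurd (by linear_combination hsum - e - e') hz
      · exact absurd e' hy
      · exact Or.inl ⟨e, e', by linear_combination hsum - e - e'⟩
    · rcases hz' with (e' | e') | e'
      · exact absurd (by linear_combination hsum - e - e') hy
      · exact Or.inr ⟨e, e', by linear_combination hsum - e - e'⟩
      · exact absurd e' hz
  have hne : (x ≠ y ∧ x ≠ z ∧ y ≠ z) ∧ ∃ r, φ r = x ^ 2 * y + y ^ 2 * z + z ^ 2 * x ∨
      φ r = x ^ 2 * z + z ^ 2 * y + y ^ 2 * x := by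
    rcases hcases with ⟨h1, h2, h3⟩ | ⟨h1, h2, h3⟩
    · obtain ⟨hne, r, hr⟩ := hconj x y z hx hy hz h1 h2 h3
      exact ⟨hne, r, Or.inl hr⟩
    · obtain ⟨hne, r, hr⟩ := hconj x z y hx hz hy h1 h2 h3
      exact ⟨⟨hne.2.1, hne.1, hne.2.2.symm⟩, r, Or.inr hr⟩
  obtain ⟨hne, r, hr'⟩ := hne
  constructor
  · refine ⟨a ^ 2 * r, φ.injective ?_⟩
    simp only [map_add, map_mul, map_pow, map_resolventP, map_resolventQ, map_zero]
    rw [hb, hc, hd]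
    simp only [resolventP, resolventQ]
    rcases hr' with hr' | hr' <;> · rw [hr']; ring
  · rw [resolvent_discr]
    exact (Cubic.discr_ne_zero_iff_roots_ne (P := ⟨a, b, c, d⟩) ha hr).2 hne

/-- If a binary cubic form has exactly one root, then it is a cube of a linear form (up to a
constant) or its quadratic resolvent has no root. -/
lemma triple_root_or_resolvent_ne_zero {K : Type*} [Field K] {a b c d : K}
    (h : ∃! x, IsProjRoot a b c d x) :
    (a = 0 ∧ b = 0 ∧ c = 0) ∨
    (∃ x, b = -3 * a * x ∧ c = 3 * a * x ^ 2 ∧ d = - a * x ^ 3) ∨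
    ∀ y, y ^ 2 + resolventP a b c d * y + resolventQ a b c d ≠ 0 := by
  obtain ⟨x, hx, huniq⟩ := h
  rcases x with _ | x
  · have ha : a = 0 := hx
    subst ha
    have hno : ∀ x, b * x ^ 2 + c * x + d ≠ 0 := fun x h0 => by
      have := huniq (some x) (by simpa [IsProjRoot] using h0)
      simp at this
    by_cases hb : b = 0
    · left
      refine ⟨rfl, hb, ?_⟩
      by_contra hc
      apply hno (-d / c)
      rw [hb]; field_simp; ring
    · right; right
      intro y hy
      apply hno (y / b ^ 2)
      simp only [resolventP, resolventQ] at hy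
      field_simp
      linear_combination hy
  · have hx' : a * x ^ 3 + b * x ^ 2 + c * x + d = 0 := hx
    have hd : d = -(a * x ^ 3 + b * x ^ 2 + c * x) := by linear_combination hx'
    have ha : a ≠ 0 := fun h0 => by simpa using huniq none h0
    have hno : ∀ u, u ≠ x → a * u ^ 2 + (b + a * x) * u + (c + b * x + a * x ^ 2) ≠ 0 := by
      intro u hu h0
      have : some u = some x := huniq (some u) (by
        change a * u ^ 3 + b * u ^ 2 + c * u + d = 0
        rw [hd]; linear_combination (u - x) * h0)
      exact hu (by simpa using this)
    by_cases h0 : a * x ^ 2 + (b + a * x) * x + (c + b * x + a * x ^ 2) = 0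
    · right; left
      have h1 : - b / a - 2 * x = x := by
        by_contra hne
        apply hno _ hne
        field_simp
        linear_combination a * h0
      have hb : b = -3 * a * x := by
        field_simp at h1
        linear_combination -h1
      have hc : c = 3 * a * x ^ 2 := by
        rw [hb] at h0; linear_combination h0
      exact ⟨x, hb, hc, by rw [hd, hb, hc]; ring⟩
    · right; right
      intro y hy
      have hno' : ∀ u, a * u ^ 2 + (b + a * x) * u + (c + b * x + a * x ^ 2) ≠ 0 := by
        intro u
        by_cases hu : u = x
        · rwa [hu]
        · exact hno u hu
      apply hno' ((y - x * ((b + a * x) ^ 2 - a * (c + b * x + a * x ^ 2))) /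
        (a * (a * x ^ 2 + (b + a * x) * x + (c + b * x + a * x ^ 2))))
      have hk := hno' x
      generalize hkdef : a * x ^ 2 + (b + a * x) * x + (c + b * x + a * x ^ 2) = k at hk ⊢
      simp only [resolventP, resolventQ, hd] at hy
      field_simp
      rw [← hkdef]
      linear_combination hy

lemma natDegree_le_of_mul_eq {R : Type*} [CommRing R] [IsDomain R] {L K G : R[X]} {n : ℕ}
    (hL : L ≠ 0) (h : L * K = G) (hG : G.natDegree ≤ L.natDegree + n) : K.natDegree ≤ n := by
  by_cases hK : K = 0
  · simp [hK]
  · rw [← h, natDegree_mul hL hK] at hG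
    omega

lemma eq_zero_of_mul_eq_of_natDegree_lt {R : Type*} [CommRing R] [IsDomain R] {L K G : R[X]}
    (h : L * K = G) (hG : G.natDegree < L.natDegree) : K = 0 := by
  by_contra hK
  have hL : L ≠ 0 := by rintro rfl; simp at hG
  rw [← h, natDegree_mul hL hK] at hG
  omega

lemma natDegree_derivative_le_of_le {R : Type*} [CommRing R] {f : R[X]} {n : ℕ}
    (h : f.natDegree ≤ n) : (derivative f).natDegree ≤ n - 1 :=
  (natDegree_derivative_le f).trans (Nat.sub_le_sub_right h 1)

lemma derivative_X_pow_card_sub_X (F : Type*) [Field F] [Fintype F] :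
    derivative (X ^ Fintype.card F - X : F[X]) = -1 := by
  rw [derivative_sub, derivative_X_pow, derivative_X, FiniteField.cast_card_eq_zero]
  simp

/-- A form of Stepanov's method for a quartic without square values. -/
lemma dvd_derivative_sq_of_forall_not_isSquare {F : Type*} [Field F] [Fintype F]
    (h2 : (2 : F) ≠ 0) (hq : 7 ≤ Fintype.card F) {D : F[X]} (hdeg : D.natDegree ≤ 4)
    (hD : ∀ t, ¬ IsSquare (D.eval t)) : D ∣ derivative D ^ 2 := by
  have hchar : ringChar F ≠ 2 := fun h => h2 (by
    have := ringChar.Nat.cast_ringChar (R := F)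
    rwa [h] at this)
  set q := Fintype.card F with hqdef
  have hodd : 2 * (q / 2) + 1 = q := by
    have := FiniteField.odd_card_of_char_ne_two hchar
    omega
  have hN : (2 : F[X]) * ((q / 2 : ℕ) : F[X]) = -1 := by
    have h := congrArg (Nat.cast : ℕ → F[X]) hodd
    have h0 : (q : F[X]) = 0 := by
      rw [← map_natCast C, FiniteField.cast_card_eq_zero, map_zero]
    push_cast [h0] at h
    linear_combination h
  have hL' : derivative (X ^ q - X : F[X]) = -1 := derivative_X_pow_card_sub_X F
  have hLdeg : (X ^ q - X : F[X]).natDegree = q :=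
    FiniteField.X_pow_card_sub_X_natDegree_eq _ (by omega)
  have hL0 : (X ^ q - X : F[X]) ≠ 0 := FiniteField.X_pow_card_sub_X_ne_zero _ (by omega)
  have hdvd : (X ^ q - X : F[X]) ∣ D ^ (q / 2) + 1 := by
    refine X_pow_card_sub_X_dvd fun t => ?_
    have ht : D.eval t ≠ 0 := fun h => hD t (h ▸ IsSquare.zero)
    have h1 := (FiniteField.pow_dichotomy hchar ht).resolve_left
      (fun h => hD t ((FiniteField.isSquare_iff hchar ht).2 h))
    simp only [eval_add, eval_pow, eval_one]
    rw [h1]; ring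
  generalize (X ^ q - X : F[X]) = L at *
  obtain ⟨H, hH⟩ := hdvd
  have hWd : 2 * D * derivative (D ^ (q / 2)) = - derivative D * D ^ (q / 2) := by
    rw [derivative_pow]
    have : D ^ (q / 2) = D ^ (q / 2 - 1) * D := by
      rw [← pow_succ]; congr 1; omega
    rw [this]
    simp only [map_natCast]
    linear_combination D ^ (q / 2 - 1) * D * derivative D * hN
  have hWdeg : (D ^ (q / 2)).natDegree ≤ (q / 2) * 4 := natDegree_pow_le_of_le _ hdeg
  generalize D ^ (q / 2) = W at *
  have hHdeg : H.natDegree ≤ q - 2 := by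
    refine natDegree_le_of_mul_eq hL0 hH.symm ?_
    refine (natDegree_add_le_of_degree_le hWdeg (n := q / 2 * 4) (by simp)).trans ?_
    omega
  have hW : W = L * H - 1 := by linear_combination hH
  subst hW
  have hd1 := natDegree_derivative_le_of_le hdeg
  have hd2 := natDegree_derivative_le_of_le hd1
  have h1 : L * (2 * D * derivative H + derivative D * H) = derivative D + 2 * D * H := by
    simp only [derivative_sub, derivative_mul, derivative_one, hL'] at hWd
    linear_combination hWd
  generalize hK : 2 * D * derivative H + derivative D * H = K at h1
  have hKdeg : K.natDegree ≤ 2 := by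
    refine natDegree_le_of_mul_eq hL0 h1 ?_
    refine natDegree_add_le_of_degree_le (hd1.trans (by omega)) ?_
    rw [mul_assoc, show (2 : F[X]) = C 2 from rfl]
    refine (natDegree_C_mul_le _ _).trans ((natDegree_mul_le_of_le hdeg hHdeg).trans (by omega))
  have h1' := congrArg derivative h1
  simp only [derivative_add, derivative_mul, derivative_ofNat, hL'] at h1'
  have h3 : L * (derivative D * K - 2 * D * derivative K) =
      derivative D ^ 2 - 4 * D * K - 2 * D * derivative (derivative D) := by
    linear_combination -2 * D * h1' + derivative D * h1 - 2 * D * hK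
  have h4 := eq_zero_of_mul_eq_of_natDegree_lt h3 (by
    rw [hLdeg]
    refine lt_of_le_of_lt (?_ : _ ≤ 6) (by omega)
    refine (natDegree_sub_le_of_le (m := 6) (n := 6) (natDegree_sub_le_of_le (m := 6) (n := 6)
      (natDegree_pow_le_of_le 2 hd1) ?_) ?_).trans (by norm_num)
    · rw [mul_assoc, show (4 : F[X]) = C 4 from rfl]
      exact (natDegree_C_mul_le _ _).trans (natDegree_mul_le_of_le hdeg hKdeg)
    · rw [mul_assoc, show (2 : F[X]) = C 2 from rfl]
      exact (natDegree_C_mul_le _ _).trans (natDegree_mul_le_of_le hdeg hd2))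
  rw [h4, mul_zero] at h3
  exact ⟨4 * K + 2 * derivative (derivative D), by linear_combination -h3⟩

lemma exists_eq_C_mul_sq_of_forall_not_isSquare {F : Type*} [Field F] [Fintype F]
    (h2 : (2 : F) ≠ 0) (hq : 7 ≤ Fintype.card F) {D : F[X]} (hdeg : D.natDegree ≤ 4)
    (hD : ∀ t, ¬ IsSquare (D.eval t)) : ∃ (ε : F) (s : F[X]), D = C ε * s ^ 2 := by
  have hD0 : ∀ t, D.eval t ≠ 0 := fun t h => hD t (h ▸ IsSquare.zero)
  have hDne : D ≠ 0 := fun h => hD0 0 (by simp [h])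
  by_cases hsq : Squarefree D
  · have hcop : IsCoprime D (derivative D) := PerfectField.separable_iff_squarefree.2 hsq
    have hu : IsUnit D := (hcop.pow_right (n := 2)).isUnit_of_dvd' dvd_rfl
      (dvd_derivative_sq_of_forall_not_isSquare h2 hq hdeg hD)
    obtain ⟨c, -, hc⟩ := Polynomial.isUnit_iff.1 hu
    exact ⟨c, 1, by simp [hc]⟩
  · simp only [Squarefree, not_forall] at hsq
    obtain ⟨x, ⟨y, hy⟩, hx⟩ := hsq
    have hx0 : x ≠ 0 := by rintro rfl; simp [hDne] at hy
    have hy0 : y ≠ 0 := by rintro rfl; simp [hDne] at hy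
    have hdeg' : D.natDegree = x.natDegree + x.natDegree + y.natDegree := by
      rw [hy, natDegree_mul (mul_ne_zero hx0 hx0) hy0, natDegree_mul hx0 hx0]
    have hx1 : x.natDegree ≠ 0 := fun h => hx (by
      rw [eq_C_of_natDegree_eq_zero h] at hx0 ⊢
      exact (isUnit_C.2 (by simpa using hx0)))
    have hx2 : x.natDegree ≠ 1 := fun h => by
      obtain ⟨t, ht⟩ := exists_root_of_degree_eq_one
        (show x.degree = 1 by rw [degree_eq_natDegree hx0, h]; rfl)
      exact hD0 t (by rw [hy]; simp [ht.eq_zero])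
    have hy1 : y.natDegree = 0 := by omega
    refine ⟨y.coeff 0, x, ?_⟩
    rw [← eq_C_of_natDegree_eq_zero hy1, hy]
    ring

lemma exists_eval_ne_zero_of_natDegree_lt {F : Type*} [Field F] [Fintype F] {G : F[X]}
    (hG : G ≠ 0) (h : G.natDegree < Fintype.card F) : ∃ t, G.eval t ≠ 0 :=
  exists_eval_ne_zero_of_natDegree_lt_card G hG (by simpa using h)

lemma exists_sq_eq_of_ne_zero {F : Type*} [Field F] [Fintype F] (h2 : (2 : F) ≠ 0)
    (hq : 7 ≤ Fintype.card F) {α δ : F} (hα : α ≠ 0) (hδ : δ ≠ 0) (w₁ : F) :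
    ∃ w y, w ≠ w₁ ∧ y ≠ 0 ∧ α * w ^ 2 + δ = y ^ 2 := by
  have hchar : ringChar F ≠ 2 := fun h => h2 (by
    have := ringChar.Nat.cast_ringChar (R := F)
    rwa [h] at this)
  obtain ⟨y₀, w₀, h₀⟩ := FiniteField.exists_root_sum_quadratic (R := F)
    (f := C 1 * X ^ 2 + C 0 * X + C 0) (g := C (-α) * X ^ 2 + C 0 * X + C (-δ))
    (degree_quadratic one_ne_zero) (degree_quadratic (neg_ne_zero.2 hα))
    (FiniteField.odd_card_of_char_ne_two hchar)
  simp only [eval_add, eval_mul, eval_C, eval_pow, eval_X] at h₀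
  have hquad : ∀ a b c : F, (a ≠ 0 ∨ b ≠ 0 ∨ c ≠ 0) → (C a * X ^ 2 + C b * X + C c : F[X]) ≠ 0 := by
    intro a b c h h0
    have e0 := congrArg (coeff · 0) h0
    have e1 := congrArg (coeff · 1) h0
    have e2 := congrArg (coeff · 2) h0
    simp [coeff_X, coeff_C] at e0 e1 e2
    tauto
  have hyw : y₀ ≠ 0 ∨ w₀ ≠ 0 := by
    by_contra! h
    rw [h.1, h.2] at h₀
    exact hδ (by linear_combination -h₀)
  have n1 := hquad 1 0 (-α) (Or.inl one_ne_zero)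
  have n2 : (C (-y₀) * X ^ 2 + C (2 * α * w₀) * X + C (-α * y₀) : F[X]) ≠ 0 := by
    apply hquad
    rcases hyw with h | h
    · exact Or.inl (neg_ne_zero.2 h)
    · exact Or.inr (Or.inl (mul_ne_zero (mul_ne_zero h2 hα) h))
  have n3 : (C (w₀ - w₁) * X ^ 2 + C (-2 * y₀) * X + C (-α * (w₀ - w₁) + 2 * α * w₀) : F[X]) ≠ 0 := by
    apply hquad
    by_contra! h
    obtain ⟨e1, e2, e3⟩ := h
    rw [e1] at e3
    rcases hyw with h | h
    · exact h (by simpa [h2] using e2)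
    · exact (mul_ne_zero (mul_ne_zero h2 hα) h) (by linear_combination e3)
  obtain ⟨m, hm⟩ := exists_eval_ne_zero_of_natDegree_lt (mul_ne_zero (mul_ne_zero n1 n2) n3) (by
    refine lt_of_le_of_lt (natDegree_mul_le_of_le (natDegree_mul_le_of_le natDegree_quadratic_le
      natDegree_quadratic_le) natDegree_quadratic_le) (by omega))
  simp only [eval_mul, eval_add, eval_C, eval_pow, eval_X, mul_ne_zero_iff] at hm
  obtain ⟨⟨m1, m2⟩, m3⟩ := hm
  have m1' : m ^ 2 - α ≠ 0 := fun h => m1 (by linear_combination h)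
  refine ⟨w₀ + (2 * α * w₀ - 2 * y₀ * m) / (m ^ 2 - α),
    y₀ + m * ((2 * α * w₀ - 2 * y₀ * m) / (m ^ 2 - α)), fun h => m3 ?_, fun h => m2 ?_, ?_⟩
  · field_simp at h
    linear_combination h
  · field_simp at h
    linear_combination h
  · field_simp
    linear_combination -(m ^ 2 - α) ^ 2 * h₀

/-- A quadratic polynomial over a finite field of odd characteristic that takes no nonzero square
values away from one point has zero discriminant. -/
lemma discrim_eq_zero_of_forall_ne_sq {F : Type*} [Field F] [Fintype F] (h2 : (2 : F) ≠ 0)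
    (hq : 7 ≤ Fintype.card F) {α β γ w₁ : F}
    (h : ∀ w y, w ≠ w₁ → y ≠ 0 → α * w ^ 2 + β * w + γ ≠ y ^ 2) : β ^ 2 - 4 * α * γ = 0 := by
  by_contra hd
  by_cases hα : α = 0
  · subst hα
    have hβ : β ≠ 0 := by rintro rfl; simp at hd
    have hval : ∀ y, y ≠ 0 → (y ^ 2 - γ) / β = w₁ := fun y hy => by
      by_contra hne
      exact h _ y hne hy (by field_simp; ring)
    obtain ⟨c, hc⟩ := exists_eval_ne_zero_of_natDegree_lt (F := F) (G := X * (X ^ 2 - C 1))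
      (mul_ne_zero X_ne_zero (X_pow_sub_C_ne_zero (by norm_num) _))
      (lt_of_le_of_lt (natDegree_mul_le_of_le natDegree_X_le (natDegree_X_pow_sub_C).le)
        (by omega))
    simp only [eval_mul, eval_X, eval_sub, eval_pow, eval_C, mul_ne_zero_iff] at hc
    have e := (hval c hc.1).trans (hval 1 one_ne_zero).symm
    field_simp at e
    exact hc.2 (by linear_combination e)
  · have h4 : (4 : F) ≠ 0 := by
      rw [show (4 : F) = 2 * 2 by norm_num]; exact mul_ne_zero h2 h2
    obtain ⟨w, y, hw, hy, hwy⟩ := exists_sq_eq_of_ne_zero h2 hq hα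
      (δ := γ - β ^ 2 / (4 * α)) (fun h0 => hd (by
        field_simp at h0
        linear_combination -h0)) (w₁ + β / (2 * α))
    refine h (w - β / (2 * α)) y (fun e => hw (by rw [← e]; ring)) hy ?_
    rw [← hwy]
    field_simp
    ring

/-- The quadratic `y² + P y + Q` over `F[t]` arises from a quadratic `z² + m z + n` with constant
coefficients by the substitution `y = s + w z`. -/
def IsConstantTwist {F : Type*} [Field F] (P Q : F[X]) : Prop :=
  ∃ (s w : F[X]) (m n : F), P = -2 * s + C m * w ∧ Q = s ^ 2 - C m * s * w + C n * w ^ 2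

lemma IsConstantTwist.of_discr {F : Type*} [Field F] (h2 : (2 : F) ≠ 0) {P Q s : F[X]} {ε : F}
    (h : P ^ 2 - 4 * Q = C ε * s ^ 2) : IsConstantTwist P Q := by
  have hh : (2 : F[X]) * C 2⁻¹ = 1 := by
    rw [show (2 : F[X]) = C 2 from rfl, ← C_mul, mul_inv_cancel₀ h2, C_1]
  refine ⟨-C 2⁻¹ * P, C 2⁻¹ * s, 0, -ε, ?_, ?_⟩
  · rw [C_0]
    linear_combination (-P) * hh
  · rw [C_0, C_neg]
    linear_combination (-(C 2⁻¹) ^ 2) * h - (2 * C 2⁻¹ + 1) * Q * hh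

lemma IsConstantTwist.of_translate {F : Type*} [Field F] {P Q E : F[X]}
    (h : IsConstantTwist (P + 2 * E) (Q + E * P + E ^ 2)) : IsConstantTwist P Q := by
  obtain ⟨s, w, m, n, hP, hQ⟩ := h
  exact ⟨s + E, w, m, n, by linear_combination hP, by linear_combination hQ - E * hP⟩

lemma resolventP_translate {R : Type*} [CommRing R] (a b c d s : R) :
    resolventP a (b + 3 * a * s) (c + 2 * b * s + 3 * a * s ^ 2)
        (d + c * s + b * s ^ 2 + a * s ^ 3) =
      resolventP a b c d + 2 * (s * b ^ 2 + 3 * s ^ 2 * a * b + 3 * s ^ 3 * a ^ 2) := by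
  simp only [resolventP]
  ring

lemma resolventQ_translate {R : Type*} [CommRing R] (a b c d s : R) :
    resolventQ a (b + 3 * a * s) (c + 2 * b * s + 3 * a * s ^ 2)
        (d + c * s + b * s ^ 2 + a * s ^ 3) =
      resolventQ a b c d +
        (s * b ^ 2 + 3 * s ^ 2 * a * b + 3 * s ^ 3 * a ^ 2) * resolventP a b c d +
        (s * b ^ 2 + 3 * s ^ 2 * a * b + 3 * s ^ 3 * a ^ 2) ^ 2 := by
  simp only [resolventP, resolventQ]
  ring

lemma resolventP_reverse {R : Type*} [CommRing R] (a b c d : R) :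
    resolventP d c b a = resolventP a b c d := by
  simp only [resolventP]
  ring

lemma resolventQ_reverse {R : Type*} [CommRing R] (a b c d : R) :
    resolventQ d c b a = resolventQ a b c d := by
  simp only [resolventQ]
  ring

lemma eq_linear_of_natDegree_le_one {F : Type*} [Field F] {A : F[X]} (h : A.natDegree ≤ 1)
    (t : F) : A = C (A.eval t) + C (A.coeff 1) * (X - C t) := by
  have hA := eq_X_add_C_of_natDegree_le_one h
  have ht : A.eval t = A.coeff 1 * t + A.coeff 0 := by
    conv_lhs => rw [hA]
    simp
  rw [ht, C_add, C_mul]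
  linear_combination hA

/-- Away from the zeros of its discriminant, the quadratic `y² + P(t) y + Q(t)` has no root. -/
def HasNoSimpleSpecializedRoot {F : Type*} [Field F] (P Q : F[X]) : Prop :=
  ∀ t y : F, P.eval t ^ 2 - 4 * Q.eval t ≠ 0 → y ^ 2 + P.eval t * y + Q.eval t ≠ 0

lemma HasNoSimpleSpecializedRoot.translate {F : Type*} [Field F] {P Q : F[X]}
    (h : HasNoSimpleSpecializedRoot P Q) (E : F[X]) :
    HasNoSimpleSpecializedRoot (P + 2 * E) (Q + E * P + E ^ 2) := by
  intro t y hD hy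
  simp only [eval_add, eval_mul, eval_pow, eval_ofNat] at hD hy
  exact h t (y + E.eval t) (fun e => hD (by linear_combination e)) (by linear_combination hy)

lemma isConstantTwist_of_triple_infty_of_two_ne_zero {F : Type*} [Field F] [Fintype F]
    (h2 : (2 : F) ≠ 0) (hq : 7 ≤ Fintype.card F) {a b c d₀ d₁ t₀ : F} (hd : d₀ ≠ 0)
    {A B C' D : F[X]} (hA : A = C a * (X - C t₀)) (hB : B = C b * (X - C t₀))
    (hC : C' = C c * (X - C t₀)) (hD : D = C d₀ + C d₁ * (X - C t₀))
    (h : HasNoSimpleSpecializedRoot (resolventP A B C' D) (resolventQ A B C' D)) :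
    IsConstantTwist (resolventP A B C' D) (resolventQ A B C' D) := by
  have hdisc : (18 * a * b * c - 4 * b ^ 3) ^ 2 - 4 * (-27 * a ^ 2) *
      (b ^ 2 * c ^ 2 - 4 * a * c ^ 3) = 0 := by
    refine discrim_eq_zero_of_forall_ne_sq h2 hq (w₁ := d₁) fun w y hw hy e => ?_
    have hw' : w - d₁ ≠ 0 := sub_ne_zero.2 hw
    have hu : d₀ / (w - d₁) ≠ 0 := div_ne_zero hd hw'
    have key := h (t₀ + d₀ / (w - d₁))
    set u := d₀ / (w - d₁) with hudef
    have eA : A.eval (t₀ + u) = a * u := by rw [hA]; simp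
    have eB : B.eval (t₀ + u) = b * u := by rw [hB]; simp
    have eC : C'.eval (t₀ + u) = c * u := by rw [hC]; simp
    have eD : D.eval (t₀ + u) = w * u := by
      rw [hD]; simp only [eval_add, eval_mul, eval_C, eval_sub, eval_X, hudef]
      field_simp; ring
    have eP : (resolventP A B C' D).eval (t₀ + u) = resolventP (a * u) (b * u) (c * u) (w * u) := by
      rw [← coe_evalRingHom, map_resolventP]; simp only [coe_evalRingHom, eA, eB, eC, eD]
    have eQ : (resolventQ A B C' D).eval (t₀ + u) = resolventQ (a * u) (b * u) (c * u) (w * u) := by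
      rw [← coe_evalRingHom, map_resolventQ]; simp only [coe_evalRingHom, eA, eB, eC, eD]
    have hΔ : resolventP (a * u) (b * u) (c * u) (w * u) ^ 2 -
        4 * resolventQ (a * u) (b * u) (c * u) (w * u) = (y * u ^ 2) ^ 2 := by
      simp only [resolventP, resolventQ]
      linear_combination u ^ 4 * e
    rw [eP, eQ] at key
    generalize resolventP (a * u) (b * u) (c * u) (w * u) = P at *
    generalize resolventQ (a * u) (b * u) (c * u) (w * u) = Q at *
    refine key ((-P + y * u ^ 2) / 2) ?_ ?_
    · rw [hΔ]; exact pow_ne_zero _ (mul_ne_zero hy (pow_ne_zero _ hu))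
    · field_simp
      linear_combination -hΔ
  have hform : ∀ u D : F[X], (C b * u) ^ 2 * (C c * u) ^ 2 - 4 * (C a * u) * (C c * u) ^ 3
      - 4 * (C b * u) ^ 3 * D - 27 * (C a * u) ^ 2 * D ^ 2 +
      18 * (C a * u) * (C b * u) * (C c * u) * D =
      u ^ 2 * (C (-27 * a ^ 2) * D ^ 2 + C (18 * a * b * c - 4 * b ^ 3) * D * u +
        C (b ^ 2 * c ^ 2 - 4 * a * c ^ 3) * u ^ 2) := by
    intro u D
    simp only [C_mul, C_sub, C_pow, C_neg, C_ofNat]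
    ring
  have hΔ := resolvent_discr A B C' D
  simp only [Cubic.discr] at hΔ
  rw [hA, hB, hC, hform] at hΔ
  rw [hA, hB, hC]
  generalize -27 * a ^ 2 = α at *
  generalize 18 * a * b * c - 4 * b ^ 3 = β at *
  generalize b ^ 2 * c ^ 2 - 4 * a * c ^ 3 = γ at *
  by_cases hα : α = 0
  · subst hα
    have hβ : β = 0 := by simpa using hdisc
    subst hβ
    exact .of_discr h2 (ε := γ) (s := (X - C t₀) ^ 2) (by rw [hΔ]; simp; ring)
  · have h4 : (4 : F) ≠ 0 := by
      rw [show (4 : F) = 2 * 2 by norm_num]; exact mul_ne_zero h2 h2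
    refine .of_discr h2 (ε := α) (s := (X - C t₀) * (D + C (β / (2 * α)) * (X - C t₀))) ?_
    rw [hΔ]
    have e1 : C β = 2 * C α * C (β / (2 * α)) := by
      rw [← C_ofNat, ← C_mul, ← C_mul]; congr 1; field_simp
    have e2 : C γ = C α * C (β / (2 * α)) ^ 2 := by
      rw [← C_pow, ← C_mul]; congr 1; field_simp; linear_combination -hdisc
    rw [e1, e2]
    ring

lemma exists_sq_eq_of_two_eq_zero {F : Type*} [Field F] [Fintype F] (h2 : (2 : F) = 0) (x : F) :
    ∃ y, y ^ 2 = x := by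
  have : CharP F 2 := CharTwo.of_one_ne_zero_of_two_eq_zero one_ne_zero h2
  obtain ⟨y, hy⟩ := FiniteField.isSquare_of_char_two (ringChar.eq F 2) x
  exact ⟨y, by rw [hy, sq]⟩

lemma isConstantTwist_of_triple_infty_of_two_eq_zero {F : Type*} [Field F] [Fintype F]
    (h2 : (2 : F) = 0) (hq : 7 ≤ Fintype.card F) {a b c d₀ d₁ t₀ : F} (ha : a ≠ 0) (hd : d₀ ≠ 0)
    {A B C' D : F[X]} (hA : A = C a * (X - C t₀)) (hB : B = C b * (X - C t₀))
    (hC : C' = C c * (X - C t₀)) (hD : D = C d₀ + C d₁ * (X - C t₀))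
    (h : HasNoSimpleSpecializedRoot (resolventP A B C' D) (resolventQ A B C' D)) :
    IsConstantTwist (resolventP A B C' D) (resolventQ A B C' D) := by
  obtain ⟨μ, hμ⟩ : ∃ μ, a * μ = b ^ 3 := ⟨b ^ 3 / a, by field_simp⟩
  obtain ⟨κ, hκ⟩ : ∃ κ, κ ^ 2 = b ^ 2 * c ^ 2 + μ * b * c + a * c ^ 3 :=
    exists_sq_eq_of_two_eq_zero h2 _
  have hμκ : μ + κ = 0 := by
    by_contra hμκ
    set e := a * d₁ + b * c with he
    have hquad : ∀ x y z : F, (x ≠ 0 ∨ z ≠ 0) → (C x * X ^ 2 + C y * X + C z : F[X]) ≠ 0 := by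
      intro x y z hxz h0
      have e0 := congrArg (coeff · 0) h0
      have e2 := congrArg (coeff · 2) h0
      simp [coeff_X, coeff_C] at e0 e2
      tauto
    obtain ⟨z, hz⟩ := exists_eval_ne_zero_of_natDegree_lt
      (mul_ne_zero (hquad 1 1 1 (by simp)) (hquad e e (e - (μ + κ)) (by
        by_cases he : e = 0
        · right; simpa [he, neg_eq_zero, -neg_add_rev] using hμκ
        · exact Or.inl he)))
      (lt_of_le_of_lt (natDegree_mul_le_of_le natDegree_quadratic_le natDegree_quadratic_le)
        (by omega))
    simp only [eval_mul, eval_add, eval_C, eval_pow, eval_X, mul_ne_zero_iff] at hz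
    obtain ⟨hz1, hz2⟩ := hz
    obtain ⟨l, hl⟩ : ∃ l, l * (z ^ 2 + z + 1) = μ + κ :=
      ⟨(μ + κ) / (z ^ 2 + z + 1), div_mul_cancel₀ _ (fun h => hz1 (by linear_combination h))⟩
    have hl0 : l ≠ 0 := by rintro rfl; exact hμκ (by rw [← hl, zero_mul])
    obtain ⟨w, hw⟩ : ∃ w, a * w = l + b * c := ⟨(l + b * c) / a, by field_simp⟩
    have hw' : w - d₁ ≠ 0 := fun h0 => hz2 (by
      have : l = e := by grind
      rw [← this]; linear_combination hl)
    set u := d₀ / (w - d₁) with hudef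
    have hu : u ≠ 0 := div_ne_zero hd hw'
    have key := h (t₀ + u) (u ^ 2 * (l * z + κ))
    have eA : A.eval (t₀ + u) = a * u := by rw [hA]; simp
    have eB : B.eval (t₀ + u) = b * u := by rw [hB]; simp
    have eC : C'.eval (t₀ + u) = c * u := by rw [hC]; simp
    have eD : D.eval (t₀ + u) = w * u := by
      rw [hD]; simp only [eval_add, eval_mul, eval_C, eval_sub, eval_X, hudef]
      field_simp; ring
    have eP : (resolventP A B C' D).eval (t₀ + u) = u ^ 2 * l := by
      rw [← coe_evalRingHom, map_resolventP]; simp only [coe_evalRingHom, eA, eB, eC, eD]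
      simp only [resolventP]
      linear_combination -3 * u ^ 2 * hw - u ^ 2 * (2 * l + b * c) * h2
    have eQ : (resolventQ A B C' D).eval (t₀ + u) = u ^ 4 * (l ^ 2 + μ * l + κ ^ 2) := by
      have : b ^ 3 * w + a * c ^ 3 + 9 * a ^ 2 * w ^ 2 - 6 * a * b * c * w =
          l ^ 2 + μ * l + κ ^ 2 := by grind
      rw [← coe_evalRingHom, map_resolventQ]; simp only [coe_evalRingHom, eA, eB, eC, eD]
      simp only [resolventQ]
      linear_combination u ^ 4 * this
    rw [eP, eQ] at key
    refine key ?_ ?_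
    · have : (u ^ 2 * l) ^ 2 ≠ 0 := pow_ne_zero _ (mul_ne_zero (pow_ne_zero _ hu) hl0)
      intro h0
      exact this (by linear_combination h0 + 2 * (u ^ 4 * (l ^ 2 + μ * l + κ ^ 2)) * h2)
    · have : (l * z + κ) ^ 2 + l * (l * z + κ) + (l ^ 2 + μ * l + κ ^ 2) = 0 := by grind
      linear_combination u ^ 4 * this
  have h2' : (2 : F[X]) = 0 := by rw [← C_ofNat, h2, C_0]
  have hμ' : C a * C μ = C b ^ 3 := by rw [← C_mul, hμ, C_pow]
  have hκ' : C μ ^ 2 = C b ^ 2 * C c ^ 2 + C μ * C b * C c + C a * C c ^ 3 := by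
    simp only [← C_pow, ← C_mul, ← C_add]
    congr 1
    grind
  refine ⟨C μ * (X - C t₀) ^ 2, resolventP A B C' D, 1, 1, ?_, ?_⟩
  · rw [C_1]
    linear_combination (C μ * (X - C t₀) ^ 2) * h2'
  · rw [C_1, hA, hB, hC]
    simp only [resolventP, resolventQ]
    generalize X - C t₀ = u at *
    generalize C μ = μ at *
    generalize C a = a at *
    generalize C b = b at *
    generalize C c = c at *
    clear hA hB hC hD h
    grind

lemma charP_two_of_two_eq_zero {R : Type*} [CommRing R] [Nontrivial R] (h2 : (2 : R) = 0) :
    CharP R 2 :=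
  CharTwo.of_one_ne_zero_of_two_eq_zero one_ne_zero h2

lemma add_pow_two_pow_of_two_eq_zero {R : Type*} [CommRing R] (h2 : (2 : R) = 0) (x y : R) (n : ℕ) :
    (x + y) ^ 2 ^ n = x ^ 2 ^ n + y ^ 2 ^ n := by
  induction n with
  | zero => simp
  | succ n ih =>
    rw [pow_succ, pow_mul, pow_mul, pow_mul, ih]
    linear_combination (x ^ 2 ^ n * y ^ 2 ^ n) * h2

lemma sum_sq_add_self_pow_two_pow {R : Type*} [CommRing R] (h2 : (2 : R) = 0) (z : R) (n : ℕ) :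
    ∑ i ∈ Finset.range n, (z ^ 2 + z) ^ 2 ^ i = z ^ 2 ^ n + z := by
  induction n with
  | zero => simp; linear_combination -z * h2
  | succ n ih =>
    rw [Finset.sum_range_succ, ih, add_pow_two_pow_of_two_eq_zero h2]
    ring_nf
    linear_combination z ^ 2 ^ n * h2

lemma sum_pow_two_pow_sq_add_self {R : Type*} [CommRing R] (h2 : (2 : R) = 0) (r : R) (n : ℕ) :
    (∑ i ∈ Finset.range n, r ^ 2 ^ i) ^ 2 + ∑ i ∈ Finset.range n, r ^ 2 ^ i = r ^ 2 ^ n + r := by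
  induction n with
  | zero => simp; linear_combination -r * h2
  | succ n ih =>
    rw [Finset.sum_range_succ, pow_succ 2 n, pow_mul]
    linear_combination ih + (r ^ 2 ^ n * (∑ i ∈ Finset.range n, r ^ 2 ^ i) + r ^ 2 ^ n) * h2

/-- In characteristic two, an element not of the form `z ^ 2 + z` has absolute trace `1`. -/
lemma sum_pow_two_pow_eq_one {F : Type*} [Field F] [Fintype F] (h2 : (2 : F) = 0) {n : ℕ}
    (hn : Fintype.card F = 2 ^ n) {r : F} (hr : ∀ z, z ^ 2 + z + r ≠ 0) :
    ∑ i ∈ Finset.range n, r ^ 2 ^ i = 1 := by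
  have hT := sum_pow_two_pow_sq_add_self h2 r n
  rw [← hn, FiniteField.pow_card] at hT
  set T := ∑ i ∈ Finset.range n, r ^ 2 ^ i with hTdef
  have hT' : T * (T - 1) = 0 := by linear_combination hT + (r - T) * h2
  rcases mul_eq_zero.1 hT' with h0 | h1
  · exfalso
    have h2K : (2 : AlgebraicClosure F) = 0 := by
      rw [← map_ofNat (algebraMap F (AlgebraicClosure F)) 2, h2, map_zero]
    obtain ⟨z, hz⟩ := IsAlgClosed.exists_root (k := AlgebraicClosure F)
      (C 1 * X ^ 2 + C 1 * X + C (algebraMap F _ r))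
      (by rw [degree_quadratic one_ne_zero]; norm_num)
    have hz' : z ^ 2 + z + algebraMap F _ r = 0 := by simpa using hz
    have hzr : z ^ 2 + z = algebraMap F _ r := by
      linear_combination hz' - (algebraMap F (AlgebraicClosure F) r) * h2K
    have hs := sum_sq_add_self_pow_two_pow h2K z n
    rw [hzr] at hs
    simp only [← map_pow, ← map_sum] at hs
    rw [← hTdef, h0, map_zero, ← hn] at hs
    obtain ⟨x, rfl⟩ := exists_algebraMap_eq_of_pow_card (F := F) (x := z)
      (by linear_combination -hs - z * h2K)
    exact hr x ((algebraMap F (AlgebraicClosure F)).injective (by simpa using hz'))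
  · linear_combination h1

lemma exists_card_eq_two_pow {F : Type*} [Field F] [Fintype F] (h2 : (2 : F) = 0) :
    ∃ n, Fintype.card F = 2 ^ n := by
  have := charP_two_of_two_eq_zero h2
  obtain ⟨n, -, hn⟩ := FiniteField.card F 2
  exact ⟨n, hn⟩

lemma derivative_pow_even {F : Type*} [Field F] (h2 : (2 : F) = 0) (r : F[X]) {k : ℕ}
    (hk : 2 ∣ k) : derivative (r ^ k) = 0 := by
  obtain ⟨j, rfl⟩ := hk
  rw [derivative_pow]
  simp [h2]

/-- In characteristic two, a depressed cubic of constant absolute trace `1` is constant. -/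
lemma eq_zero_of_cubic_sq_add_self_ne {F : Type*} [Field F] [Fintype F] (h2 : (2 : F) = 0)
    (hq : 7 ≤ Fintype.card F) {α β γ : F}
    (h : ∀ t z, z ^ 2 + z + (α * t ^ 3 + β * t + γ) ≠ 0) : α = 0 ∧ β = 0 := by
  obtain ⟨n, hn⟩ := exists_card_eq_two_pow h2
  obtain ⟨m, rfl⟩ : ∃ m, n = m + 1 := Nat.exists_eq_succ_of_ne_zero (by
    rintro rfl; omega)
  have h2' : (2 : F[X]) = 0 := by rw [← C_ofNat, h2, C_0]
  set r : F[X] := C α * X ^ 3 + C β * X + C γ with hr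
  have hrdeg : r.natDegree ≤ 3 := by rw [hr]; compute_degree
  set T := ∑ i ∈ Finset.range (m + 1), r ^ 2 ^ i with hT
  set L : F[X] := X ^ Fintype.card F - X with hL
  have hLdeg : L.natDegree = Fintype.card F :=
    FiniteField.X_pow_card_sub_X_natDegree_eq F (by omega)
  have hL0 : L ≠ 0 := FiniteField.X_pow_card_sub_X_ne_zero F (by omega)
  obtain ⟨H, hH⟩ : L ∣ T + 1 := X_pow_card_sub_X_dvd fun t => by
    have := sum_pow_two_pow_eq_one h2 hn (h t)
    simp only [hT, hr, eval_add, eval_finsetSum, eval_pow, eval_mul, eval_C, eval_X, eval_one,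
      this]
    linear_combination h2
  have hTdeg : T.natDegree ≤ 2 ^ m * 3 := by
    refine natDegree_sum_le_of_forall_le _ _ fun i hi => ?_
    refine (natDegree_pow_le_of_le _ hrdeg).trans ?_
    gcongr
    · norm_num
    · have := Finset.mem_range.1 hi; omega
  have hHdeg : H.natDegree ≤ 2 ^ m := natDegree_le_of_mul_eq hL0 hH.symm (by
    refine (natDegree_add_le_of_degree_le hTdeg (by simp)).trans ?_
    rw [hLdeg, hn]; omega)
  have hr' : derivative r = C α * X ^ 2 + C β := by
    rw [hr]
    simp only [derivative_add, derivative_C_mul, derivative_X_pow, derivative_X, derivative_C]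
    rw [Nat.cast_ofNat, C_ofNat]
    linear_combination C α * X ^ 2 * h2'
  have hT' : derivative T = derivative r := by
    rw [hT, derivative_sum, Finset.sum_range_succ', Finset.sum_eq_zero]
    · simp
    · intro i _; exact derivative_pow_even h2 r (dvd_pow_self 2 (by omega))
  have hd := congrArg derivative hH
  rw [derivative_add, hT', derivative_one, derivative_mul, hL, derivative_X_pow_card_sub_X,
    ← hL] at hd
  have hH' : derivative H = 0 := eq_zero_of_mul_eq_of_natDegree_lt (L := L)
    (G := derivative r + H) (by linear_combination -hd) (by
      refine lt_of_le_of_lt (natDegree_add_le_of_degree_le (n := max 2 (2 ^ m))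
        ?_ ?_) ?_
      · rw [hr']; refine le_trans ?_ (le_max_left _ _); compute_degree
      · exact hHdeg.trans (le_max_right _ _)
      · rw [hLdeg]; omega)
  rw [hH', hr'] at hd
  have hT2 := sum_pow_two_pow_sq_add_self h2' r (m + 1)
  rw [← hT, ← hn] at hT2
  set K : F[X] := C α * X ^ 2 + C β with hK
  have hKdeg : K.natDegree ≤ 2 := by rw [hK]; compute_degree
  have hHK : H = K := by linear_combination -hd + H * h2'
  have hTK : T = 1 + L * K := by rw [← hHK, ← hH]; linear_combination -h2'
  have key : r ^ Fintype.card F = L * K * (1 + L * K) + r := by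
    rw [hTK] at hT2; linear_combination -hT2 + (1 + L * K - r) * h2'
  have hα : α = 0 := by
    have hdeg : (L * K * (1 + L * K) + r).natDegree ≤ 2 * Fintype.card F + 4 := by
      have h1 : (L * K).natDegree ≤ Fintype.card F + 2 := natDegree_mul_le_of_le hLdeg.le hKdeg
      have h3 : (1 + L * K).natDegree ≤ Fintype.card F + 2 :=
        natDegree_add_le_of_degree_le (by simp) h1
      refine natDegree_add_le_of_degree_le ((natDegree_mul_le_of_le h1 h3).trans ?_)
        (hrdeg.trans ?_) <;> omega
    have hc : r.coeff 3 ^ Fintype.card F = 0 := by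
      rw [← coeff_pow_of_natDegree_le hrdeg, key]
      exact coeff_eq_zero_of_natDegree_lt (by omega)
    have hr3 : r.coeff 3 = α := by rw [hr]; simp
    rw [hr3] at hc
    exact (pow_eq_zero_iff (by omega)).1 hc
  refine ⟨hα, ?_⟩
  by_contra hβ
  have hKβ : K = C β := by rw [hK, hα]; simp
  have hrβ : r ^ Fintype.card F = C β * X ^ Fintype.card F + C γ := by
    rw [hr, hα, hn, C_0, zero_mul, zero_add, add_pow_two_pow_of_two_eq_zero h2', mul_pow, ← C_pow,
      ← C_pow, ← hn, FiniteField.pow_card, FiniteField.pow_card]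
  rw [hrβ, hKβ, hr, hα, C_0] at key
  have : L * L * (C β * C β) = 0 := by
    rw [hL] at key ⊢
    linear_combination -key
  simp [hL0, hβ] at this

lemma isConstantTwist_of_eq_C_of_root_free {F : Type*} [Field F] [Fintype F] (h2 : (2 : F) = 0)
    (hq : 7 ≤ Fintype.card F) {p : F} (hp : p ≠ 0) {Q : F[X]} (hQ : Q.natDegree ≤ 4)
    (h : ∀ t y, y ^ 2 + p * y + Q.eval t ≠ 0) : IsConstantTwist (C p) Q := by
  have h2' : (2 : F[X]) = 0 := by rw [← C_ofNat, h2, C_0]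
  obtain ⟨s₂, hs₂⟩ := exists_sq_eq_of_two_eq_zero h2 (Q.coeff 4 / p ^ 2)
  obtain ⟨s₁, hs₁⟩ := exists_sq_eq_of_two_eq_zero h2 (Q.coeff 2 / p ^ 2 + s₂)
  have e₂ : Q.coeff 4 = p ^ 2 * s₂ ^ 2 := by rw [hs₂]; field_simp
  have e₁ : Q.coeff 2 = p ^ 2 * (s₁ ^ 2 - s₂) := by rw [hs₁]; field_simp; ring
  obtain ⟨α, hα⟩ : ∃ α, p ^ 2 * α = Q.coeff 3 := ⟨Q.coeff 3 / p ^ 2, by field_simp⟩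
  obtain ⟨β, hβ⟩ : ∃ β, p ^ 2 * (β - s₁) = Q.coeff 1 :=
    ⟨Q.coeff 1 / p ^ 2 + s₁, by field_simp; ring⟩
  obtain ⟨γ, hγ⟩ : ∃ γ, p ^ 2 * γ = Q.coeff 0 := ⟨Q.coeff 0 / p ^ 2, by field_simp⟩
  have hQe : Q = C p ^ 2 * ((C s₂ * X ^ 2 + C s₁ * X) ^ 2 - (C s₂ * X ^ 2 + C s₁ * X) +
      (C α * X ^ 3 + C β * X + C γ)) := by
    conv_lhs => rw [Q.as_sum_range_C_mul_X_pow' (n := 5) (by omega)]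
    simp only [Finset.sum_range_succ, Finset.sum_range_zero, e₂, e₁, ← hα, ← hβ, ← hγ, C_mul,
      C_sub, C_pow]
    linear_combination (-(C p) ^ 2 * C s₂ * C s₁ * X ^ 3) * h2'
  obtain ⟨rfl, rfl⟩ := eq_zero_of_cubic_sq_add_self_ne (α := α) (β := β) (γ := γ) h2 hq
    fun t z hz => h t (p * (z + (s₂ * t ^ 2 + s₁ * t))) (by
      rw [hQe]
      simp only [eval_add, eval_mul, eval_sub, eval_pow, eval_C, eval_X]
      linear_combination p ^ 2 * hz +
        (p ^ 2 * (z * (s₂ * t ^ 2 + s₁ * t) + (s₂ * t ^ 2 + s₁ * t) ^ 2)) * h2)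
  refine ⟨C p * (C s₂ * X ^ 2 + C s₁ * X), C p, 1, γ, ?_, ?_⟩
  · rw [C_1]; linear_combination C p * (C s₂ * X ^ 2 + C s₁ * X) * h2'
  · rw [hQe, C_1, C_0]; ring

lemma isConstantTwist_of_natDegree_two_of_root_free {F : Type*} [Field F] [Fintype F]
    (h2 : (2 : F) = 0) (hq : 7 ≤ Fintype.card F) {P Q : F[X]} (hP : P.natDegree = 2)
    (hQ : Q.natDegree ≤ 4) (hP0 : ∀ t, P.eval t ≠ 0)
    (h : ∀ t y, y ^ 2 + P.eval t * y + Q.eval t ≠ 0) : IsConstantTwist P Q := by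
  have h2' : (2 : F[X]) = 0 := by rw [← C_ofNat, h2, C_0]
  obtain ⟨n, hn⟩ := exists_card_eq_two_pow h2
  obtain ⟨m, rfl⟩ : ∃ m, n = m + 3 := Nat.exists_eq_add_of_le' (by
    by_contra! hlt
    interval_cases n <;> omega)
  set p₂ := P.coeff 2 with hp₂
  set p₁ := P.coeff 1 with hp₁
  set p₀ := P.coeff 0 with hp₀
  have hP' : P ≠ 0 := by rintro rfl; simp at hP
  have hp₂0 : p₂ ≠ 0 := by
    have := leadingCoeff_ne_zero.2 hP'
    rwa [leadingCoeff, hP] at this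
  have hPe : P = C p₂ * X ^ 2 + C p₁ * X + C p₀ := by
    conv_lhs => rw [P.as_sum_range_C_mul_X_pow' (n := 3) (by omega)]
    simp only [Finset.sum_range_succ, Finset.sum_range_zero, ← hp₂, ← hp₁, ← hp₀]
    ring
  have hp₁0 : p₁ ≠ 0 := by
    intro h1
    obtain ⟨t, ht⟩ := exists_sq_eq_of_two_eq_zero h2 (p₀ / p₂)
    refine hP0 t ?_
    rw [hPe, h1]
    simp only [eval_add, eval_mul, eval_pow, eval_C, eval_X, ht]
    field_simp
    linear_combination p₀ * h2
  have hdP : derivative P = C p₁ := by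
    rw [hPe]
    simp only [derivative_add, derivative_C_mul, derivative_X_pow, derivative_X, derivative_C]
    rw [Nat.cast_ofNat, C_ofNat]
    linear_combination C p₂ * X * h2'
  obtain ⟨S, N, hS, hN⟩ : ∃ S N : F[X], S.natDegree ≤ 1 ∧ Q + S ^ 2 + S * P = P * N := by
    have hmod : (Q % P).natDegree < 2 := by
      rw [← hP]; exact natDegree_mod_lt Q (by omega)
    set r₁ := (Q % P).coeff 1 with hr₁
    set r₀ := (Q % P).coeff 0 with hr₀
    have hr : Q % P = C r₁ * X + C r₀ := by
      conv_lhs => rw [(Q % P).as_sum_range_C_mul_X_pow' (n := 2) hmod]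
      simp only [Finset.sum_range_succ, Finset.sum_range_zero, ← hr₁, ← hr₀]
      ring
    obtain ⟨k, hk⟩ : ∃ k, k * p₁ = r₁ := ⟨r₁ / p₁, by field_simp⟩
    obtain ⟨s₁, hs₁⟩ := exists_sq_eq_of_two_eq_zero h2 (k * p₂)
    obtain ⟨s₀, hs₀⟩ := exists_sq_eq_of_two_eq_zero h2 (r₀ + k * p₀)
    refine ⟨C s₁ * X + C s₀, Q / P + C k + (C s₁ * X + C s₀), natDegree_linear_le, ?_⟩
    have e1 : C s₁ ^ 2 = C k * C p₂ := by rw [← C_pow, hs₁, C_mul]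
    have e0 : C s₀ ^ 2 = C r₀ + C k * C p₀ := by rw [← C_pow, hs₀, C_add, C_mul]
    have hdiv := EuclideanDomain.div_add_mod Q P
    rw [hr, ← hk, C_mul] at hdiv
    linear_combination -hdiv + X ^ 2 * e1 + e0 - C k * hPe + (C s₁ * C s₀ * X + C r₀) * h2'
  have hNdeg : N.natDegree ≤ 2 := natDegree_le_of_mul_eq hP' hN.symm (by
    rw [hP]
    refine natDegree_add_le_of_degree_le (natDegree_add_le_of_degree_le hQ
      ((natDegree_pow_le_of_le 2 hS).trans (by omega))) ((natDegree_mul_le_of_le hS hP.le).trans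
      (by omega)))
  have hzN : ∀ t z, z ^ 2 + z + N.eval t / P.eval t ≠ 0 := fun t z hz =>
    h t (P.eval t * z + S.eval t) (by
      have hN' := congrArg (eval t) hN
      simp only [eval_add, eval_mul, eval_pow] at hN'
      have := hP0 t
      field_simp at hz
      linear_combination P.eval t * hz + hN' +
        (P.eval t * z * S.eval t) * h2)
  set T := ∑ i ∈ Finset.range (m + 3), N ^ 2 ^ i * P ^ (2 ^ (m + 2) - 2 ^ i) with hT
  set L : F[X] := X ^ Fintype.card F - X with hL
  have hLdeg : L.natDegree = Fintype.card F :=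
    FiniteField.X_pow_card_sub_X_natDegree_eq F (by omega)
  have hL0 : L ≠ 0 := FiniteField.X_pow_card_sub_X_ne_zero F (by omega)
  have hle : ∀ i ∈ Finset.range (m + 3), 2 ^ i ≤ 2 ^ (m + 2) := fun i hi =>
    Nat.pow_le_pow_right (by norm_num) (by have := Finset.mem_range.1 hi; omega)
  obtain ⟨K, hK⟩ : L ∣ T + P ^ 2 ^ (m + 2) := X_pow_card_sub_X_dvd fun t => by
    have hs := sum_pow_two_pow_eq_one h2 hn (hzN t)
    have : T.eval t = P.eval t ^ 2 ^ (m + 2) := by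
      rw [← mul_one (_ ^ 2 ^ (m + 2)), ← hs, hT, eval_finsetSum, Finset.mul_sum]
      refine Finset.sum_congr rfl fun i hi => ?_
      rw [eval_mul, eval_pow, eval_pow, div_pow, pow_sub₀ _ (hP0 t) (hle i hi)]
      field_simp
    rw [eval_add, this, eval_pow]
    linear_combination P.eval t ^ 2 ^ (m + 2) * h2
  have hKdeg : K.natDegree ≤ 0 := natDegree_le_of_mul_eq hL0 hK.symm (by
    have hcard : Fintype.card F = 2 ^ (m + 2) * 2 := by rw [hn, pow_succ 2 (m + 2)]
    rw [hLdeg, hcard]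
    refine natDegree_add_le_of_degree_le (natDegree_sum_le_of_forall_le _ _ fun i hi => ?_)
      (natDegree_pow_le_of_le _ hP.le)
    refine (natDegree_mul_le_of_le (natDegree_pow_le_of_le _ hNdeg)
      (natDegree_pow_le_of_le _ hP.le)).trans ?_
    have := hle i hi
    omega)
  have hdT : derivative T = P ^ (2 ^ (m + 2) - 2) * (derivative N * P + N * derivative P) := by
    obtain ⟨j, hj⟩ : ∃ j, 2 ^ (m + 2) = 2 * j + 2 := ⟨2 ^ (m + 1) - 1, by
      have := Nat.one_le_two_pow (n := m + 1)
      rw [pow_succ 2 (m + 1)]; omega⟩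
    rw [hT, derivative_sum, Finset.sum_range_succ', Finset.sum_eq_zero]
    · rw [pow_zero, pow_one, hj, show 2 * j + 2 - 1 = 2 * j + 1 by omega,
        show 2 * j + 2 - 2 = 2 * j by omega, pow_succ, derivative_mul, derivative_mul,
        derivative_pow_even h2 P ⟨j, rfl⟩]
      ring
    · intro i hi
      rw [derivative_mul, derivative_pow_even h2 N (dvd_pow_self 2 (by omega)),
        derivative_pow_even h2 P (Nat.dvd_sub (dvd_pow_self 2 (by omega))
          (dvd_pow_self 2 (by omega)))]
      ring
  have hNP : derivative N * P + N * derivative P = 0 := by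
    refine eq_zero_of_mul_eq_of_natDegree_lt (L := P ^ (2 ^ (m + 2) - 2)) (G := -K) ?_ ?_
    · have hd := congrArg derivative hK
      rw [derivative_add, hdT, derivative_pow_even h2 P (dvd_pow_self 2 (by omega)), derivative_mul, hL,
        derivative_X_pow_card_sub_X, eq_C_of_natDegree_le_zero hKdeg, derivative_C] at hd
      rw [eq_C_of_natDegree_le_zero hKdeg]
      linear_combination hd
    · rw [natDegree_neg, natDegree_pow, hP]
      have : 4 ≤ 2 ^ (m + 2) := Nat.pow_le_pow_right (n := 2) (by norm_num) (by omega : 2 ≤ m + 2)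
      omega
  obtain ⟨M, hM⟩ : P ∣ N := ⟨C (-p₁⁻¹) * derivative N, by
    rw [hdP] at hNP
    have : C p₁ * C p₁⁻¹ = 1 := by rw [← C_mul, mul_inv_cancel₀ hp₁0, C_1]
    rw [C_neg]
    linear_combination C p₁⁻¹ * hNP - N * this⟩
  have hMdeg : M.natDegree ≤ 0 := natDegree_le_of_mul_eq hP' hM.symm (by omega)
  obtain ⟨k, rfl⟩ : ∃ k, M = C k := ⟨_, eq_C_of_natDegree_le_zero hMdeg⟩
  refine ⟨S, P, 1, k, ?_, ?_⟩
  · rw [C_1]; linear_combination S * h2'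
  · rw [C_1]; rw [hM] at hN
    linear_combination hN - S ^ 2 * h2'

lemma isConstantTwist_of_root_free_of_two_eq_zero {F : Type*} [Field F] [Fintype F]
    (h2 : (2 : F) = 0) (hq : 7 ≤ Fintype.card F) {P Q : F[X]} (hP : P.natDegree ≤ 2)
    (hQ : Q.natDegree ≤ 4) (hP0 : ∀ t, P.eval t ≠ 0)
    (h : ∀ t y, y ^ 2 + P.eval t * y + Q.eval t ≠ 0) : IsConstantTwist P Q := by
  rcases (by omega : P.natDegree = 0 ∨ P.natDegree = 1 ∨ P.natDegree = 2) with hd | hd | hd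
  · rw [natDegree_eq_zero] at hd
    obtain ⟨p, rfl⟩ := hd
    simp only [eval_C] at hP0 h
    exact isConstantTwist_of_eq_C_of_root_free h2 hq (hP0 0) hQ h
  · obtain ⟨t, ht⟩ := exists_root_of_degree_eq_one (degree_eq_iff_natDegree_eq_of_pos one_pos |>.2 hd)
    exact (hP0 t ht).elim
  · exact isConstantTwist_of_natDegree_two_of_root_free h2 hq hd hQ hP0 h

lemma eval_resolventP {R : Type*} [CommRing R] (a b c d : R[X]) (t : R) :
    (resolventP a b c d).eval t = resolventP (a.eval t) (b.eval t) (c.eval t) (d.eval t) :=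
  map_resolventP (evalRingHom t) a b c d

lemma eval_resolventQ {R : Type*} [CommRing R] (a b c d : R[X]) (t : R) :
    (resolventQ a b c d).eval t = resolventQ (a.eval t) (b.eval t) (c.eval t) (d.eval t) :=
  map_resolventQ (evalRingHom t) a b c d

lemma natDegree_resolventP_le {R : Type*} [CommRing R] {a b c d : R[X]} (ha : a.natDegree ≤ 1)
    (hb : b.natDegree ≤ 1) (hc : c.natDegree ≤ 1) (hd : d.natDegree ≤ 1) :
    (resolventP a b c d).natDegree ≤ 2 :=
  natDegree_sub_le_of_le (natDegree_mul_le_of_le hb hc)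
    (natDegree_mul_le_of_le (natDegree_mul_le_of_le (natDegree_ofNat 3).le ha) hd)

lemma natDegree_resolventQ_le {R : Type*} [CommRing R] {a b c d : R[X]} (ha : a.natDegree ≤ 1)
    (hb : b.natDegree ≤ 1) (hc : c.natDegree ≤ 1) (hd : d.natDegree ≤ 1) :
    (resolventQ a b c d).natDegree ≤ 4 := by
  have h1 : (b ^ 3 * d).natDegree ≤ 3 + 1 :=
    natDegree_mul_le_of_le (natDegree_pow_le_of_le 3 hb) hd
  have h2 : (a * c ^ 3).natDegree ≤ 1 + 3 :=
    natDegree_mul_le_of_le ha (natDegree_pow_le_of_le 3 hc)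
  have h3 : (9 * a ^ 2 * d ^ 2).natDegree ≤ (0 + 2) + 2 :=
    natDegree_mul_le_of_le (natDegree_mul_le_of_le (natDegree_ofNat 9).le
      (natDegree_pow_le_of_le 2 ha)) (natDegree_pow_le_of_le 2 hd)
  have h4 : (6 * a * b * c * d).natDegree ≤ ((0 + 1) + 1) + 1 + 1 :=
    natDegree_mul_le_of_le (natDegree_mul_le_of_le (natDegree_mul_le_of_le
      (natDegree_mul_le_of_le (natDegree_ofNat 6).le ha) hb) hc) hd
  exact natDegree_sub_le_of_le (natDegree_add_le_of_degree_le
    (natDegree_add_le_of_degree_le h1 h2) h3) h4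

lemma isConstantTwist_of_triple_infty {F : Type*} [Field F] [Fintype F]
    (hq : 7 ≤ Fintype.card F) {a b c d : F[X]} (ha : a.natDegree ≤ 1) (hb : b.natDegree ≤ 1)
    (hc : c.natDegree ≤ 1) (hd : d.natDegree ≤ 1) (ha0 : a ≠ 0) {t₀ : F} (hat : a.eval t₀ = 0)
    (hbt : b.eval t₀ = 0) (hct : c.eval t₀ = 0) (hdt : d.eval t₀ ≠ 0)
    (h : HasNoSimpleSpecializedRoot (resolventP a b c d) (resolventQ a b c d)) :
    IsConstantTwist (resolventP a b c d) (resolventQ a b c d) := by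
  have hA := eq_linear_of_natDegree_le_one ha t₀
  have hB := eq_linear_of_natDegree_le_one hb t₀
  have hC := eq_linear_of_natDegree_le_one hc t₀
  have hD := eq_linear_of_natDegree_le_one hd t₀
  rw [hat, C_0, zero_add] at hA
  rw [hbt, C_0, zero_add] at hB
  rw [hct, C_0, zero_add] at hC
  by_cases h2 : (2 : F) = 0
  · exact isConstantTwist_of_triple_infty_of_two_eq_zero h2 hq
      (fun h0 => ha0 (by rw [hA, h0, C_0, zero_mul])) hdt hA hB hC hD h
  · exact isConstantTwist_of_triple_infty_of_two_ne_zero h2 hq hdt hA hB hC hD h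

lemma isConstantTwist_of_existsUnique_isProjRoot {F : Type*} [Field F] [Fintype F]
    (hq : 7 ≤ Fintype.card F) {a b c d : F[X]} (ha : a.natDegree ≤ 1) (hb : b.natDegree ≤ 1)
    (hc : c.natDegree ≤ 1) (hd : d.natDegree ≤ 1) (ha0 : a ≠ 0)
    (hroot : ∀ x : F, a * C x ^ 3 + b * C x ^ 2 + c * C x + d ≠ 0)
    (h : ∀ t, ∃! x, IsProjRoot (a.eval t) (b.eval t) (c.eval t) (d.eval t) x) :
    HasNoSimpleSpecializedRoot (resolventP a b c d) (resolventQ a b c d) ∧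
      IsConstantTwist (resolventP a b c d) (resolventQ a b c d) := by
  have hns : HasNoSimpleSpecializedRoot (resolventP a b c d) (resolventQ a b c d) := by
    intro t y hD
    rw [eval_resolventP, eval_resolventQ] at hD ⊢
    rcases triple_root_or_resolvent_ne_zero (h t) with ⟨e1, e2, e3⟩ | ⟨x, e1, e2, e3⟩ | hne
    · exact absurd (by rw [e1, e2, e3]; simp only [resolventP, resolventQ]; ring) hD
    · exact absurd (by rw [e1, e2, e3]; simp only [resolventP, resolventQ]; ring) hD
    · exact hne y
  refine ⟨hns, ?_⟩
  have hnz : ∀ t, ¬ (a.eval t = 0 ∧ b.eval t = 0 ∧ c.eval t = 0 ∧ d.eval t = 0) := by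
    rintro t ⟨e1, e2, e3, e4⟩
    have := (h t).unique (y₁ := none) (y₂ := some 0) e1 (by simp [IsProjRoot, e4])
    simp at this
  by_cases hD : ∀ t, (resolventP a b c d).eval t ^ 2 - 4 * (resolventQ a b c d).eval t ≠ 0
  · have hP := natDegree_resolventP_le ha hb hc hd
    have hQ := natDegree_resolventQ_le ha hb hc hd
    generalize resolventP a b c d = P at *
    generalize resolventQ a b c d = Q at *
    have hno : ∀ t y, y ^ 2 + P.eval t * y + Q.eval t ≠ 0 := fun t y => hns t y (hD t)
    by_cases h2 : (2 : F) = 0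
    · refine isConstantTwist_of_root_free_of_two_eq_zero h2 hq hP hQ (fun t ht => hD t ?_) hno
      linear_combination P.eval t * ht - 2 * Q.eval t * h2
    · obtain ⟨ε, s, hs⟩ := exists_eq_C_mul_sq_of_forall_not_isSquare h2 hq
        (D := P ^ 2 - 4 * Q) (natDegree_sub_le_of_le (natDegree_pow_le_of_le 2 hP)
          (natDegree_mul_le_of_le (natDegree_ofNat 4).le hQ)) fun t ⟨r, hr⟩ => by
            simp only [eval_sub, eval_mul, eval_pow, eval_ofNat] at hr
            refine hno t ((-P.eval t + r) / 2) ?_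
            field_simp
            linear_combination -hr
      exact .of_discr h2 hs
  · push Not at hD
    obtain ⟨t₀, ht₀⟩ := hD
    rw [eval_resolventP, eval_resolventQ] at ht₀
    rcases triple_root_or_resolvent_ne_zero (h t₀) with ⟨e1, e2, e3⟩ | ⟨x, e1, e2, e3⟩ | hne
    · exact isConstantTwist_of_triple_infty hq ha hb hc hd ha0 e1 e2 e3
        (fun e4 => hnz t₀ ⟨e1, e2, e3, e4⟩) hns
    · have hCx : (C x).natDegree ≤ 0 := (natDegree_C x).le
      have hx2 : (C x ^ 2).natDegree ≤ 0 := natDegree_pow_le_of_le 2 hCx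
      have hx3 : (C x ^ 3).natDegree ≤ 0 := natDegree_pow_le_of_le 3 hCx
      have h3a : (3 * a).natDegree ≤ 1 := natDegree_mul_le_of_le (natDegree_ofNat 3).le ha
      have h2b : (2 * b).natDegree ≤ 1 := natDegree_mul_le_of_le (natDegree_ofNat 2).le hb
      refine IsConstantTwist.of_translate
        (E := C x * b ^ 2 + 3 * C x ^ 2 * a * b + 3 * C x ^ 3 * a ^ 2) ?_
      have hns' := hns.translate (C x * b ^ 2 + 3 * C x ^ 2 * a * b + 3 * C x ^ 3 * a ^ 2)
      rw [← resolventP_translate, ← resolventQ_translate, ← resolventP_reverse,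
        ← resolventQ_reverse] at hns' ⊢
      refine isConstantTwist_of_triple_infty hq (t₀ := t₀) ?_ ?_ ?_ ha ?_ ?_ ?_ ?_ ?_ hns'
      · exact natDegree_add_le_of_degree_le (natDegree_add_le_of_degree_le
          (natDegree_add_le_of_degree_le hd (natDegree_mul_le_of_le hc hCx))
          (natDegree_mul_le_of_le hb hx2)) (natDegree_mul_le_of_le ha hx3)
      · exact natDegree_add_le_of_degree_le (natDegree_add_le_of_degree_le hc
          (natDegree_mul_le_of_le h2b hCx)) (natDegree_mul_le_of_le h3a hx2)
      · exact natDegree_add_le_of_degree_le hb (natDegree_mul_le_of_le h3a hCx)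
      · exact fun h0 => hroot x (by linear_combination h0)
      · simp only [eval_add, eval_mul, eval_pow, eval_C, e1, e2, e3]; ring
      · simp only [eval_add, eval_mul, eval_pow, eval_C, eval_ofNat, e1, e2]; ring
      · simp only [eval_add, eval_mul, eval_C, eval_ofNat, e1]; ring
      · exact fun e0 => hnz t₀ ⟨e0, by rw [e1, e0]; ring, by rw [e2, e0]; ring,
          by rw [e3, e0]; ring⟩
    · exfalso
      generalize resolventP (a.eval t₀) (b.eval t₀) (c.eval t₀) (d.eval t₀) = P at *
      generalize resolventQ (a.eval t₀) (b.eval t₀) (c.eval t₀) (d.eval t₀) = Q at *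
      by_cases h2 : (2 : F) = 0
      · obtain ⟨y, hy⟩ := exists_sq_eq_of_two_eq_zero h2 Q
        have hP : P = 0 := by
          refine pow_eq_zero_iff two_ne_zero |>.1 ?_
          linear_combination ht₀ + 2 * Q * h2
        exact hne y (by rw [hP, hy]; linear_combination Q * h2)
      · refine hne (-P / 2) ?_
        field_simp
        linear_combination -ht₀

/-- The coefficients, as polynomials in `t`, of `f(x) - t·g(x)`. -/
def fiberCoeff {R : Type*} [CommRing R] (f g : R[X]) (i : ℕ) : R[X] :=
  C (f.coeff i) - C (g.coeff i) * X

lemma eval_fiberCoeff {R : Type*} [CommRing R] (f g : R[X]) (i : ℕ) (t : R) :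
    (fiberCoeff f g i).eval t = f.coeff i - g.coeff i * t := by
  simp [fiberCoeff]

lemma natDegree_fiberCoeff_le {R : Type*} [CommRing R] (f g : R[X]) (i : ℕ) :
    (fiberCoeff f g i).natDegree ≤ 1 := by
  rw [fiberCoeff]
  compute_degree

lemma coeff_one_fiberCoeff {R : Type*} [CommRing R] (f g : R[X]) (i : ℕ) :
    (fiberCoeff f g i).coeff 1 = -g.coeff i := by
  simp [fiberCoeff, coeff_C]

lemma fiberCoeff_map {R S : Type*} [CommRing R] [CommRing S] (φ : R →+* S) (f g : R[X]) (i : ℕ) :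
    fiberCoeff (f.map φ) (g.map φ) i = (fiberCoeff f g i).map φ := by
  simp [fiberCoeff]

lemma coeff_fiberPoly {F : Type} [Field F] (f g : F[X]) (i : ℕ) :
    (fiberPoly f g).coeff i = algebraMap F[X] (RatFunc F) (fiberCoeff f g i) := by
  simp only [fiberPoly, fiberCoeff, coeff_sub, coeff_map, coeff_C_mul, map_sub, map_mul,
    RatFunc.algebraMap_C, RatFunc.algebraMap_X, RatFunc.algebraMap_eq_C]
  ring

lemma coeff_three_ne_zero_or {F : Type*} [Field F] {f g : F[X]}
    (h : max f.natDegree g.natDegree = 3) : f.coeff 3 ≠ 0 ∨ g.coeff 3 ≠ 0 := by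
  have key : ∀ p : F[X], p.natDegree = 3 → p.coeff 3 ≠ 0 := fun p hp => by
    rw [← hp]
    exact leadingCoeff_ne_zero.2 (by rintro rfl; simp at hp)
  rcases max_choice f.natDegree g.natDegree with hm | hm
  · exact Or.inl (key f (by omega))
  · exact Or.inr (key g (by omega))

lemma fiberCoeff_three_ne_zero {F : Type*} [Field F] {f g : F[X]}
    (h : max f.natDegree g.natDegree = 3) : fiberCoeff f g 3 ≠ 0 := by
  intro h0
  have e0 := congrArg (coeff · 0) h0
  have e1 := congrArg (coeff · 1) h0
  simp [fiberCoeff, coeff_C] at e0 e1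
  rcases coeff_three_ne_zero_or h with h' | h' <;> contradiction

lemma natDegree_fiberPoly_le {F : Type} [Field F] {f g : F[X]}
    (h : max f.natDegree g.natDegree = 3) : (fiberPoly f g).natDegree ≤ 3 := by
  rw [natDegree_le_iff_coeff_eq_zero]
  intro i hi
  rw [coeff_fiberPoly, fiberCoeff, coeff_eq_zero_of_natDegree_lt (by omega),
    coeff_eq_zero_of_natDegree_lt (by omega)]
  simp

lemma leadingCoeff_fiberPoly {F : Type} [Field F] {f g : F[X]}
    (h : max f.natDegree g.natDegree = 3) :
    (fiberPoly f g).leadingCoeff = algebraMap F[X] (RatFunc F) (fiberCoeff f g 3) := by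
  rw [leadingCoeff, natDegree_eq_of_le_of_coeff_ne_zero (natDegree_fiberPoly_le h),
    coeff_fiberPoly]
  rw [coeff_fiberPoly]
  exact RatFunc.algebraMap_ne_zero (fiberCoeff_three_ne_zero h)

lemma irreducible_X_sq_add_iff {K : Type*} [Field K] (p q : K) :
    Irreducible (X ^ 2 + C p * X + C q) ↔ ∀ x, x ^ 2 + p * x + q ≠ 0 := by
  have hdeg : (X ^ 2 + C p * X + C q).natDegree = 2 := by compute_degree!
  have hmonic : (X ^ 2 + C p * X + C q).Monic := by monicity!
  rw [hmonic.irreducible_iff_roots_eq_zero_of_degree_le_three (by omega) (by omega),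
    Multiset.eq_zero_iff_forall_notMem]
  refine forall_congr' fun x => not_congr ?_
  rw [mem_roots hmonic.ne_zero, IsRoot]
  simp

/-- The quadratic resolvent of `f(x) - t·g(x)` is irreducible over `F(t)` exactly when its
denominator-free version has no root in `F[t]`. -/
lemma irreducible_quadResolvent_iff {F : Type} [Field F] {f g : F[X]}
    (h : max f.natDegree g.natDegree = 3) :
    Irreducible (quadResolvent (monicize (fiberPoly f g))) ↔ ∀ y : F[X],
      y ^ 2 + resolventP (fiberCoeff f g 3) (fiberCoeff f g 2) (fiberCoeff f g 1)
        (fiberCoeff f g 0) * y + resolventQ (fiberCoeff f g 3) (fiberCoeff f g 2)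
        (fiberCoeff f g 1) (fiberCoeff f g 0) ≠ 0 := by
  have hA : algebraMap F[X] (RatFunc F) (fiberCoeff f g 3) ≠ 0 :=
    RatFunc.algebraMap_ne_zero (fiberCoeff_three_ne_zero h)
  rw [quadResolvent, irreducible_X_sq_add_iff]
  simp only [monicize, coeff_C_mul, leadingCoeff_fiberPoly h, coeff_fiberPoly]
  set φ := algebraMap F[X] (RatFunc F)
  set a := fiberCoeff f g 3
  set b := fiberCoeff f g 2
  set c := fiberCoeff f g 1
  set d := fiberCoeff f g 0
  constructor
  · intro hx y hy
    refine hx (φ y / φ a ^ 2) ?_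
    have hy' := congrArg φ hy
    simp only [map_add, map_mul, map_pow, map_zero, map_resolventP, map_resolventQ] at hy'
    simp only [resolventP, resolventQ] at hy'
    field_simp
    linear_combination hy'
  · intro hy x hx
    have hz : (φ a ^ 2 * x) ^ 2 + φ (resolventP a b c d) * (φ a ^ 2 * x) +
        φ (resolventQ a b c d) = 0 := by
      rw [map_resolventP, map_resolventQ]
      simp only [resolventP, resolventQ]
      field_simp at hx
      linear_combination hx
    obtain ⟨y, hy'⟩ := IsIntegrallyClosed.algebraMap_eq_of_integral (R := F[X]) (K := RatFunc F)
      (x := φ a ^ 2 * x) ⟨X ^ 2 + C (resolventP a b c d) * X + C (resolventQ a b c d), by monicity!,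
        by simpa using hz⟩
    refine hy y (IsFractionRing.injective F[X] (RatFunc F) ?_)
    rw [← hy'] at hz
    simpa using hz

lemma eval_eq_cubic {R : Type*} [CommRing R] {p : R[X]} (h : p.natDegree ≤ 3) (x : R) :
    p.eval x = p.coeff 3 * x ^ 3 + p.coeff 2 * x ^ 2 + p.coeff 1 * x + p.coeff 0 := by
  rw [eval_eq_sum_range' (Nat.lt_succ_of_le h)]
  simp only [Finset.sum_range_succ, Finset.sum_range_zero]
  ring

lemma ratEval_eq_some_iff {F : Type} [Field F] {f g : F[X]} (hco : IsCoprime f g)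
    (hdeg : max f.natDegree g.natDegree = 3) (t : F) (x : Option F) :
    ratEval f g x = some t ↔ IsProjRoot ((fiberCoeff f g 3).eval t) ((fiberCoeff f g 2).eval t)
      ((fiberCoeff f g 1).eval t) ((fiberCoeff f g 0).eval t) x := by
  simp only [eval_fiberCoeff]
  rcases x with _ | x
  · simp only [ratEval, IsProjRoot]
    split_ifs with h1 h2
    · have hg : g.coeff 3 = 0 := coeff_eq_zero_of_natDegree_lt (by omega)
      have := coeff_three_ne_zero_or hdeg
      simp_all
    · have hf : f.coeff 3 = 0 := coeff_eq_zero_of_natDegree_lt (by omega)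
      have hg : g.coeff 3 ≠ 0 := by simpa [hf] using coeff_three_ne_zero_or hdeg
      rw [hf, zero_sub, neg_eq_zero, mul_eq_zero, or_iff_right hg, Option.some_inj, eq_comm]
    · have hf : f.natDegree = 3 := by omega
      have hg : g.natDegree = 3 := by omega
      have hg0 : g.coeff 3 ≠ 0 := by
        rw [← hg]
        exact leadingCoeff_ne_zero.2 (by rintro rfl; simp at hg)
      rw [leadingCoeff, leadingCoeff, hf, hg, Option.some_inj, div_eq_iff hg0, sub_eq_zero,
        mul_comm]
  · have e : (f.coeff 3 - g.coeff 3 * t) * x ^ 3 + (f.coeff 2 - g.coeff 2 * t) * x ^ 2 +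
        (f.coeff 1 - g.coeff 1 * t) * x + (f.coeff 0 - g.coeff 0 * t) =
        f.eval x - t * g.eval x := by
      rw [eval_eq_cubic (p := f) (by omega), eval_eq_cubic (p := g) (by omega)]
      ring
    simp only [ratEval, IsProjRoot, e]
    split_ifs with h
    · rw [Option.some_inj, div_eq_iff h, sub_eq_zero]
    · push Not at h
      obtain ⟨u, v, huv⟩ := hco
      have h1 := congrArg (eval x) huv
      simp only [eval_add, eval_mul, h, eval_one, mul_zero, add_zero] at h1
      simp only [h, mul_zero, sub_zero, false_iff]
      intro h0
      simp [h0] at h1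

lemma ratEval_eq_none_iff {F : Type} [Field F] {f g : F[X]}
    (hdeg : max f.natDegree g.natDegree = 3) (x : Option F) :
    ratEval f g x = none ↔
      IsProjRoot (g.coeff 3) (g.coeff 2) (g.coeff 1) (g.coeff 0) x := by
  rcases x with _ | x
  · simp only [ratEval, IsProjRoot]
    split_ifs with h1 h2
    · simp [coeff_eq_zero_of_natDegree_lt (by omega : g.natDegree < 3)]
    · have hf : f.coeff 3 = 0 := coeff_eq_zero_of_natDegree_lt (by omega)
      have := coeff_three_ne_zero_or hdeg
      simp_all
    · have hg : g.natDegree = 3 := by omega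
      have hg0 : g.coeff 3 ≠ 0 := by
        rw [← hg]
        exact leadingCoeff_ne_zero.2 (by rintro rfl; simp at hg)
      simp [hg0]
  · rw [IsProjRoot, ← eval_eq_cubic (by omega)]
    simp only [ratEval]
    split_ifs with h <;> simp_all

lemma resolventP_sq_sub_ne_zero {F : Type} [Field F] {f g : F[X]}
    (hdeg : max f.natDegree g.natDegree = 3) (hsep : (fiberPoly f g).Separable) :
    resolventP (fiberCoeff f g 3) (fiberCoeff f g 2) (fiberCoeff f g 1) (fiberCoeff f g 0) ^ 2 -
      4 * resolventQ (fiberCoeff f g 3) (fiberCoeff f g 2) (fiberCoeff f g 1)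
        (fiberCoeff f g 0) ≠ 0 := by
  intro h0
  have hmap := congrArg (algebraMap F[X] (RatFunc F)) h0
  rw [map_sub, map_mul, map_pow, map_resolventP, map_resolventQ, map_ofNat, resolvent_discr,
    map_zero] at hmap
  have hA : algebraMap F[X] (RatFunc F) (fiberCoeff f g 3) ≠ 0 :=
    RatFunc.algebraMap_ne_zero (fiberCoeff_three_ne_zero hdeg)
  generalize hc : Cubic.mk (algebraMap F[X] (RatFunc F) (fiberCoeff f g 3))
    (algebraMap F[X] (RatFunc F) (fiberCoeff f g 2))
    (algebraMap F[X] (RatFunc F) (fiberCoeff f g 1))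
    (algebraMap F[X] (RatFunc F) (fiberCoeff f g 0)) = cub at hmap
  have ha : cub.a ≠ 0 := by rw [← hc]; exact hA
  have hpoly : cub.toPoly = fiberPoly f g := by
    rw [(fiberPoly f g).as_sum_range_C_mul_X_pow' (n := 4)
      (Nat.lt_succ_of_le (natDegree_fiberPoly_le hdeg)), ← hc]
    simp only [Finset.sum_range_succ, Finset.sum_range_zero, coeff_fiberPoly, Cubic.toPoly]
    ring
  refine (Cubic.discr_ne_zero_iff_roots_nodup
    (φ := algebraMap (RatFunc F) (AlgebraicClosure (RatFunc F))) ha (IsAlgClosed.splits _)).2 ?_ hmap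
  rw [Cubic.map_roots, hpoly]
  exact nodup_roots hsep.map

/-- A monic quadratic over a finite field `F` has a root in the quadratic extension of `F`. -/
lemma exists_quadratic_root_of_card_eq_sq {F E : Type*} [Field F] [Fintype F] [Field E]
    [Fintype E] [Algebra F E] (hE : Fintype.card E = Fintype.card F ^ 2) (m n : F) :
    ∃ z : E, z ^ 2 + algebraMap F E m * z + algebraMap F E n = 0 := by
  obtain ⟨z, hz⟩ := IsAlgClosed.exists_root (k := AlgebraicClosure E)
    (C 1 * X ^ 2 + C (algebraMap F _ m) * X + C (algebraMap F _ n))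
    (by rw [degree_quadratic one_ne_zero]; norm_num)
  have hz' : z ^ 2 + algebraMap F _ m * z + algebraMap F _ n = 0 := by simpa using hz
  let σ := FiniteField.frobeniusAlgHom F (AlgebraicClosure E)
  have hσ : ∀ x, σ x = x ^ Fintype.card F := fun x => rfl
  have hσz := congrArg σ hz'
  simp only [map_add, map_mul, map_pow, AlgHom.commutes, map_zero] at hσz
  have hfac : (σ z - z) * (σ z + z + algebraMap F _ m) = 0 := by
    linear_combination hσz - hz'
  have hσσ : σ (σ z) = z := by
    rcases mul_eq_zero.1 hfac with h | h
    · rw [sub_eq_zero.1 h, sub_eq_zero.1 h]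
    · have h1 : σ z = -algebraMap F _ m - z := by linear_combination h
      rw [h1, map_sub, map_neg, AlgHom.commutes, h1]
      ring
  obtain ⟨r, rfl⟩ := exists_algebraMap_eq_of_pow_card (F := E) (x := z) (by
    rw [hE, sq, pow_mul]; exact hσσ)
  refine ⟨r, (algebraMap E (AlgebraicClosure E)).injective ?_⟩
  simpa [← IsScalarTower.algebraMap_apply] using hz'

lemma IsConstantTwist.exists_root {F E : Type*} [Field F] [Fintype F] [Field E] [Fintype E]
    [Algebra F E] (hE : Fintype.card E = Fintype.card F ^ 2) {P Q : F[X]}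
    (h : IsConstantTwist P Q) :
    ∃ y, y ^ 2 + P.map (algebraMap F E) * y + Q.map (algebraMap F E) = 0 := by
  obtain ⟨s, w, m, n, rfl, rfl⟩ := h
  obtain ⟨z, hz⟩ := exists_quadratic_root_of_card_eq_sq hE m n
  refine ⟨s.map (algebraMap F E) + w.map (algebraMap F E) * C z, ?_⟩
  have hz' := congrArg C hz
  simp only [C_add, C_mul, C_pow, C_0] at hz'
  simp only [Polynomial.map_add, Polynomial.map_sub, Polynomial.map_mul, Polynomial.map_neg,
    Polynomial.map_pow, Polynomial.map_ofNat, map_C]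
  linear_combination (w.map (algebraMap F E)) ^ 2 * hz'

/-- If the two roots of the quadratic resolvent of a binary cubic form are exchanged by Frobenius,
the form has a root. -/
lemma exists_isProjRoot_of_pow_card_eq {F E : Type*} [Field F] [Fintype F] [Field E] [Algebra F E]
    {a b c d : F} {y : E}
    (hy : y ^ 2 + algebraMap F E (resolventP a b c d) * y +
      algebraMap F E (resolventQ a b c d) = 0)
    (hσ : y ^ Fintype.card F = -algebraMap F E (resolventP a b c d) - y) :
    ∃ x, IsProjRoot a b c d x := by
  by_contra! h
  obtain ⟨⟨r, hr⟩, hD⟩ := exists_resolvent_root h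
  generalize resolventP a b c d = P at *
  generalize resolventQ a b c d = Q at *
  have hr' := congrArg (algebraMap F E) hr
  simp only [map_add, map_mul, map_pow, map_zero] at hr'
  obtain ⟨x, rfl⟩ : ∃ x, algebraMap F E x = y := by
    rcases mul_eq_zero.1 (show (y - algebraMap F E r) * (y + algebraMap F E r + algebraMap F E P)
      = 0 by linear_combination hy - hr') with h0 | h0
    · exact ⟨r, (sub_eq_zero.1 h0).symm⟩
    · exact ⟨-r - P, by rw [map_sub, map_neg]; linear_combination -h0⟩
  have hinj := (algebraMap F E).injective
  have e1 : x ^ 2 + P * x + Q = 0 := hinj (by simpa using hy)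
  rw [← map_pow, FiniteField.pow_card] at hσ
  have e2 : x = -P - x := hinj (by simpa using hσ)
  exact hD (by linear_combination (2 * x + P) * e2 - 4 * e1)

lemma coeff_resolventP {R : Type*} [CommRing R] {a b c d : R[X]} (ha : a.natDegree ≤ 1)
    (hb : b.natDegree ≤ 1) (hc : c.natDegree ≤ 1) (hd : d.natDegree ≤ 1) :
    (resolventP a b c d).coeff 2 =
      resolventP (a.coeff 1) (b.coeff 1) (c.coeff 1) (d.coeff 1) := by
  rw [resolventP, coeff_sub, mul_assoc, coeff_ofNat_mul, coeff_mul_add_eq_of_natDegree_le hb hc,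
    coeff_mul_add_eq_of_natDegree_le ha hd, resolventP, mul_assoc]

lemma coeff_resolventQ {R : Type*} [CommRing R] {a b c d : R[X]} (ha : a.natDegree ≤ 1)
    (hb : b.natDegree ≤ 1) (hc : c.natDegree ≤ 1) (hd : d.natDegree ≤ 1) :
    (resolventQ a b c d).coeff 4 =
      resolventQ (a.coeff 1) (b.coeff 1) (c.coeff 1) (d.coeff 1) := by
  have hpow : ∀ (p : R[X]) (n : ℕ), p.natDegree ≤ 1 →
      (p ^ n).natDegree ≤ n ∧ (p ^ n).coeff n = p.coeff 1 ^ n := fun p n hp =>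
    ⟨by simpa using natDegree_pow_le_of_le n hp, by simpa using coeff_pow_of_natDegree_le hp⟩
  have h1 : (b ^ 3 * d).coeff 4 = _ :=
    coeff_mul_add_eq_of_natDegree_le (hpow b 3 hb).1 hd
  have h2 : (a * c ^ 3).coeff 4 = _ :=
    coeff_mul_add_eq_of_natDegree_le ha (hpow c 3 hc).1
  have h3 : (a ^ 2 * d ^ 2).coeff 4 = _ :=
    coeff_mul_add_eq_of_natDegree_le (hpow a 2 ha).1 (hpow d 2 hd).1
  have h4 : (a * b * (c * d)).coeff 4 = _ :=
    coeff_mul_add_eq_of_natDegree_le (natDegree_mul_le_of_le ha hb) (natDegree_mul_le_of_le hc hd)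
  rw [resolventQ, show b ^ 3 * d + a * c ^ 3 + 9 * a ^ 2 * d ^ 2 - 6 * a * b * c * d =
    b ^ 3 * d + a * c ^ 3 + 9 * (a ^ 2 * d ^ 2) - 6 * (a * b * (c * d)) by ring, coeff_sub,
    coeff_add, coeff_add, coeff_ofNat_mul, coeff_ofNat_mul, h1, h2, h3, h4, (hpow b 3 hb).2,
    (hpow c 3 hc).2, (hpow a 2 ha).2, (hpow d 2 hd).2, coeff_mul_add_eq_of_natDegree_le ha hb,
    coeff_mul_add_eq_of_natDegree_le hc hd, resolventQ]
  ring

lemma natDegree_le_of_sq_add_mul_add_eq_zero {K : Type*} [Field K] {P Q Y : K[X]} {n : ℕ}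
    (hP : P.natDegree ≤ n) (hQ : Q.natDegree ≤ 2 * n) (h : Y ^ 2 + P * Y + Q = 0) :
    Y.natDegree ≤ n := by
  by_contra! hlt
  have hYP : (Y + P).natDegree = Y.natDegree := natDegree_add_eq_left_of_natDegree_lt (by omega)
  have hY0 : Y ≠ 0 := by rintro rfl; simp at hlt
  have hYP0 : Y + P ≠ 0 := by rintro h0; rw [h0, natDegree_zero] at hYP; omega
  have h1 : (Y * (Y + P)).natDegree = Y.natDegree + Y.natDegree := by
    rw [natDegree_mul hY0 hYP0, hYP]
  rw [show Y * (Y + P) = -Q by linear_combination h, natDegree_neg] at h1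
  omega

/-- The Frobenius of `E / F` acting on the coefficients exchanges the two roots in `E[X]` of a
quadratic over `F[X]` without roots in `F[X]`. -/
lemma map_frobenius_eq_of_forall_ne_zero {F E : Type*} [Field F] [Fintype F] [Field E] [Algebra F E]
    {P Q : F[X]} (h : ∀ y, y ^ 2 + P * y + Q ≠ 0) {Y : E[X]}
    (hY : Y ^ 2 + P.map (algebraMap F E) * Y + Q.map (algebraMap F E) = 0) :
    Y.map (FiniteField.frobeniusAlgHom F E : E →+* E) = -P.map (algebraMap F E) - Y := by
  set σ := (FiniteField.frobeniusAlgHom F E : E →+* E) with hσ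
  have hfix : ∀ p : F[X], (p.map (algebraMap F E)).map σ = p.map (algebraMap F E) := fun p => by
    rw [Polynomial.map_map, hσ, AlgHom.comp_algebraMap]
  have hσY := congrArg (Polynomial.map σ) hY
  simp only [Polynomial.map_add, Polynomial.map_mul, Polynomial.map_pow, Polynomial.map_zero,
    hfix] at hσY
  rcases mul_eq_zero.1 (show (Y.map σ - Y) * (Y.map σ + Y + P.map (algebraMap F E)) = 0 by
    linear_combination hσY - hY) with h0 | h0
  · exfalso
    obtain ⟨y, rfl⟩ : ∃ y : F[X], y.map (algebraMap F E) = Y := by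
      rw [← mem_lifts, lifts_iff_coeff_lifts]
      intro i
      have := congrArg (coeff · i) (sub_eq_zero.1 h0)
      simp only [coeff_map] at this
      exact exists_algebraMap_eq_of_pow_card this
    refine h y (map_injective _ (algebraMap F E).injective ?_)
    simpa using hY
  · linear_combination h0

lemma surjective_ratEval {F E : Type} [Field F] [Fintype F] [Field E] [Algebra F E]
    {f g : F[X]} (hco : IsCoprime f g) (hdeg : max f.natDegree g.natDegree = 3)
    (h : Irreducible (quadResolvent (monicize (fiberPoly f g))))
    (hE : ¬ Irreducible (quadResolvent (monicize
      (fiberPoly (f.map (algebraMap F E)) (g.map (algebraMap F E)))))) :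
    Function.Surjective (ratEval f g) := by
  rw [irreducible_quadResolvent_iff hdeg] at h
  rw [irreducible_quadResolvent_iff (by simpa only [natDegree_map] using hdeg)] at hE
  push Not at hE
  obtain ⟨Y, hY⟩ := hE
  simp only [fiberCoeff_map] at hY
  have hle := natDegree_fiberCoeff_le f g
  have hPdeg := natDegree_resolventP_le (hle 3) (hle 2) (hle 1) (hle 0)
  have hQdeg := natDegree_resolventQ_le (hle 3) (hle 2) (hle 1) (hle 0)
  have hP2 := coeff_resolventP (hle 3) (hle 2) (hle 1) (hle 0)
  have hQ4 := coeff_resolventQ (hle 3) (hle 2) (hle 1) (hle 0)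
  have hPt := eval_resolventP (fiberCoeff f g 3) (fiberCoeff f g 2) (fiberCoeff f g 1)
    (fiberCoeff f g 0)
  have hQt := eval_resolventQ (fiberCoeff f g 3) (fiberCoeff f g 2) (fiberCoeff f g 1)
    (fiberCoeff f g 0)
  simp only [← coe_mapRingHom] at hY
  rw [← map_resolventP, ← map_resolventQ] at hY
  simp only [coe_mapRingHom] at hY
  generalize resolventP (fiberCoeff f g 3) (fiberCoeff f g 2) (fiberCoeff f g 1)
    (fiberCoeff f g 0) = P at *
  generalize resolventQ (fiberCoeff f g 3) (fiberCoeff f g 2) (fiberCoeff f g 1)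
    (fiberCoeff f g 0) = Q at *
  have hσ := map_frobenius_eq_of_forall_ne_zero h hY
  intro t
  rcases t with _ | t
  · have hYdeg : Y.natDegree ≤ 2 := natDegree_le_of_sq_add_mul_add_eq_zero (n := 2)
      (by simpa only [natDegree_map] using hPdeg) (by simpa only [natDegree_map] using hQdeg) hY
    obtain ⟨x, hx⟩ := exists_isProjRoot_of_pow_card_eq (E := E) (y := Y.coeff 2)
      (a := (fiberCoeff f g 3).coeff 1) (b := (fiberCoeff f g 2).coeff 1)
      (c := (fiberCoeff f g 1).coeff 1) (d := (fiberCoeff f g 0).coeff 1) (by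
        have h4 := congrArg (coeff · 4) hY
        have e1 : (Y ^ 2).coeff 4 = _ := coeff_pow_of_natDegree_le (n := 2) (m := 2) hYdeg
        have e2 : (P.map (algebraMap F E) * Y).coeff 4 = _ :=
          coeff_mul_add_eq_of_natDegree_le (natDegree_map_le.trans hPdeg) hYdeg
        simp only [coeff_add, e1, e2, coeff_map, coeff_zero, hP2, hQ4] at h4
        exact h4) (by
        have h2 := congrArg (coeff · 2) hσ
        simp only [coeff_map, coeff_sub, coeff_neg, hP2] at h2
        exact h2)
    refine ⟨x, (ratEval_eq_none_iff hdeg x).2 ?_⟩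
    simp only [coeff_one_fiberCoeff] at hx
    rcases x with _ | x
    · exact neg_eq_zero.1 hx
    · simp only [IsProjRoot] at hx ⊢
      linear_combination -hx
  · obtain ⟨x, hx⟩ := exists_isProjRoot_of_pow_card_eq (E := E) (y := Y.eval (algebraMap F E t))
      (a := (fiberCoeff f g 3).eval t) (b := (fiberCoeff f g 2).eval t)
      (c := (fiberCoeff f g 1).eval t) (d := (fiberCoeff f g 0).eval t) (by
        have h4 := congrArg (eval (algebraMap F E t)) hY
        simp only [eval_add, eval_mul, eval_pow, eval_map_algebraMap, aeval_algebraMap_apply,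
          eval_zero, coe_aeval_eq_eval, hPt, hQt] at h4
        exact h4) (by
        have h2 := congrArg (eval (algebraMap F E t)) hσ
        have hfr : (Y.map (FiniteField.frobeniusAlgHom F E : E →+* E)).eval (algebraMap F E t) =
            Y.eval (algebraMap F E t) ^ Fintype.card F := by
          have := eval₂_at_apply (p := Y) (FiniteField.frobeniusAlgHom F E : E →+* E)
            (algebraMap F E t)
          rw [← eval_map] at this
          simpa using this
        rw [hfr] at h2
        simp only [eval_sub, eval_neg, eval_map_algebraMap, aeval_algebraMap_apply,
          coe_aeval_eq_eval, hPt] at h2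
        exact h2)
    exact ⟨x, (ratEval_eq_some_iff hco hdeg t x).2 hx⟩

theorem stmt_3 (F : Type) [Field F] [Fintype F] (hq : 13 ≤ Fintype.card F)
    (f g : F[X]) (hco : IsCoprime f g) (hdeg : max f.natDegree g.natDegree = 3)
    (hsep : (fiberPoly f g).Separable) :
    Function.Bijective (ratEval f g) ↔
      (Irreducible (quadResolvent (monicize (fiberPoly f g))) ∧
        ∀ (E : Type) [Field E] [Algebra F E] [Fintype E],
          Fintype.card E = Fintype.card F ^ 2 →
          ¬ Irreducible (quadResolvent (monicize
            (fiberPoly (f.map (algebraMap F E)) (g.map (algebraMap F E)))))) := by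
  have hle := natDegree_fiberCoeff_le f g
  constructor
  · intro hbij
    obtain ⟨hns, htwist⟩ := isConstantTwist_of_existsUnique_isProjRoot (by omega) (hle 3) (hle 2)
      (hle 1) (hle 0) (fiberCoeff_three_ne_zero hdeg)
      (fun x h0 => by
        have e : fiberCoeff f g 3 * C x ^ 3 + fiberCoeff f g 2 * C x ^ 2 + fiberCoeff f g 1 * C x +
            fiberCoeff f g 0 = C (f.eval x) - C (g.eval x) * X := by
          rw [eval_eq_cubic (p := f) (by omega), eval_eq_cubic (p := g) (by omega)]
          simp only [fiberCoeff, C_add, C_mul, C_pow]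
          ring
        rw [e] at h0
        have hf := congrArg (coeff · 0) h0
        have hg := congrArg (coeff · 1) h0
        simp [coeff_C] at hf hg
        obtain ⟨u, v, huv⟩ := hco
        simpa [hf, hg] using congrArg (eval x) huv)
      (fun t => by
        simpa only [ratEval_eq_some_iff hco hdeg] using hbij.existsUnique (some t))
    refine ⟨(irreducible_quadResolvent_iff hdeg).2 fun y hy => ?_, fun E _ _ _ hE hirr => ?_⟩
    · obtain ⟨t, ht⟩ := exists_eval_ne_zero_of_natDegree_lt (resolventP_sq_sub_ne_zero hdeg hsep)
        (lt_of_le_of_lt (natDegree_sub_le_of_le (natDegree_pow_le_of_le 2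
          (natDegree_resolventP_le (hle 3) (hle 2) (hle 1) (hle 0)))
          (natDegree_mul_le_of_le (natDegree_ofNat 4).le
            (natDegree_resolventQ_le (hle 3) (hle 2) (hle 1) (hle 0)))) (by omega))
      refine hns t (y.eval t) (by simpa using ht) ?_
      simpa using congrArg (eval t) hy
    · obtain ⟨y, hy⟩ := htwist.exists_root hE
      refine (irreducible_quadResolvent_iff (by simpa only [natDegree_map] using hdeg)).1 hirr y ?_
      simp only [fiberCoeff_map]
      simp only [← coe_mapRingHom] at hy ⊢
      rwa [← map_resolventP, ← map_resolventQ]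
  · rintro ⟨hirr, hred⟩
    obtain ⟨p, hp⟩ := CharP.exists F
    have : Fact p.Prime := ⟨CharP.char_is_prime F p⟩
    have : Fintype (FiniteField.Extension F p 2) := Fintype.ofFinite _
    have hsurj := surjective_ratEval hco hdeg hirr (hred (FiniteField.Extension F p 2) (by
      rw [← Nat.card_eq_fintype_card, FiniteField.natCard_extension, Nat.card_eq_fintype_card]))
    exact ⟨Finite.injective_iff_surjective.2 hsurj, hsurj⟩

end
end
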